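/- Let f ∈ ℤ[X] be a polynomial of degree n ≥ 2 with nonzero discriminant D. Then f is GL₂(ℤ)-equivalent to a polynomial f* ∈ ℤ[X] whose height satisfies H(f*) ≤ exp((4²·n³)^(25n²)·|D|^(5n−3)). -/

import Mathlib

open Polynomial

/-- The Hermite form `[f]` of an integer polynomial viewed as degree `n`:
`f₀^(n-1) · ∏ᵢ (αᵢ^(n-1) X₁ + αᵢ^(n-2) X₂ + ⋯ + X_n)`, where the `αᵢ` are the
complex roots of `f` counted with multiplicity. -/
noncomputable def hermiteForm (n : ℕ) (f : Polynomial ℤ) : MvPolynomial (Fin n) ℂ :=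
  MvPolynomial.C ((f.leadingCoeff : ℂ) ^ (n - 1)) *
    (Multiset.map
      (fun α : ℂ => ∑ j : Fin n, MvPolynomial.C (α ^ (n - 1 - (j : ℕ))) * MvPolynomial.X j)
      ((f.map (Int.castRingHom ℂ)).roots)).prod

/-- `f` and `g`, viewed as degree-`n` polynomials, are Hermite equivalent if there are
`U ∈ GL_n(ℤ)` and `ε ∈ {1,-1}` with `[g](U·X) = ε·[f](X)`. -/
def HermiteEquiv (n : ℕ) (f g : Polynomial ℤ) : Prop :=
  ∃ (U : Matrix (Fin n) (Fin n) ℤ) (ε : ℤ), IsUnit U.det ∧ (ε = 1 ∨ ε = -1) ∧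
    MvPolynomial.bind₁
        (fun i : Fin n => ∑ j : Fin n, MvPolynomial.C ((U i j : ℂ)) * MvPolynomial.X j)
        (hermiteForm n g)
      = MvPolynomial.C ((ε : ℂ)) * hermiteForm n f

/-- The translate `(f∘M)(X) = ∑ₖ f_k (aX+b)^k (cX+d)^(n-k)` of `f`, viewed as a
degree-`n` polynomial, by the matrix `M = (a b; c d)`. -/
noncomputable def glTranslate (n : ℕ) (f : Polynomial ℤ) (M : Matrix (Fin 2) (Fin 2) ℤ) : Polynomial ℤ :=
  ∑ k ∈ Finset.range (n + 1),
    Polynomial.C (f.coeff k) * (Polynomial.C (M 0 0) * Polynomial.X + Polynomial.C (M 0 1)) ^ k *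
      (Polynomial.C (M 1 0) * Polynomial.X + Polynomial.C (M 1 1)) ^ (n - k)

/-- `f` and `g`, viewed as degree-`n` polynomials, are `GL₂(ℤ)`-equivalent if
`g = ±(f∘M)` for some `M ∈ GL₂(ℤ)`. -/
def GL2Equiv (n : ℕ) (f g : Polynomial ℤ) : Prop :=
  ∃ M : Matrix (Fin 2) (Fin 2) ℤ, IsUnit M.det ∧
    (g = glTranslate n f M ∨ g = -glTranslate n f M)

/-- The list of complex roots of `f`, counted with multiplicity (in some order). -/
noncomputable def rootList (f : Polynomial ℤ) : List ℂ :=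
  ((f.map (Int.castRingHom ℂ)).roots).toList

/-- The discriminant `D(f) = f₀^(2n-2) ∏_{i<j} (αᵢ - α_j)²` of `f` (as a complex number;
it is independent of the ordering of the roots since the product is symmetric). -/
noncomputable def discC (f : Polynomial ℤ) : ℂ :=
  (f.leadingCoeff : ℂ) ^ (2 * f.natDegree - 2) *
    ∏ p : Fin (rootList f).length × Fin (rootList f).length,
      if (p.1 : ℕ) < (p.2 : ℕ) then ((rootList f).get p.1 - (rootList f).get p.2) ^ 2 else 1

/-- `K_f := ℚ[X]/(f)`. -/
abbrev Kf (f : Polynomial ℤ) : Type := AdjoinRoot (f.map (Int.castRingHom ℚ))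

/-- The residue class `α` of `X` in `K_f`. -/
noncomputable def rootOf (f : Polynomial ℤ) : Kf f := AdjoinRoot.root _

/-- `ζᵢ = f₀ αⁱ + f₁ α^(i-1) + ⋯ + f_{i-1} α`, where `f_j` is the coefficient of
`X^(n-j)` in `f`. -/
noncomputable def zeta (f : Polynomial ℤ) (i : ℕ) : Kf f :=
  ∑ j ∈ Finset.range i, ((f.coeff (f.natDegree - j) : ℤ) : Kf f) * rootOf f ^ (i - j)

/-- The invariant module `I_f(k)`: the ℤ-span of `1, α, …, α^k, ζ_{k+1}, …, ζ_{n-1}`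
inside `K_f`.  In particular `R_f = I_f(0)` and `I_f = I_f(1)`. -/
noncomputable def invModule (f : Polynomial ℤ) (k : ℕ) : Submodule ℤ (Kf f) :=
  Submodule.span ℤ
    ({x | ∃ j ≤ k, x = rootOf f ^ j} ∪
     {x | ∃ i, k + 1 ≤ i ∧ i ≤ f.natDegree - 1 ∧ x = zeta f i})

/-- `f` and `g` are ℤ-equivalent: `g(X) = εⁿ f(εX + a)` with `ε = ±1`, `a ∈ ℤ`. -/
def ZEquiv (f g : Polynomial ℤ) : Prop :=
  ∃ ε a : ℤ, (ε = 1 ∨ ε = -1) ∧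
    g = Polynomial.C (ε ^ f.natDegree) * f.comp (Polynomial.C ε * Polynomial.X + Polynomial.C a)

/-- The `(n-2)`-th partial sum `a⁽ⁿ⁾(X) = ∑_{i=0}^{n-2} Cᵢ Xⁱ` of the Catalan
generating function. -/
noncomputable def aPoly (n : ℕ) : Polynomial ℤ :=
  ∑ i ∈ Finset.range (n - 1), Polynomial.C ((catalan i : ℤ)) * Polynomial.X ^ i

theorem card_mul_pred_le_two_mul_sum (s : Finset ℕ) :
    s.card * (s.card - 1) / 2 ≤ ∑ i ∈ s, i := by
  rw [← Finset.sum_range_id]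
  induction h : s.card generalizing s with
  | zero => simp
  | succ k ih =>
    have hne : s.Nonempty := Finset.card_pos.mp (by omega)
    have hk := ih (s.erase (s.max' hne)) (by rw [Finset.card_erase_of_mem (s.max'_mem hne), h]; rfl)
    rw [Finset.sum_range_succ, ← Finset.sum_erase_add s _ (s.max'_mem hne)]
    have hmax : k ≤ s.max' hne := by
      have hsub : s ⊆ Finset.range (s.max' hne + 1) := fun x hx =>
        Finset.mem_range.mpr (Nat.lt_succ_of_le (s.le_max' x hx))
      have := Finset.card_le_card hsub
      rw [h, Finset.card_range] at this
      omega
    omega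

/-- If each row with index in `I` is `X`-adically a combination of vectors `c m` with coefficient
divisible by `X ^ m`, then the determinant is divisible by `X ^ (#I * (#I - 1) / 2)`. -/
theorem pow_dvd_det_of_rows {A ι : Type*} [CommRing A] [Fintype ι] [DecidableEq ι]
    (I : Finset ι) (X : A) (M : Matrix ι ι A) (a : ι → ℕ → A) (c : ℕ → ι → A) (d : ι → ι → A)
    (T : ℕ) (hT : I.card * (I.card - 1) / 2 = T)
    (hM : ∀ i ∈ I, ∀ j, M i j = ∑ m ∈ Finset.range T, X ^ m * a i m * c m j + X ^ T * d i j) :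
    X ^ T ∣ M.det := by
  classical
  let v : ι → ℕ → (ι → A) := fun i m =>
    if i ∈ I then (if m < T then (X ^ m * a i m) • c m else X ^ T • d i) else M i
  let S : ι → Finset ℕ := fun i => if i ∈ I then Finset.range (T + 1) else {0}
  have hrow : M = fun i => ∑ m ∈ S i, v i m := by
    funext i
    by_cases hi : i ∈ I
    · funext j
      simp only [S, v, hi, if_true, Finset.sum_range_succ, hM i hi j, Finset.sum_apply,
        lt_irrefl, if_false, Pi.smul_apply, smul_eq_mul, add_left_inj]
      refine Finset.sum_congr rfl fun m hm => ?_
      simp [Finset.mem_range.mp hm]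
    · simp [S, v, hi]
  have hdet : M.det = ∑ r ∈ Fintype.piFinset S, Matrix.det (fun i => v i (r i)) := by
    conv_lhs => rw [hrow]
    exact (Matrix.detRowAlternating (R := A) (n := ι)).toMultilinearMap.map_sum_finset v S
  rw [hdet]
  refine Finset.dvd_sum fun r hr => ?_
  rw [Fintype.mem_piFinset] at hr
  let u : ι → A := fun i => if i ∈ I then X ^ (r i) else 1
  let w : Matrix ι ι A := fun i => if i ∈ I then (if r i < T then a i (r i) • c (r i) else d i) else M i
  have huw : (fun i => v i (r i)) = Matrix.of fun i j => u i * w i j := by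
    funext i j
    by_cases hi : i ∈ I
    · have h1 := hr i
      simp only [S, hi, if_true, Finset.mem_range] at h1
      by_cases h2 : r i < T
      · simp [v, u, w, hi, h2, mul_assoc]
      · have : r i = T := by omega
        simp [v, u, w, hi, this]
    · simp [v, u, w, hi]
  have hdet2 : Matrix.det (fun i => v i (r i)) = (∏ i ∈ I, X ^ (r i)) * Matrix.det w := by
    rw [huw]
    refine (Matrix.det_mul_column u w).trans ?_
    congr 1
    simp [u, Finset.prod_ite_mem]
  by_cases hex : ∃ i ∈ I, T ≤ r i
  · obtain ⟨i, hi, hTi⟩ := hex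
    rw [hdet2]
    exact ((pow_dvd_pow X hTi).trans (Finset.dvd_prod_of_mem (fun i => X ^ (r i)) hi)).mul_right _
  push Not at hex
  by_cases hinj : Set.InjOn r I
  · rw [hdet2, Finset.prod_pow_eq_pow_sum]
    refine (pow_dvd_pow X ?_).mul_right _
    rw [← hT, ← Finset.card_image_of_injOn hinj, ← Finset.sum_image (f := fun x => x) hinj]
    exact card_mul_pred_le_two_mul_sum _
  · simp only [Set.InjOn, not_forall] at hinj
    obtain ⟨i, hi, j, hj, hij, hne⟩ := hinj
    have hzero : Matrix.det w = 0 := by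
      have hi' : i ∈ I := hi
      have hj' : j ∈ I := hj
      let u' : ι → A := fun k => if k ∈ I then (if r k < T then a k (r k) else 1) else 1
      let w' : Matrix ι ι A := fun k l =>
        if k ∈ I then (if r k < T then c (r k) l else d k l) else M k l
      have hw : w = Matrix.of fun k l => u' k * w' k l := by
        funext k l
        by_cases hk : k ∈ I <;> by_cases hk2 : r k < T <;> simp [w, u', w', hk, hk2]
      have hrow : w' i = w' j := by
        funext l
        simp [w', hi', hj', hex j hj', hij]
      rw [hw]
      refine (Matrix.det_mul_column u' w').trans ?_
      rw [Matrix.det_zero_of_row_eq hne hrow, mul_zero]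
    rw [hdet2, hzero, mul_zero]
    exact dvd_zero _

/-- Taylor expansion of an entire function with entire remainder. -/
theorem Differentiable.exists_taylor {g : ℂ → ℂ} (hg : Differentiable ℂ g) (T : ℕ) :
    ∃ (p : ℕ → ℂ) (q : ℂ → ℂ), Differentiable ℂ q ∧
      ∀ y, g y = ∑ m ∈ Finset.range T, y ^ m * p m + y ^ T * q y := by
  induction T with
  | zero => exact ⟨0, g, hg, by simp⟩
  | succ T ih =>
    obtain ⟨p, q, hq, h⟩ := ih
    have hd : Differentiable ℂ (dslope q 0) := by
      rw [← differentiableOn_univ] at hq ⊢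
      exact (Complex.differentiableOn_dslope Filter.univ_mem).mpr hq
    refine ⟨fun m => if m = T then q 0 else p m, dslope q 0, hd, fun y => ?_⟩
    have hy : q y = q 0 + y * dslope q 0 y := by
      have := sub_smul_dslope q 0 y
      simp only [sub_zero, smul_eq_mul] at this
      rw [this]; ring
    rw [h y, Finset.sum_range_succ, hy]
    have : ∑ m ∈ Finset.range T, y ^ m * (if m = T then q 0 else p m)
        = ∑ m ∈ Finset.range T, y ^ m * p m :=
      Finset.sum_congr rfl fun m hm => by rw [if_neg (Finset.mem_range.mp hm).ne]
    rw [this]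
    simp
    ring

/-- The ring of entire functions. -/
def entireSubring : Subring (ℂ → ℂ) where
  carrier := {f | Differentiable ℂ f}
  mul_mem' hf hg := Differentiable.mul hf hg
  one_mem' := differentiable_const 1
  add_mem' hf hg := Differentiable.add hf hg
  zero_mem' := differentiable_const 0
  neg_mem' hf := Differentiable.neg hf

theorem norm_det_le_of_forall_norm_le {ι : Type*} [Fintype ι] [DecidableEq ι]
    (M : Matrix ι ι ℂ) (b : ι → ℝ) (h : ∀ i j, ‖M i j‖ ≤ b i) :
    ‖M.det‖ ≤ (Fintype.card ι).factorial * ∏ i, b i := by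
  rw [← Matrix.det_transpose, Matrix.det_apply']
  refine (norm_sum_le _ _).trans ?_
  have : ∀ σ ∈ (Finset.univ : Finset (Equiv.Perm ι)),
      ‖((Equiv.Perm.sign σ : ℤ) : ℂ) * ∏ i, M.transpose (σ i) i‖ ≤ ∏ i, b i := by
    intro σ _
    rw [norm_mul, norm_prod]
    have h1 : ‖((Equiv.Perm.sign σ : ℤ) : ℂ)‖ = 1 := by
      rcases Int.units_eq_one_or (Equiv.Perm.sign σ) with h | h <;> simp [h]
    rw [h1, one_mul]
    exact Finset.prod_le_prod (fun _ _ => norm_nonneg _) fun i _ => h i (σ i)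
  refine (Finset.sum_le_card_nsmul _ _ _ this).trans ?_
  rw [Finset.card_univ, Fintype.card_perm, nsmul_eq_mul]

theorem norm_det_le_of_entire_rows {ι : Type*} [Fintype ι] [DecidableEq ι] (I : Finset ι)
    (g : ι → ℂ → ℂ) (hg : ∀ j, Differentiable ℂ (g j)) (z : ι → ℂ) (c : ι → ι → ℂ)
    {E B ε : ℝ} (hE : 1 ≤ E)
    (hB : ∀ i ∈ I, ∀ j, ∀ x : ℂ, ‖x‖ = E → ‖g j (x * z i)‖ ≤ B)
    (hc : ∀ i ∉ I, ∀ j, ‖c i j‖ ≤ ε) :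
    ‖(Matrix.of fun i j => if i ∈ I then g j (z i) else c i j).det‖ ≤
      (Fintype.card ι).factorial * (B ^ I.card * ε ^ Iᶜ.card) /
        E ^ (I.card * (I.card - 1) / 2) := by
  set T := I.card * (I.card - 1) / 2 with hT
  choose p q hq hpq using fun j => (hg j).exists_taylor T
  let N : Matrix ι ι entireSubring := Matrix.of fun i j =>
    if i ∈ I then (⟨fun x => g j (x * z i), (hg j).comp (differentiable_id.mul_const _)⟩ : entireSubring)
    else ⟨fun _ => c i j, differentiable_const _⟩
  let Y : entireSubring := ⟨fun x => x, differentiable_id⟩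
  have hdvd : Y ^ T ∣ N.det := by
    refine pow_dvd_det_of_rows I Y N (fun i m => ⟨fun _ => z i ^ m, differentiable_const _⟩)
      (fun m j => ⟨fun _ => p j m, differentiable_const _⟩)
      (fun i j => ⟨fun x => z i ^ T * q j (x * z i),
        ((hq j).comp (differentiable_id.mul_const _)).const_mul _⟩) T hT.symm ?_
    intro i hi j
    apply Subtype.ext
    funext x
    simp only [N, Y, Matrix.of_apply, hi, if_true, Subring.coe_add, Subring.coe_mul,
      Pi.add_apply, Pi.mul_apply, Subring.coe_pow, Pi.pow_apply]
    rw [hpq j, AddSubmonoidClass.coe_finsetSum, Finset.sum_apply]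
    congr 1
    · refine Finset.sum_congr rfl fun m _ => ?_
      simp [mul_pow]
    · ring
  obtain ⟨h, hh⟩ := hdvd
  have heval : ∀ x : ℂ, (Matrix.of fun i j => if i ∈ I then g j (x * z i) else c i j).det
      = x ^ T * h.1 x := by
    intro x
    have h1 := congrArg ((Pi.evalRingHom (fun _ : ℂ => ℂ) x).comp entireSubring.subtype) hh
    rw [RingHom.map_det] at h1
    convert h1 using 2
    · ext i j
      by_cases hi : i ∈ I <;> simp [N, hi]
    · simp [Y]
  have hE0 : 0 < E := by linarith
  have hbound : ∀ x : ℂ, ‖x‖ = E →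
      ‖h.1 x‖ ≤ (Fintype.card ι).factorial * (B ^ I.card * ε ^ Iᶜ.card) / E ^ T := by
    intro x hx
    rw [le_div_iff₀ (by positivity), mul_comm, ← hx, ← norm_pow, ← norm_mul, ← heval]
    refine (norm_det_le_of_forall_norm_le _ (fun i => if i ∈ I then B else ε) ?_).trans ?_
    · intro i j
      by_cases hi : i ∈ I
      · simpa [hi] using hB i hi j x hx
      · simpa [hi] using hc i hi j
    · rw [Finset.prod_ite, Finset.prod_const, Finset.prod_const]
      simp [Finset.filter_not, Finset.compl_eq_univ_sdiff]
  have hmain : ‖h.1 1‖ ≤ (Fintype.card ι).factorial * (B ^ I.card * ε ^ Iᶜ.card) / E ^ T := by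
    refine Complex.norm_le_of_forall_mem_frontier_norm_le (U := Metric.ball 0 E)
      Metric.isBounded_ball (Differentiable.diffContOnCl h.2) ?_ ?_
    · intro x hx
      rw [frontier_ball _ hE0.ne'] at hx
      exact hbound x (by simpa using hx)
    · rw [closure_ball _ hE0.ne']
      simpa using hE
  have h1 := heval 1
  simp only [one_mul, one_pow] at h1
  rw [h1]
  exact hmain

/-- Upper bound for a perturbed interpolation determinant. -/
theorem norm_det_le_of_perturbed_entire {ι : Type*} [Fintype ι] [DecidableEq ι]
    (g : ι → ℂ → ℂ) (hg : ∀ j, Differentiable ℂ (g j)) (z : ι → ℂ) (ε : ι → ι → ℂ)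
    {E B : ℝ} (hE : 1 ≤ E) (hB0 : 0 ≤ B)
    (hB : ∀ i j, ∀ x : ℂ, ‖x‖ ≤ E → ‖g j (x * z i)‖ ≤ B)
    (hε : ∀ i j, ‖ε i j‖ ≤ 1 / E ^ Fintype.card ι) :
    ‖(Matrix.of fun i j => g j (z i) * (1 + ε i j)).det‖ ≤
      2 ^ Fintype.card ι * ((Fintype.card ι).factorial * B ^ Fintype.card ι) /
        E ^ (Fintype.card ι * (Fintype.card ι - 1) / 2) := by
  set n := Fintype.card ι with hn
  have hE0 : 0 < E := by linarith
  have hsplit : (Matrix.of fun i j => g j (z i) * (1 + ε i j)).det =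
      ∑ I : Finset ι, (Matrix.of fun i j =>
        if i ∈ I then g j (z i) else g j (z i) * ε i j).det := by
    have := (Matrix.detRowAlternating (R := ℂ) (n := ι)).toMultilinearMap.map_add_univ
      (fun i j => g j (z i)) (fun i j => g j (z i) * ε i j)
    convert this using 2
    · simp [Matrix.detRowAlternating, mul_add]
      rfl
    · rename_i I _
      change Matrix.det _ = Matrix.det _
      congr 1
      ext i j
      by_cases hi : i ∈ I <;> simp [hi, Finset.piecewise]
  rw [hsplit]
  refine (norm_sum_le _ _).trans ?_
  have hterm : ∀ I ∈ (Finset.univ : Finset (Finset ι)), ‖(Matrix.of fun i j =>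
      if i ∈ I then g j (z i) else g j (z i) * ε i j).det‖ ≤
      (n.factorial * B ^ n) / E ^ (n * (n - 1) / 2) := by
    intro I _
    refine (norm_det_le_of_entire_rows I g hg z (fun i j => g j (z i) * ε i j) (B := B)
      (ε := B * (1 / E ^ n)) hE (fun i _ j x hx => hB i j x hx.le) ?_).trans ?_
    · intro i _ j
      rw [norm_mul]
      have := hB i j 1 (by simpa using hE)
      rw [one_mul] at this
      exact mul_le_mul this (hε i j) (norm_nonneg _) hB0
    · have hc : I.card + Iᶜ.card = n := Finset.card_add_card_compl I
      set i := I.card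
      set k := Iᶜ.card
      rw [mul_pow, ← mul_assoc (B ^ i), ← pow_add, hc, one_div, inv_pow, ← pow_mul,
        ← mul_assoc, ← div_eq_mul_inv, div_div, ← pow_add]
      have hexp : n * (n - 1) / 2 ≤ n * k + i * (i - 1) / 2 := by
        have h2 : n * (n - 1) ≤ 2 * (n * k) + i * (i - 1) := by
          rcases Nat.eq_zero_or_pos i with hi | hi
          · have hk : k = n := by omega
            have := Nat.mul_le_mul_left n (Nat.sub_le n 1)
            rw [hk]
            omega
          · obtain ⟨i', hi'⟩ : ∃ i', i = i' + 1 := ⟨i - 1, by omega⟩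
            rw [← hc, hi']
            have h3 : i' + 1 + k - 1 = i' + k := by omega
            rw [h3, Nat.add_sub_cancel]
            nlinarith [sq_nonneg (k : ℤ), Nat.zero_le k]
        omega
      gcongr
  refine (Finset.sum_le_card_nsmul _ _ _ hterm).trans ?_
  rw [Finset.card_univ, Fintype.card_finset, nsmul_eq_mul, ← hn]
  push_cast
  exact le_of_eq (by ring)

open Polynomial

/-- If the columns of `v` (seen as a matrix) are linearly independent, some maximal minor is
nonzero. -/
theorem exists_det_submatrix_ne_zero {F ρ ι : Type*} [Field F] [Fintype ι] [DecidableEq ι]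
    (v : ρ → ι → F) (h : ∀ c : ι → F, (∀ i, ∑ j, v i j * c j = 0) → c = 0) :
    ∃ e : ι → ρ, (Matrix.of fun i j => v (e i) j).det ≠ 0 := by
  obtain ⟨κ, a, -, hspan, hli⟩ := exists_linearIndependent' F v
  have htop : Submodule.span F (Set.range v) = ⊤ := by
    by_contra hne
    obtain ⟨φ, hφ, hle⟩ := Submodule.exists_le_ker_of_lt_top _ (lt_top_iff_ne_top.mpr hne)
    apply hφ
    have hφv : ∀ x : ι → F, φ x = ∑ j, x j * φ (Pi.single j 1) := by
      intro x
      conv_lhs => rw [pi_eq_sum_univ' x]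
      simp [map_sum]
    have := h (fun j => φ (Pi.single j 1)) fun i => by
      rw [← hφv]
      exact hle (Submodule.subset_span ⟨i, rfl⟩)
    ext j
    simpa using congrFun this j
  rw [← hspan] at htop
  let b := Module.Basis.mk hli htop.ge
  let σ : ι ≃ κ := (Pi.basisFun F ι).indexEquiv b
  refine ⟨a ∘ σ, ?_⟩
  have hli2 : LinearIndependent F (fun i => v (a (σ i))) := hli.comp σ σ.injective
  have := Matrix.linearIndependent_rows_iff_isUnit (A := Matrix.of fun i j => v (a (σ i)) j) |>.mp hli2
  exact ((Matrix.isUnit_iff_isUnit_det _).mp this).ne_zero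

/-- The coefficient of a determinant of nonzero polynomials whose degrees depend only on the
column. -/
theorem Polynomial.coeff_det_of_natDegree_eq {F ι : Type*} [Field F] [Fintype ι] [DecidableEq ι]
    (A : Matrix ι ι F[X]) (d : ι → ℕ) (hd : ∀ i j, (A i j).natDegree = d j)
    (h0 : ∀ i j, A i j ≠ 0) :
    A.det.coeff (∑ j, d j) = (A.map leadingCoeff).det := by
  rw [Matrix.det_apply, Matrix.det_apply, finsetSum_coeff]
  refine Finset.sum_congr rfl fun σ _ => ?_
  rw [coeff_smul]
  congr 1
  have h1 : (∏ i, A (σ i) i).natDegree = ∑ j, d j := by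
    rw [natDegree_prod _ _ fun i _ => h0 _ _]
    exact Finset.sum_congr rfl fun i _ => hd _ _
  rw [← h1, coeff_natDegree, leadingCoeff_prod]
  rfl

/-- Zero estimate on the group `𝔾ₐ × 𝔾ₘ`. -/
theorem eq_zero_of_forall_eval_eq_zero {F : Type*} [Field F] [CharZero F] {η α : F} (hη0 : η ≠ 0)
    (hα : α ≠ 0) (hη : ∀ m : ℕ, 0 < m → η ^ m ≠ 1) {K L R S N : ℕ} (hRN : R ≤ N)
    (hKL : K * L ≤ R * S) (P : Fin L → F[X]) (hP : ∀ l, (P l).degree < K)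
    (hz : ∀ r s : ℕ, r < R + L → s < S →
      ∑ l, (P l).eval ((r + N * s : ℕ) : F) * (η ^ r * α ^ s) ^ (l : ℕ) = 0) :
    P = 0 := by
  classical
  by_contra hne
  let J : Finset (Fin L) := Finset.univ.filter fun l => P l ≠ 0
  set m := J.card with hm
  let e := J.orderEmbOfFin hm.symm
  have heJ : ∀ i, P (e i) ≠ 0 := fun i => by
    exact (Finset.mem_filter.mp (J.orderEmbOfFin_mem hm.symm i)).2
  have hmpos : 0 < m := by
    obtain ⟨l, hl⟩ := Function.ne_iff.mp hne
    exact Finset.card_pos.mpr ⟨l, by simpa [J] using hl⟩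
  have hmL : m ≤ L := by
    have := Finset.card_le_univ J
    simpa using this
  have hη0p : ∀ a : ℕ, η ^ a ≠ 0 := fun a => pow_ne_zero _ hη0
  let A : Matrix (Fin m) (Fin m) F[X] := Matrix.of fun r l =>
    C ((η ^ (e l : ℕ)) ^ (r : ℕ)) * (P (e l)).comp (X + C ((r : ℕ) : F))
  have hA0 : ∀ r l, A r l ≠ 0 := fun r l => by
    refine mul_ne_zero (by simpa using fun h => absurd h hη0) ?_
    intro h
    refine (comp_eq_zero_iff.mp h).elim (heJ l) fun h => ?_
    have := congrArg natDegree h.2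
    rw [natDegree_X_add_C, natDegree_C] at this
    omega
  have hAd : ∀ r l, (A r l).natDegree = (P (e l)).natDegree := fun r l => by
    simp only [A, Matrix.of_apply]
    rw [natDegree_C_mul (by simpa using fun h => absurd h hη0), natDegree_comp, natDegree_X_add_C, mul_one]
  have hdet0 : A.det ≠ 0 := by
    intro h0
    have h1 := Polynomial.coeff_det_of_natDegree_eq A _ hAd hA0
    rw [h0, coeff_zero] at h1
    have h2 : A.map leadingCoeff = Matrix.of fun r l =>
        (P (e l)).leadingCoeff * (Matrix.vandermonde fun l => η ^ (e l : ℕ)).transpose r l := by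
      ext r l
      simp only [A, Matrix.map_apply, Matrix.of_apply, Matrix.transpose_apply,
        Matrix.vandermonde_apply]
      rw [leadingCoeff_mul, leadingCoeff_C, leadingCoeff_comp (by rw [natDegree_X_add_C]; exact one_ne_zero),
        leadingCoeff_X_add_C, one_pow, mul_one, mul_comm]
    rw [h2, Matrix.det_mul_row, Matrix.det_transpose] at h1
    refine mul_ne_zero ?_ ?_ h1.symm
    · exact Finset.prod_ne_zero_iff.mpr fun l _ => leadingCoeff_ne_zero.mpr (heJ l)
    · rw [Matrix.det_vandermonde_ne_zero_iff]
      have key : ∀ a b : ℕ, a < b → η ^ a ≠ η ^ b := by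
        intro a b hab h
        apply hη (b - a) (by omega)
        have : η ^ b = η ^ a * η ^ (b - a) := by rw [← pow_add]; congr 1; omega
        rw [this] at h
        exact mul_left_cancel₀ (hη0p a) (by rw [← h, mul_one])
      intro i j hij
      apply e.injective
      apply Fin.ext
      rcases lt_trichotomy (e i : ℕ) (e j) with h | h | h
      · exact absurd hij (key _ _ h)
      · exact h
      · exact absurd hij.symm (key _ _ h)
  have hdeg : A.det.natDegree < R * S := by
    have hK : ∀ l, (P (e l)).natDegree + 1 ≤ K := fun l => by
      have := (natDegree_lt_iff_degree_lt (heJ l)).mpr (hP (e l))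
      omega
    have h1 : A.det.natDegree ≤ ∑ l, (P (e l)).natDegree := by
      rw [Matrix.det_apply]
      refine natDegree_sum_le_of_forall_le _ _ fun σ _ => ?_
      refine (natDegree_smul_le _ _).trans ((natDegree_prod_le _ _).trans ?_)
      exact Finset.sum_le_sum fun i _ => (hAd _ _).le
    have h2 : ∑ l : Fin m, ((P (e l)).natDegree + 1) ≤ m * K := by
      refine (Finset.sum_le_sum fun l _ => hK l).trans ?_
      simp
    rw [Finset.sum_add_distrib] at h2
    simp only [Finset.sum_const, Finset.card_univ, Fintype.card_fin, smul_eq_mul, mul_one] at h2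
    have h3 : m * K ≤ K * L := by rw [mul_comm]; exact Nat.mul_le_mul_left _ hmL
    omega
  let pts : Finset F := (Finset.range R ×ˢ Finset.range S).image
    fun p => ((p.1 + N * p.2 : ℕ) : F)
  have hcard : pts.card = R * S := by
    rw [Finset.card_image_of_injOn, Finset.card_product, Finset.card_range, Finset.card_range]
    rintro ⟨r, s⟩ h1 ⟨r', s'⟩ h2 h
    simp only [Finset.coe_product, Finset.coe_range, Set.mem_prod, Set.mem_Iio] at h1 h2
    have h' : r + N * s = r' + N * s' := Nat.cast_injective h
    have hr := Nat.mod_eq_of_lt (h1.1.trans_le hRN)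
    have hr' := Nat.mod_eq_of_lt (h2.1.trans_le hRN)
    have e1 : r = r' := by
      rw [← hr, ← hr', ← Nat.add_mul_mod_self_left r N s, h', Nat.add_mul_mod_self_left]
    subst e1
    have hN : 0 < N := by omega
    have := Nat.eq_of_mul_eq_mul_left hN (Nat.add_left_cancel h')
    rw [this]
  refine hdet0 (eq_zero_of_natDegree_lt_card_of_eval_eq_zero' _ pts ?_ (by rwa [hcard]))
  intro x hx
  obtain ⟨⟨r, s⟩, hrs, rfl⟩ := Finset.mem_image.mp hx
  simp only [Finset.mem_product, Finset.mem_range] at hrs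
  have hev : (A.det).eval ((r + N * s : ℕ) : F) =
      (A.map (eval ((r + N * s : ℕ) : F))).det := by
    have := RingHom.map_det (evalRingHom ((r + N * s : ℕ) : F)) A
    simpa using this
  rw [hev]
  refine Matrix.exists_mulVec_eq_zero_iff.mp
    ⟨fun l => (η ^ r * α ^ s) ^ (e l : ℕ), fun h => ?_, ?_⟩
  · have := congrFun h ⟨0, hmpos⟩
    simp [hη0, hα] at this
  · funext r1
    have h1 := hz (r + r1) s (by omega) hrs.2
    have h2 : ∑ l ∈ J, (P l).eval ((r + r1 + N * s : ℕ) : F) * (η ^ (r + r1 : ℕ) * α ^ s) ^ (l : ℕ)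
        = 0 := by
      rw [← h1]
      refine Finset.sum_subset (Finset.subset_univ _) fun l _ hl => ?_
      have : P l = 0 := by simpa [J] using hl
      simp [this]
    rw [← Finset.map_orderEmbOfFin_univ J hm.symm, Finset.sum_map] at h2
    simp only [Matrix.mulVec, dotProduct, Pi.zero_apply]
    rw [← h2]
    refine Finset.sum_congr rfl fun l _ => ?_
    simp only [A, Matrix.map_apply, Matrix.of_apply, eval_mul, eval_C, eval_comp, eval_add, eval_X]
    have : ((r + N * s : ℕ) : F) + ((r1 : ℕ) : F) = ((r + r1 + N * s : ℕ) : F) := by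
      push_cast; ring
    rw [this, mul_pow, mul_pow]
    simp only [← pow_mul]
    simp only [RelEmbedding.coe_toEmbedding, e]
    ring_nf

/-- The polynomial `X (X - 1) ⋯ (X - k + 1) / k!`. -/
noncomputable def choosePoly (F : Type*) [Field F] (k : ℕ) : F[X] :=
  C ((k.factorial : F)⁻¹) * descPochhammer F k

theorem choosePoly_eval_natCast {F : Type*} [Field F] [CharZero F] (k z : ℕ) :
    (choosePoly F k).eval (z : F) = z.choose k := by
  rw [choosePoly, eval_mul, eval_C, descPochhammer_eval_eq_descFactorial,
    Nat.descFactorial_eq_factorial_mul_choose, Nat.cast_mul, inv_mul_cancel_left₀]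
  exact_mod_cast k.factorial_ne_zero

theorem choosePoly_degree {F : Type*} [Field F] [CharZero F] (k : ℕ) :
    (choosePoly F k).degree = k := by
  have h : ((k.factorial : F)⁻¹) ≠ 0 := inv_ne_zero (by exact_mod_cast k.factorial_ne_zero)
  rw [choosePoly, degree_C_mul h, degree_eq_natDegree (monic_descPochhammer F k).ne_zero,
    descPochhammer_natDegree]

theorem exists_interpolation_det_ne_zero {F : Type*} [Field F] [CharZero F] {η α : F}
    (hη0 : η ≠ 0) (hα : α ≠ 0) (hη : ∀ m : ℕ, 0 < m → η ^ m ≠ 1) {K L R S N : ℕ} (hRN : R ≤ N)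
    (hKL : K * L ≤ R * S) :
    ∃ r s : Fin K × Fin L → ℕ, (∀ i, r i < R + L) ∧ (∀ i, s i < S) ∧
      (Matrix.of fun i j : Fin K × Fin L =>
        (((r i + N * s i).choose j.1 : ℕ) : F) * (η ^ r i * α ^ s i) ^ (j.2 : ℕ)).det ≠ 0 := by
  suffices h : ∀ c : Fin K × Fin L → F, (∀ i : Fin (R + L) × Fin S,
      ∑ j : Fin K × Fin L, ((((i.1 : ℕ) + N * i.2).choose j.1 : ℕ) : F) *
        (η ^ (i.1 : ℕ) * α ^ (i.2 : ℕ)) ^ (j.2 : ℕ) * c j = 0) → c = 0 by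
    obtain ⟨e, he⟩ := exists_det_submatrix_ne_zero _ h
    exact ⟨fun i => (e i).1, fun i => (e i).2, fun i => (e i).1.2, fun i => (e i).2.2, he⟩
  intro c hc
  have hdeg : ∀ l : Fin L, (∑ k : Fin K, C (c (k, l)) * choosePoly F k).degree < K := by
    intro l
    refine (degree_sum_le _ _).trans_lt ?_
    refine (Finset.sup_lt_iff (WithBot.bot_lt_coe K)).mpr fun k _ => ?_
    refine (degree_mul_le _ _).trans_lt ?_
    rw [choosePoly_degree]
    refine (add_le_add_left degree_C_le _).trans_lt ?_
    rw [zero_add]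
    exact Nat.cast_lt.mpr k.2
  have h := eq_zero_of_forall_eval_eq_zero hη0 hα hη hRN hKL
    (fun l => ∑ k : Fin K, C (c (k, l)) * choosePoly F k) hdeg ?_
  · let sq : Polynomial.Sequence F := ⟨choosePoly F, fun i => choosePoly_degree i⟩
    have hli : LinearIndependent F (fun k : Fin K => choosePoly F k) :=
      sq.linearIndependent.comp (fun k : Fin K => (k : ℕ)) Fin.val_injective
    funext ⟨k, l⟩
    refine Fintype.linearIndependent_iff.mp hli (fun k => c (k, l)) ?_ k
    have := congrFun h l
    simpa [smul_eq_C_mul] using this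
  · intro r s hr hs
    have := hc (⟨r, hr⟩, ⟨s, hs⟩)
    rw [← this, Fintype.sum_prod_type_right]
    refine Finset.sum_congr rfl fun l _ => ?_
    rw [eval_finsetSum, Finset.sum_mul]
    refine Finset.sum_congr rfl fun k _ => ?_
    rw [eval_mul, eval_C, choosePoly_eval_natCast]
    ring

open Polynomial

theorem NumberField.one_le_prod_norm_of_isIntegral {F : Type*} [Field F] [NumberField F] {x : F}
    (hx : IsIntegral ℤ x) (h0 : x ≠ 0) : 1 ≤ ∏ ψ : F →+* ℂ, ‖ψ x‖ := by
  have h1 := Algebra.norm_eq_prod_embeddings ℚ ℂ x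
  have h2 : ∏ ψ : F →+* ℂ, ‖ψ x‖ = ‖((Algebra.norm ℚ x : ℚ) : ℂ)‖ := by
    have e : (algebraMap ℚ ℂ) (Algebra.norm ℚ x) = ((Algebra.norm ℚ x : ℚ) : ℂ) := rfl
    rw [← e, h1, norm_prod]
    exact (Fintype.prod_equiv (RingHom.equivRatAlgHom F ℂ) _ _ fun ψ => rfl)
  obtain ⟨m, hm⟩ := IsIntegrallyClosed.isIntegral_iff.mp (Algebra.isIntegral_norm ℚ hx)
  have hm0 : m ≠ 0 := by
    rintro rfl
    rw [map_zero] at hm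
    exact h0 (Algebra.norm_eq_zero_iff.mp hm.symm)
  rw [h2, ← hm]
  simp only [algebraMap_int_eq, eq_intCast, Rat.cast_intCast, Complex.norm_intCast]
  exact_mod_cast Int.one_le_abs hm0

theorem pow_div_factorial_mono {Y : ℝ} {k K : ℕ} (hkK : k ≤ K) (hY : (K : ℝ) ≤ Y) :
    Y ^ k / k.factorial ≤ Y ^ K / K.factorial := by
  have hY0 : 0 ≤ Y := le_trans (Nat.cast_nonneg K) hY
  induction K, hkK using Nat.le_induction with
  | base => exact le_rfl
  | succ m _ ih =>
    refine (ih (le_trans (by push_cast; linarith) hY)).trans ?_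
    rw [pow_succ, Nat.factorial_succ, Nat.cast_mul, mul_comm (_ : ℝ) (m.factorial : ℝ),
      mul_div_mul_comm]
    exact le_mul_of_one_le_right (by positivity) ((one_le_div (by positivity)).mpr hY)

theorem norm_choosePoly_eval_le {k K : ℕ} (hK : 0 < K) (hkK : k ≤ K) {Y : ℝ} {w : ℂ}
    (hw : ‖w‖ ≤ Y) :
    ‖(choosePoly ℂ k).eval w‖ ≤ (Real.exp 1 * (Y / K + 1)) ^ K := by
  have hY0 : 0 ≤ Y := (norm_nonneg _).trans hw
  have hK' : (0 : ℝ) < K := Nat.cast_pos.mpr hK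
  have h1 : ‖(choosePoly ℂ k).eval w‖ ≤ (Y + K) ^ k / k.factorial := by
    rw [choosePoly, eval_mul, eval_C, norm_mul, norm_inv, Complex.norm_natCast,
      descPochhammer_eval_eq_prod_range, norm_prod, inv_mul_eq_div]
    gcongr
    refine (Finset.prod_le_prod (fun _ _ => norm_nonneg _) (fun j hj => ?_)).trans_eq
      (b := ∏ j ∈ Finset.range k, (Y + K)) (by simp)
    refine (norm_sub_le _ _).trans ?_
    have : j < K := (Finset.mem_range.mp hj).trans_le hkK
    rw [Complex.norm_natCast]
    have : (j : ℝ) ≤ K := by exact_mod_cast this.le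
    linarith
  refine h1.trans ((pow_div_factorial_mono hkK (by linarith)).trans ?_)
  have h2 : (Y + K) ^ K / K.factorial = (Y / K + 1) ^ K * ((K : ℝ) ^ K / K.factorial) := by
    rw [← mul_div_assoc, ← mul_pow]
    congr 2
    field_simp
  rw [h2, mul_pow, mul_comm, ← Real.exp_nat_mul, mul_one]
  gcongr
  exact Real.pow_div_factorial_le_exp _ hK'.le _

theorem norm_pow_sub_one_le {u : ℂ} {τ : ℝ} {m : ℕ} (hu : ‖u - 1‖ ≤ τ) (hm : m * τ ≤ 1) :
    ‖u ^ m - 1‖ ≤ 2 * m * τ := by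
  have hτ : 0 ≤ τ := (norm_nonneg _).trans hu
  have key : ∀ j : ℕ, ‖u ^ j - 1‖ ≤ (1 + τ) ^ j - 1 := by
    intro j
    induction j with
    | zero => simp
    | succ j ih =>
      have h1 : u ^ (j + 1) - 1 = (u ^ j - 1) * u + (u - 1) := by ring
      have h2 : ‖u‖ ≤ 1 + τ := by
        have : u = 1 + (u - 1) := by ring
        rw [this]
        refine (norm_add_le _ _).trans ?_
        simpa using hu
      rw [h1]
      refine (norm_add_le _ _).trans ?_
      rw [norm_mul]
      have h3 : 0 ≤ (1 + τ) ^ j - 1 := sub_nonneg.mpr (one_le_pow₀ (by linarith))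
      have := mul_le_mul ih h2 (norm_nonneg _) h3
      rw [pow_succ]
      linarith
  refine (key m).trans ?_
  have h1 : (1 + τ) ^ m ≤ Real.exp (m * τ) := by
    rw [Real.exp_nat_mul]
    gcongr
    linarith [Real.add_one_le_exp τ]
  have h2 : Real.exp (m * τ) - 1 ≤ 2 * (m * τ) := by
    have h0 : 0 ≤ m * τ := by positivity
    have := Real.abs_exp_sub_one_le (x := m * τ) (by rwa [abs_of_nonneg h0])
    rw [abs_of_nonneg h0] at this
    exact (le_abs_self _).trans this
  linarith

theorem log_factorial_le (n : ℕ) : Real.log n.factorial ≤ n * Real.log n := by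
  rw [← Real.log_pow]
  apply Real.log_le_log (by exact_mod_cast n.factorial_pos)
  exact_mod_cast Nat.factorial_le_pow n

/-- The basic inequality of the interpolation determinant method for two multiplicatively
close numbers `α` and `η ^ N`. -/
theorem card_le_of_norm_div_pow_sub_one_le {F : Type*} [Field F] [NumberField F] (φ : F →+* ℂ)
    {η α : F} (hη0 : η ≠ 0) (hα0 : α ≠ 0) (hη : ∀ m : ℕ, 0 < m → η ^ m ≠ 1)
    (hηint : IsIntegral ℤ η) {b : ℕ} (hb : 0 < b) (hbα : IsIntegral ℤ ((b : F) * α))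
    {d h₁ h₂ : ℝ} (hd : (Module.finrank ℚ F : ℝ) ≤ d) (h₁0 : 0 ≤ h₁) (h₂0 : 0 ≤ h₂)
    (hηle : ∀ ψ : F →+* ℂ, ‖ψ η‖ ≤ Real.exp h₁) (hαle : ∀ ψ : F →+* ℂ, ‖ψ α‖ ≤ Real.exp h₂)
    (hble : (b : ℝ) ≤ Real.exp h₂) {K L R S N : ℕ} (hK : 0 < K) (hL : 0 < L) (hRN : R ≤ N)
    (hKL : K * L ≤ R * S) {ω : ℂ} (hω : Complex.exp ω = φ η) {τ : ℝ}
    (hτ : ‖φ α / φ η ^ N - 1‖ ≤ τ) (hτle : 2 * (L * S) * τ ≤ Real.exp (-(K * L)))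
    {Z : ℝ} (hZ : R + L + N * S ≤ Z) :
    (K * L : ℝ) ≤ 3 + 2 * d * (2 * L * S * h₂ + L * (R + L) * h₁ + Real.log (K * L)
      + K * Real.log (Real.exp 1 * (Real.exp 1 * Z / K + 1)) + Real.exp 1 * L * ‖ω‖ * Z) := by
  obtain ⟨r, s, hr, hs, hdet⟩ := exists_interpolation_det_ne_zero hη0 hα0 hη hRN hKL
  set A : Matrix (Fin K × Fin L) (Fin K × Fin L) F := Matrix.of fun i j =>
        (((r i + N * s i).choose j.1 : ℕ) : F) * (η ^ r i * α ^ s i) ^ (j.2 : ℕ) with hA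
  have hn : Fintype.card (Fin K × Fin L) = K * L := by simp
  have hn0 : 0 < K * L := Nat.mul_pos hK hL
  have hK' : (0 : ℝ) < K := Nat.cast_pos.mpr hK
  have hL' : (0 : ℝ) < L := Nat.cast_pos.mpr hL
  have hZ0 : 0 < Z := lt_of_lt_of_le (by positivity) hZ
  have he1 : 1 ≤ Real.exp 1 := Real.one_le_exp zero_le_one
  set c := K * Real.log (Real.exp 1 * (Real.exp 1 * Z / K + 1)) with hc
  have hexpc : Real.exp c = (Real.exp 1 * (Real.exp 1 * Z / K + 1)) ^ K := by
    rw [hc, Real.exp_nat_mul, Real.exp_log (by positivity)]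
  have hzle : ∀ i, ((r i + N * s i : ℕ) : ℝ) ≤ Z := fun i => by
    refine le_trans ?_ hZ
    have h1 : r i + N * s i ≤ R + L + N * S :=
      add_le_add (hr i).le (Nat.mul_le_mul_left _ (hs i).le)
    exact_mod_cast h1
  have hchoose : ∀ i (j : Fin K × Fin L), (((r i + N * s i).choose j.1 : ℕ) : ℝ) ≤ Real.exp c := by
    intro i j
    have h1 := norm_choosePoly_eval_le (k := j.1) (K := K) hK j.1.2.le
      (w := ((r i + N * s i : ℕ) : ℂ)) (Y := Real.exp 1 * Z) (by
        rw [Complex.norm_natCast]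
        exact (hzle i).trans (le_mul_of_one_le_left hZ0.le he1))
    rw [choosePoly_eval_natCast, Complex.norm_natCast] at h1
    rwa [hexpc]
  -- arbitrary embeddings
  have hψ : ∀ ψ : F →+* ℂ, ‖ψ A.det‖ ≤ (K * L).factorial *
      Real.exp (c + L * (R + L) * h₁ + L * S * h₂) ^ (K * L) := by
    intro ψ
    rw [RingHom.map_det]
    refine (norm_det_le_of_forall_norm_le _
      (fun _ => Real.exp (c + L * (R + L) * h₁ + L * S * h₂)) ?_).trans_eq (by simp)
    intro i j
    simp only [hA, RingHom.mapMatrix_apply, Matrix.map_apply, Matrix.of_apply, map_mul, map_pow,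
      map_natCast, norm_mul, norm_pow, Complex.norm_natCast]
    rw [Real.exp_add, Real.exp_add, mul_assoc]
    refine mul_le_mul (hchoose i j) ?_ (by positivity) (by positivity)
    rw [mul_pow, ← pow_mul, ← pow_mul]
    have hj : (j.2 : ℕ) ≤ L := j.2.2.le
    refine mul_le_mul ?_ ?_ (by positivity) (by positivity)
    · refine (pow_le_pow_left₀ (norm_nonneg _) (hηle ψ) _).trans ?_
      rw [← Real.exp_nat_mul]
      apply Real.exp_le_exp.mpr
      apply mul_le_mul_of_nonneg_right _ h₁0
      have : r i * (j.2 : ℕ) ≤ L * (R + L) := by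
        rw [mul_comm]; exact Nat.mul_le_mul hj (hr i).le
      exact_mod_cast this
    · refine (pow_le_pow_left₀ (norm_nonneg _) (hαle ψ) _).trans ?_
      rw [← Real.exp_nat_mul]
      apply Real.exp_le_exp.mpr
      apply mul_le_mul_of_nonneg_right _ h₂0
      have : s i * (j.2 : ℕ) ≤ L * S := by
        rw [mul_comm]; exact Nat.mul_le_mul hj (hs i).le
      exact_mod_cast this
  -- the given embedding
  have hφη0 : φ η ≠ 0 := (map_ne_zero φ).mpr hη0
  have hφ : ‖φ A.det‖ ≤ 2 ^ (K * L) * ((K * L).factorial *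
      Real.exp (c + L * ‖ω‖ * (Real.exp 1 * Z)) ^ (K * L)) /
        Real.exp 1 ^ (K * L * (K * L - 1) / 2) := by
    let u := φ α / φ η ^ N
    have hentry : (φ.mapMatrix A) = Matrix.of fun i j : Fin K × Fin L =>
        ((choosePoly ℂ j.1).eval ((r i + N * s i : ℕ) : ℂ) *
          Complex.exp ((j.2 : ℕ) * ω * ((r i + N * s i : ℕ) : ℂ))) *
          (1 + (u ^ (s i * (j.2 : ℕ)) - 1)) := by
      ext i j
      simp only [hA, RingHom.mapMatrix_apply, Matrix.map_apply, Matrix.of_apply, map_mul, map_pow,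
        map_natCast]
      rw [choosePoly_eval_natCast, mul_assoc]
      congr 1
      have h1 : Complex.exp ((j.2 : ℕ) * ω * ((r i + N * s i : ℕ) : ℂ)) =
          φ η ^ ((j.2 : ℕ) * (r i + N * s i)) := by
        rw [← hω, ← Complex.exp_nat_mul]
        congr 1
        push_cast
        ring
      have h2 : φ α = u * φ η ^ N := by
        simp only [u]
        rw [div_mul_cancel₀ _ (pow_ne_zero _ hφη0)]
      rw [h1, h2]
      ring
    rw [RingHom.map_det, hentry]
    have := norm_det_le_of_perturbed_entire
      (fun j : Fin K × Fin L => fun w : ℂ => (choosePoly ℂ j.1).eval w *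
        Complex.exp ((j.2 : ℕ) * ω * w))
      (fun j => ((choosePoly ℂ j.1).differentiable).mul (by fun_prop))
      (fun i => ((r i + N * s i : ℕ) : ℂ)) (fun i j => u ^ (s i * (j.2 : ℕ)) - 1)
      (E := Real.exp 1) (B := Real.exp (c + L * ‖ω‖ * (Real.exp 1 * Z))) he1 (by positivity)
      ?_ ?_
    · rwa [hn] at this
    · intro i j x hx
      have hw : ‖x * ((r i + N * s i : ℕ) : ℂ)‖ ≤ Real.exp 1 * Z := by
        rw [norm_mul, Complex.norm_natCast]
        exact mul_le_mul hx (hzle i) (by positivity) (by positivity)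
      rw [norm_mul, Real.exp_add]
      refine mul_le_mul ?_ ?_ (norm_nonneg _) (by positivity)
      · rw [hexpc]
        exact norm_choosePoly_eval_le hK j.1.2.le hw
      · refine (Complex.norm_exp_le_exp_norm _).trans (Real.exp_le_exp.mpr ?_)
        rw [norm_mul, norm_mul, Complex.norm_natCast]
        gcongr
        exact_mod_cast j.2.2.le
    · intro i j
      have hτ0 : 0 ≤ τ := (norm_nonneg _).trans hτ
      have hm : ((s i * (j.2 : ℕ) : ℕ) : ℝ) ≤ L * S := by
        have : s i * (j.2 : ℕ) ≤ L * S := by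
          rw [mul_comm]; exact Nat.mul_le_mul j.2.2.le (hs i).le
        exact_mod_cast this
      have h1 : Real.exp (-(K * L : ℝ)) ≤ 1 := Real.exp_le_one_iff.mpr (by
        have : (0 : ℝ) ≤ K * L := by positivity
        linarith)
      have h3 := mul_le_mul_of_nonneg_right hm hτ0
      refine (norm_pow_sub_one_le hτ (by linarith)).trans ?_
      rw [hn, ← Real.exp_nat_mul, one_div, ← Real.exp_neg]
      push_cast at h3 ⊢
      rw [mul_one]
      linarith
  -- arithmetic lower bound
  have hintegral : IsIntegral ℤ (((b : F) ^ (L * S)) ^ (K * L) * A.det) := by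
    have h1 : ((b : F) ^ (L * S)) ^ (K * L) * A.det = (((b : F) ^ (L * S)) • A).det := by
      rw [Matrix.det_smul, hn]
    rw [h1]
    refine IsIntegral.det fun i j => ?_
    simp only [hA, Matrix.smul_apply, Matrix.of_apply, smul_eq_mul]
    have h2 : s i * (j.2 : ℕ) ≤ L * S := by
      rw [mul_comm]; exact Nat.mul_le_mul j.2.2.le (hs i).le
    obtain ⟨q, hq⟩ := Nat.exists_eq_add_of_le h2
    have h3 : (b : F) ^ (L * S) * ((((r i + N * s i).choose j.1 : ℕ) : F) *
        (η ^ r i * α ^ s i) ^ (j.2 : ℕ)) =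
        (((r i + N * s i).choose j.1 * b ^ q : ℕ) : F) * (η ^ (r i * (j.2 : ℕ)) *
          ((b : F) * α) ^ (s i * (j.2 : ℕ))) := by
      rw [hq]
      push_cast
      ring
    rw [h3]
    have h4 : IsIntegral ℤ (((r i + N * s i).choose j.1 * b ^ q : ℕ) : F) :=
      map_natCast (algebraMap ℤ F) _ ▸ isIntegral_algebraMap
    exact h4.mul ((hηint.pow _).mul (hbα.pow _))
  have hb0 : (b : F) ≠ 0 := by exact_mod_cast hb.ne'
  have hprod := NumberField.one_le_prod_norm_of_isIntegral hintegral
    (mul_ne_zero (pow_ne_zero _ (pow_ne_zero _ hb0)) hdet)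
  simp only [map_mul, map_pow, map_natCast, norm_mul, norm_pow, Complex.norm_natCast,
    Finset.prod_mul_distrib, Finset.prod_const, Finset.card_univ] at hprod
  rw [NumberField.Embeddings.card] at hprod
  classical
  set n := K * L with hndef
  set m := Module.finrank ℚ F with hm
  have hmpos : 0 < m := Module.finrank_pos
  have hn0' : (0 : ℝ) < n := Nat.cast_pos.mpr hn0
  have hfac : ((n.factorial : ℕ) : ℝ) ≤ Real.exp (n * Real.log n) := by
    rw [← Real.log_le_iff_le_exp (by positivity)]
    exact log_factorial_le n
  set v := c + L * (R + L) * h₁ + L * S * h₂ with hv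
  have hψ' : ∀ ψ : F →+* ℂ, ‖ψ A.det‖ ≤ Real.exp (n * (Real.log n + v)) := by
    intro ψ
    refine (hψ ψ).trans ?_
    have e : Real.exp (n * (Real.log n + v)) = Real.exp (n * Real.log n) * Real.exp v ^ n := by
      rw [mul_add (n : ℝ), Real.exp_add (n * Real.log n), Real.exp_nat_mul v]
    rw [e]
    gcongr
  have hdiv : ((n * (n - 1) / 2 : ℕ) : ℝ) = n * (n - 1) / 2 := by
    rw [Nat.cast_div (Nat.even_mul_pred_self n).two_dvd (by norm_num), Nat.cast_mul,
      Nat.cast_sub hn0]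
    simp
  have hφ' : ‖φ A.det‖ ≤ Real.exp (n * (1 + Real.log n + (c + L * ‖ω‖ * (Real.exp 1 * Z))
      - (n - 1) / 2)) := by
    refine hφ.trans ?_
    have h2 : (2 : ℝ) ^ n ≤ Real.exp n := by
      rw [← mul_one (n : ℝ), Real.exp_nat_mul]
      gcongr
      linarith [Real.add_one_le_exp 1]
    rw [div_le_iff₀ (by positivity), ← Real.exp_nat_mul, ← Real.exp_nat_mul, hdiv, mul_one,
      ← Real.exp_add]
    calc 2 ^ n * (((n.factorial : ℕ) : ℝ) * Real.exp (n * (c + L * ‖ω‖ * (Real.exp 1 * Z))))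
        ≤ Real.exp n * (Real.exp (n * Real.log n) *
          Real.exp (n * (c + L * ‖ω‖ * (Real.exp 1 * Z)))) := by gcongr
      _ = _ := by
        rw [← Real.exp_add, ← Real.exp_add]
        congr 1
        ring
  have hprodle : ∏ ψ : F →+* ℂ, ‖ψ A.det‖ ≤
      Real.exp (n * (1 + Real.log n + (c + L * ‖ω‖ * (Real.exp 1 * Z)) - (n - 1) / 2)) *
        Real.exp (n * (Real.log n + v)) ^ (m - 1) := by
    rw [← Finset.mul_prod_erase _ _ (Finset.mem_univ φ)]
    refine mul_le_mul hφ' ?_ (Finset.prod_nonneg fun _ _ => norm_nonneg _) (by positivity)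
    refine (Finset.prod_le_prod (fun _ _ => norm_nonneg _) fun ψ _ => hψ' ψ).trans_eq ?_
    rw [Finset.prod_const, Finset.card_erase_of_mem (Finset.mem_univ _), Finset.card_univ,
      NumberField.Embeddings.card]
  have hb' : ((((b : ℝ) ^ (L * S)) ^ n) ^ m) ≤ Real.exp (n * (m * (L * S * h₂))) := by
    have : Real.exp (n * (m * (L * S * h₂))) = (((Real.exp h₂ ^ (L * S)) ^ n) ^ m) := by
      rw [← pow_mul, ← pow_mul, ← Real.exp_nat_mul]
      congr 1
      push_cast
      ring
    rw [this]
    gcongr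
  have hfinal := hprod.trans (mul_le_mul hb' hprodle
    (Finset.prod_nonneg fun _ _ => norm_nonneg _) (by positivity))
  rw [← Real.exp_nat_mul, ← Real.exp_add, ← Real.exp_add, Nat.cast_sub hmpos,
    Nat.cast_one] at hfinal
  replace hfinal := Real.exp_le_exp.mp (Real.exp_zero.trans_le hfinal)
  have hlogn : 0 ≤ Real.log n := Real.log_natCast_nonneg n
  have hc0 : 0 ≤ c := by
    rw [hc]
    refine mul_nonneg hK'.le (Real.log_nonneg ?_)
    have : 1 ≤ Real.exp 1 * Z / K + 1 := by
      have : 0 ≤ Real.exp 1 * Z / K := by positivity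
      linarith
    nlinarith
  have hnn : (n : ℝ) = K * L := by rw [hndef, Nat.cast_mul]
  have h5 : 0 ≤ m * (L * S * h₂) + (1 + Real.log n + (c + L * ‖ω‖ * (Real.exp 1 * Z)) - (n - 1) / 2)
      + (m - 1) * (Real.log n + v) := by
    refine nonneg_of_mul_nonneg_right ?_ hn0'
    linarith
  rw [← hnn]
  have hv' : c ≤ v := by
    have : 0 ≤ L * (R + L) * h₁ + L * S * h₂ := by positivity
    linarith
  have hm1 : (1 : ℝ) ≤ m := by exact_mod_cast hmpos
  have hW : 0 ≤ L * ‖ω‖ * (Real.exp 1 * Z) := by positivity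
  have h6 : m * (L * S * h₂ + Real.log n + v + L * ‖ω‖ * (Real.exp 1 * Z)) ≤
      d * (L * S * h₂ + Real.log n + v + L * ‖ω‖ * (Real.exp 1 * Z)) := by
    refine mul_le_mul_of_nonneg_right hd ?_
    have : 0 ≤ L * S * h₂ := by positivity
    linarith
  have h7 := mul_le_mul_of_nonneg_right hm1 hW
  have h8 : (n : ℝ) ≤ 3 + 2 * (m * (L * S * h₂ + Real.log n + v + L * ‖ω‖ * (Real.exp 1 * Z))) := by
    linarith
  have h9 : (n : ℝ) ≤ 3 + 2 * d * (2 * L * S * h₂ + L * (R + L) * h₁ + Real.log n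
      + c + Real.exp 1 * L * ‖ω‖ * Z) := by
    refine h8.trans ?_
    rw [hv] at h6
    rw [hv]
    linarith
  exact h9

theorem interpolation_parameters_lt {d L p N ν H S K R Q X w : ℝ} (hd : 1 ≤ d) (hL : 1 ≤ L)
    (hp : 1 ≤ p) (hH : 1 ≤ H) (hN : 0 < N) (hν0 : 0 < ν) (hνH : ν * N ≤ H) (hS26 : 26 ≤ S)
    (hQ : Q = d ^ 2 * L ^ 2) (hS : S = 26 * d * L * p) (hK : K = 24 * d * S * H)
    (hR : R = 24 * d * L * H) (hX : X = K * L) (hν : 1248 * Q * ν ≤ 1)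
    (hL' : 12 * d * Real.log (1 / ν) ≤ L) (hw0 : 0 ≤ w) (hw : w ≤ ν / 3) :
    3 + 2 * d * (2 * L * S * H + L * (R + L) * (2 * p) + Real.log X
      + K * Real.log (Real.exp 1 * (Real.exp 1 * (2 * N * S) / K + 1))
      + Real.exp 1 * L * w * (2 * N * S)) < X := by
  have he : Real.exp 1 < 2.72 := lt_trans Real.exp_one_lt_d9 (by norm_num)
  have he0 : 0 < Real.exp 1 := Real.exp_pos 1
  have hL2 : 1 ≤ L ^ 2 := one_le_pow₀ hL
  have hdd : d ≤ d ^ 2 := le_self_pow₀ hd two_ne_zero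
  have hd2Q : d ^ 2 ≤ Q := by rw [hQ]; exact le_mul_of_one_le_right (by positivity) hL2
  have hdLL : d * L ^ 2 ≤ Q := by rw [hQ]; gcongr
  have hQ1 : 1 ≤ Q := by linarith
  have hQp : Q ≤ Q * p := le_mul_of_one_le_right (by linarith) hp
  have hQpH : Q * p ≤ Q * p * H := le_mul_of_one_le_right (by linarith) hH
  have hXe : X = 624 * (Q * p * H) := by rw [hX, hK, hS, hQ]; ring
  have hX0 : 624 ≤ X := by linarith
  have hS0 : 0 < S := by linarith
  have hK0 : 0 < K := by rw [hK]; positivity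
  have hlog : Real.log (Real.exp 1 * (Real.exp 1 * (2 * N * S) / K + 1)) ≤ Real.log (1 / ν) := by
    apply Real.log_le_log (by positivity)
    have h1 : Real.exp 1 * (2 * N * S) / K ≤ Real.exp 1 / (12 * ν) := by
      rw [hK, div_le_div_iff₀ (by positivity) (by positivity)]
      have h2 : (ν * N) * S ≤ d * (S * H) := by
        have h3 := mul_le_mul_of_nonneg_right hνH hS0.le
        have h4 : S * H ≤ d * (S * H) := le_mul_of_one_le_left (by positivity) hd
        linarith
      have h5 := mul_le_mul_of_nonneg_left h2 he0.le
      linarith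
    have h2 : Real.exp 1 / (12 * ν) = Real.exp 1 / 12 * (1 / ν) := by field_simp
    have h3 : 1248 ≤ 1 / ν := by
      rw [le_div_iff₀ hν0]
      have : ν ≤ Q * ν := le_mul_of_one_le_left hν0.le hQ1
      linarith
    have h4 : Real.exp 1 * Real.exp 1 ≤ 2.72 * 2.72 := by gcongr
    calc Real.exp 1 * (Real.exp 1 * (2 * N * S) / K + 1)
        ≤ Real.exp 1 * (Real.exp 1 / 12 * (1 / ν) + 1) := by rw [← h2]; gcongr
      _ = Real.exp 1 * Real.exp 1 / 12 * (1 / ν) + Real.exp 1 := by ring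
      _ ≤ 2.72 * 2.72 / 12 * (1 / ν) + 2.72 := by gcongr
      _ ≤ 1 / ν := by linarith
  have t1 : 2 * d * (2 * L * S * H) = X / 6 := by rw [hX, hK]; ring
  have t2 : 2 * d * (L * (R + L) * (2 * p)) ≤ X * (2 / 13) + X * (1 / 100) := by
    have e1 : 2 * d * (L * (R + L) * (2 * p)) = X * (2 / 13) + 4 * (d * L ^ 2 * p) := by
      rw [hX, hK, hS, hR]; ring
    have e2 : d * L ^ 2 * p ≤ Q * p := by gcongr
    rw [e1, hXe]
    linarith
  have t3 : 2 * d * Real.log X ≤ X * (1 / 5) := by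
    have h1 : Real.log X ≤ 2 * Real.sqrt X := by
      have := Real.log_le_self (Real.sqrt_nonneg X)
      rw [Real.log_sqrt (by linarith)] at this
      linarith
    have h2 : 20 * d ≤ Real.sqrt X := by
      apply Real.le_sqrt_of_sq_le
      rw [mul_pow]
      linarith
    have h3 : Real.sqrt X * Real.sqrt X = X := Real.mul_self_sqrt (by linarith)
    have h4 := mul_le_mul_of_nonneg_right h2 (Real.sqrt_nonneg X)
    have h5 := mul_le_mul_of_nonneg_left h1 (by linarith : 0 ≤ 2 * d)
    linarith
  have t4 : 2 * d * (K * Real.log (Real.exp 1 * (Real.exp 1 * (2 * N * S) / K + 1))) ≤ X / 6 := by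
    have : 12 * d * Real.log (Real.exp 1 * (Real.exp 1 * (2 * N * S) / K + 1)) ≤ L :=
      (mul_le_mul_of_nonneg_left hlog (by positivity)).trans hL'
    have := mul_le_mul_of_nonneg_left this hK0.le
    rw [hX]
    linarith
  have t5 : 2 * d * (Real.exp 1 * L * w * (2 * N * S)) ≤ X * (2.72 / 18) := by
    have h1 : w * N ≤ H / 3 := by
      have := mul_le_mul_of_nonneg_right hw hN.le
      linarith
    have h2 : Real.exp 1 * (w * N) ≤ 2.72 * (H / 3) :=
      mul_le_mul he.le h1 (by positivity) (by norm_num)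
    have h3 := mul_le_mul_of_nonneg_left h2 (by positivity : (0 : ℝ) ≤ 4 * d * L * S)
    rw [hX, hK]
    linarith
  linarith

set_option maxHeartbeats 1000000 in
/-- A power of `η` cannot be too close to `α` in some embedding when the embeddings of `η` and `α`
are controlled as below, unless `η` is a root of unity. -/
theorem exists_pow_eq_one_of_close {F : Type*} [Field F] [NumberField F] (φ : F →+* ℂ)
    {η α : F} (hη0 : η ≠ 0) (hα0 : α ≠ 0)
    (hηint : IsIntegral ℤ η) {b : ℕ} (hb : 0 < b) (hbα : IsIntegral ℤ ((b : F) * α))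
    {d L p N : ℕ} {ν : ℝ} (hν0 : 0 < ν) (hd : Module.finrank ℚ F ≤ d) (hL0 : 0 < L) (hp : 0 < p)
    (hηle : ∀ ψ : F →+* ℂ, ‖ψ η‖ ≤ Real.exp (2 * p))
    (hαle : ∀ ψ : F →+* ℂ, ‖ψ α‖ ≤ Real.exp (ν * N)) (hble : (b : ℝ) ≤ Real.exp (ν * N))
    {ω : ℂ} (hω : Complex.exp ω = φ η) (hων : ‖ω‖ ≤ ν / 3)
    (hτ : ‖φ α / φ η ^ N - 1‖ ≤ 2 * Real.exp (-(p * N)))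
    (hL : 12 * d * Real.log (1 / ν) ≤ L) (hν : 1248 * (d ^ 2 * L ^ 2) * ν ≤ 1)
    (hN : 2496 * (d ^ 2 * L ^ 2) ≤ N) : ∃ m : ℕ, 0 < m ∧ η ^ m = 1 := by
  by_contra! hη
  have hd1 : 1 ≤ d := le_trans Module.finrank_pos hd
  obtain ⟨H, hH⟩ : ∃ H, H = ⌈ν * N⌉₊ := ⟨_, rfl⟩
  obtain ⟨S, hS⟩ : ∃ S, S = 26 * d * L * p := ⟨_, rfl⟩
  obtain ⟨K, hK⟩ : ∃ K, K = 24 * d * S * H := ⟨_, rfl⟩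
  obtain ⟨R, hR⟩ : ∃ R, R = 24 * d * L * H := ⟨_, rfl⟩
  have hdL : d * L ≤ d ^ 2 * L ^ 2 := by
    have := Nat.le_self_pow two_ne_zero (d * L)
    rwa [mul_pow] at this
  have hdL1 : 1 ≤ d * L := Nat.mul_pos hd1 hL0
  have hNpos : 0 < N := by omega
  have hNpos' : (0 : ℝ) < N := Nat.cast_pos.mpr hNpos
  have hHpos : 0 < H := hH ▸ Nat.ceil_pos.mpr (by positivity)
  have hHle : (H : ℝ) ≤ ν * N + 1 := hH ▸ (Nat.ceil_lt_add_one (by positivity)).le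
  have hleH : ν * N ≤ H := hH ▸ Nat.le_ceil _
  have hdr : (1 : ℝ) ≤ d := by exact_mod_cast hd1
  have hLr : (1 : ℝ) ≤ L := by exact_mod_cast hL0
  have hpr : (1 : ℝ) ≤ p := by exact_mod_cast hp
  have hHr : (1 : ℝ) ≤ H := by exact_mod_cast hHpos
  have hNr : 2496 * ((d : ℝ) ^ 2 * L ^ 2) ≤ N := by exact_mod_cast hN
  obtain ⟨Q, hQ⟩ : ∃ Q : ℝ, Q = (d : ℝ) ^ 2 * L ^ 2 := ⟨_, rfl⟩
  rw [← hQ] at hNr hν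
  have hdLr : (d : ℝ) * L ≤ Q := by rw [hQ]; exact_mod_cast hdL
  have hLd : (L : ℝ) ≤ d * L := le_mul_of_one_le_left (by positivity) hdr
  have hddL : (d : ℝ) ≤ d * L := le_mul_of_one_le_right (by positivity) hLr
  have hdLL : (d : ℝ) * L ^ 2 ≤ Q := by
    rw [hQ]; gcongr; exact le_self_pow₀ hdr two_ne_zero
  have hQ1 : 1 ≤ Q := hdr.trans (hddL.trans hdLr)
  have hQν : 1248 * Q * (ν * N) ≤ N := by
    linarith [mul_le_mul_of_nonneg_right hν hNpos'.le]
  have hQH : 832 * (Q * H) ≤ N := by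
    linarith [mul_le_mul_of_nonneg_left hHle (zero_le_one.trans hQ1)]
  have hSr : (S : ℝ) = 26 * d * L * p := by rw [hS]; push_cast; ring
  have hKr : (K : ℝ) = 24 * d * S * H := by rw [hK]; push_cast; ring
  have hRr : (R : ℝ) = 24 * d * L * H := by rw [hR]; push_cast; ring
  have hS26 : 26 ≤ (S : ℝ) := by
    rw [hSr]
    linarith [one_le_mul_of_one_le_of_one_le (one_le_mul_of_one_le_of_one_le hdr hLr) hpr]
  have hRN' : (R : ℝ) ≤ N := by
    rw [hRr]
    have : 0 ≤ Q * H := by positivity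
    linarith [mul_le_mul_of_nonneg_right hdLr (by linarith : (0 : ℝ) ≤ H)]
  have hRN : R ≤ N := by exact_mod_cast hRN'
  have hLN : (L : ℝ) ≤ N := by linarith
  have hexpH : Real.exp (ν * N) ≤ Real.exp H := Real.exp_le_exp.mpr hleH
  have hSpos : 0 < S := by exact_mod_cast (by linarith : (0 : ℝ) < S)
  have hKpos : 0 < K := by rw [hK]; positivity
  have hKL : K * L ≤ R * S := by rw [hK, hR]; exact le_of_eq (by ring)
  have hZ : (R : ℝ) + L + N * S ≤ 2 * N * S := by
    linarith [mul_le_mul_of_nonneg_left hS26 hNpos'.le]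
  have hX : (K * L : ℝ) = 624 * (Q * p * H) := by rw [hKr, hSr, hQ]; ring
  have hLS : (L : ℝ) * S ≤ 26 * Q * p := by rw [hSr]; linarith [mul_le_mul_of_nonneg_right hdLL (by linarith : (0 : ℝ) ≤ p)]
  have hτle : 2 * ((L : ℝ) * S) * (2 * Real.exp (-(p * N))) ≤ Real.exp (-(K * L)) := by
    have h1 : 4 * ((L : ℝ) * S) ≤ Real.exp (p * N - K * L) := by
      refine le_trans ?_ (Real.add_one_le_exp _)
      rw [hX]
      have h2 : 624 * (Q * p * H) ≤ 3 / 4 * (p * N) := by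
        linarith [mul_le_mul_of_nonneg_left hQH (by linarith : (0 : ℝ) ≤ p)]
      have h3 : 2496 * (Q * p) ≤ p * N := by
        linarith [mul_le_mul_of_nonneg_left hNr (by linarith : (0 : ℝ) ≤ p)]
      have h5 : 0 ≤ Q * p := by positivity
      linarith
    have h4 : Real.exp (-(K * L : ℝ)) = Real.exp (p * N - K * L) * Real.exp (-(p * N)) := by
      rw [← Real.exp_add]; congr 1; ring
    rw [h4]
    linarith [mul_le_mul_of_nonneg_right h1 (Real.exp_pos (-(p * N : ℝ))).le]
  have hmain := card_le_of_norm_div_pow_sub_one_le φ hη0 hα0 hη hηint hb hbα (d := d)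
    (h₁ := 2 * p) (h₂ := H) (by exact_mod_cast hd) (by positivity) (by positivity) hηle
    (fun ψ => (hαle ψ).trans hexpH) (hble.trans hexpH) hKpos hL0 hRN hKL hω hτ hτle hZ
  exact absurd (interpolation_parameters_lt hdr hLr hpr hHr hNpos' hν0 hleH hS26 hQ hSr hKr hRr rfl
    hν hL (norm_nonneg ω) hων) (not_lt.mpr hmain)

/-- A finite Euler product bound for sums over ideals. -/
theorem Ideal.sum_inv_absNorm_sq_le_prod {R : Type*} [CommRing R] [IsDedekindDomain R]
    [Module.Free ℤ R] [Module.Finite ℤ R] [CharZero R] (s W : Finset (Ideal R))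
    (hs : ∀ P ∈ s, Prime P) (hW0 : ∀ I ∈ W, I ≠ 0) (hW : ∀ I ∈ W, ∀ P, Prime P → P ∣ I → P ∈ s) :
    ∑ I ∈ W, ((absNorm I : ℝ) ^ 2)⁻¹ ≤ ∏ P ∈ s, (1 - ((absNorm P : ℝ) ^ 2)⁻¹)⁻¹ := by
  classical
  induction s using Finset.induction_on generalizing W with
  | empty =>
    have hsub : W ⊆ {1} := by
      intro I hI
      rw [Finset.mem_singleton]
      by_contra h1
      have hu : ¬IsUnit I := fun h => h1 ((Ideal.isUnit_iff.mp h).trans Ideal.one_eq_top.symm)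
      obtain ⟨P, hP, hPI⟩ := WfDvdMonoid.exists_irreducible_factor hu (hW0 I hI)
      simpa using hW I hI P hP.prime hPI
    refine (Finset.sum_le_sum_of_subset_of_nonneg hsub fun _ _ _ => by positivity).trans ?_
    simp
  | insert P s hPs ih =>
    have hP : Prime P := hs P (Finset.mem_insert_self _ _)
    have hfac : ∀ I : Ideal R, ∃ (k : ℕ) (J : Ideal R), I ≠ 0 → I = P ^ k * J ∧ ¬P ∣ J := by
      intro I
      by_cases hI : I = 0
      · exact ⟨0, 0, fun h => absurd hI h⟩
      · obtain ⟨J, h1, h2⟩ :=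
          (FiniteMultiplicity.of_prime_left hP hI).exists_eq_pow_mul_and_not_dvd
        exact ⟨_, J, fun _ => ⟨h1, h2⟩⟩
    choose k J hkJ using hfac
    set W' := W.image J
    have hih := ih W' (fun Q hQ => hs Q (Finset.mem_insert_of_mem hQ)) ?_ ?_
    · set x : ℝ := ((absNorm P : ℝ) ^ 2)⁻¹ with hx
      have hNP : 2 ≤ absNorm P := by
        have h0 : absNorm P ≠ 0 := fun h => hP.ne_zero (absNorm_eq_zero_iff.mp h)
        have h1 : absNorm P ≠ 1 := fun h =>
          hP.not_isUnit (Ideal.isUnit_iff.mpr (absNorm_eq_one_iff.mp h))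
        omega
      have hx0 : 0 ≤ x := by positivity
      have hx1 : x < 1 := by
        have : (2 : ℝ) ≤ absNorm P := by exact_mod_cast hNP
        exact inv_lt_one_of_one_lt₀ (by nlinarith)
      rw [Finset.prod_insert hPs]
      set M := W.sup k
      have hinj : Set.InjOn (fun I => (k I, J I)) W := by
        intro I hI I' hI' h
        simp only [Prod.mk.injEq] at h
        rw [(hkJ I (hW0 I hI)).1, (hkJ I' (hW0 I' hI')).1, h.1, h.2]
      have hsub : W.image (fun I => (k I, J I)) ⊆ Finset.range (M + 1) ×ˢ W' := by
        intro y hy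
        obtain ⟨I, hI, rfl⟩ := Finset.mem_image.mp hy
        exact Finset.mem_product.mpr ⟨Finset.mem_range.mpr (Nat.lt_succ_of_le (Finset.le_sup hI)),
          Finset.mem_image_of_mem _ hI⟩
      calc ∑ I ∈ W, ((absNorm I : ℝ) ^ 2)⁻¹
          = ∑ I ∈ W, x ^ (k I) * ((absNorm (J I) : ℝ) ^ 2)⁻¹ := by
            refine Finset.sum_congr rfl fun I hI => ?_
            conv_lhs => rw [(hkJ I (hW0 I hI)).1]
            rw [map_mul, map_pow, hx]
            push_cast
            rw [inv_pow, ← mul_inv, ← pow_mul, mul_pow, ← pow_mul, mul_comm 2]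
        _ = ∑ y ∈ W.image (fun I => (k I, J I)), x ^ y.1 * ((absNorm y.2 : ℝ) ^ 2)⁻¹ :=
            (Finset.sum_image (f := fun y : ℕ × Ideal R => x ^ y.1 * ((absNorm y.2 : ℝ) ^ 2)⁻¹) hinj).symm
        _ ≤ ∑ y ∈ Finset.range (M + 1) ×ˢ W', x ^ y.1 * ((absNorm y.2 : ℝ) ^ 2)⁻¹ :=
            Finset.sum_le_sum_of_subset_of_nonneg hsub fun _ _ _ => by positivity
        _ = (∑ i ∈ Finset.range (M + 1), x ^ i) * ∑ I ∈ W', ((absNorm I : ℝ) ^ 2)⁻¹ := by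
            rw [Finset.sum_product, Finset.sum_mul_sum]
        _ ≤ (1 - x)⁻¹ * ∏ P ∈ s, (1 - ((absNorm P : ℝ) ^ 2)⁻¹)⁻¹ := by
            refine mul_le_mul ?_ hih (Finset.sum_nonneg fun _ _ => by positivity)
              (inv_nonneg.mpr (by linarith))
            rw [← tsum_geometric_of_lt_one hx0 hx1]
            exact (summable_geometric_of_lt_one hx0 hx1).sum_le_tsum _ fun _ _ => by positivity
    · intro J' hJ'
      obtain ⟨I, hI, rfl⟩ := Finset.mem_image.mp hJ'
      intro h
      have := (hkJ I (hW0 I hI)).1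
      rw [h, mul_zero] at this
      exact hW0 I hI this
    · intro J' hJ' Q hQ hQI
      obtain ⟨I, hI, rfl⟩ := Finset.mem_image.mp hJ'
      have h1 := hkJ I (hW0 I hI)
      have h2 := hW I hI Q hQ (by rw [h1.1]; exact hQI.mul_left _)
      rcases Finset.mem_insert.mp h2 with h | h
      · rw [h] at hQI
        exact absurd hQI h1.2
      · exact h

theorem prod_one_sub_inv_sq_inv_le_two (B : ℕ) :
    ∏ q ∈ Finset.Icc 2 B, (1 - ((q : ℝ) ^ 2)⁻¹)⁻¹ ≤ 2 := by
  have key : ∀ B : ℕ, 1 ≤ B →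
      ∏ q ∈ Finset.Icc 2 B, (1 - ((q : ℝ) ^ 2)⁻¹)⁻¹ = 2 * B / (B + 1) := by
    intro B hB
    induction B, hB using Nat.le_induction with
    | base => norm_num
    | succ m hm ih =>
      have hm' : (1 : ℝ) ≤ m := by exact_mod_cast hm
      rw [Finset.prod_Icc_succ_top (by omega), ih]
      push_cast
      have h1 : (1 : ℝ) - (((m : ℝ) + 1) ^ 2)⁻¹ = m * (m + 2) / (m + 1) ^ 2 := by
        field_simp
        ring
      rw [h1]
      field_simp
      ring
  rcases Nat.eq_zero_or_pos B with rfl | hB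
  · simp
  · rw [key B hB, div_le_iff₀ (by positivity)]
    linarith

open NumberField in
theorem NumberField.card_primes_of_natCast_mem_le {K : Type*} [Field K] [NumberField K] {q : ℕ}
    (hq : q.Prime) (T : Finset (Ideal (𝓞 K))) (hT : ∀ P ∈ T, Prime P)
    (hTq : ∀ P ∈ T, (q : 𝓞 K) ∈ P ∧ q ≤ P.absNorm) : T.card ≤ Module.finrank ℚ K := by
  have h1 : ∏ P ∈ T, P ∣ Ideal.span {(q : 𝓞 K)} := by
    refine Finset.prod_primes_dvd _ hT fun P hP => ?_
    rw [Ideal.dvd_span_singleton]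
    exact (hTq P hP).1
  have h2 := map_dvd Ideal.absNorm h1
  rw [Ideal.absNorm_span_natCast, map_prod, RingOfIntegers.rank] at h2
  have h3 : q ^ T.card ≤ q ^ Module.finrank ℚ K :=
    (Finset.pow_card_le_prod _ _ _ fun P hP => (hTq P hP).2).trans
      (Nat.le_of_dvd (pow_pos hq.pos _) h2)
  exact (Nat.pow_le_pow_iff_right hq.one_lt).mp h3

open NumberField in
/-- A number field of degree `d` has at most `2 ^ d * B ^ 2` nonzero ideals of norm at most `B`. -/
theorem NumberField.card_ideals_absNorm_le {K : Type*} [Field K] [NumberField K] (B : ℕ)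
    (W : Finset (Ideal (𝓞 K))) (hW : ∀ I ∈ W, I ≠ 0 ∧ I.absNorm ≤ B) :
    (W.card : ℝ) ≤ 2 ^ Module.finrank ℚ K * (B : ℝ) ^ 2 := by
  classical
  set d := Module.finrank ℚ K
  let s : Finset (Ideal (𝓞 K)) :=
    (Ideal.finite_setOfPred_absNorm_le B).toFinset.filter fun P => Prime P
  have hmem : ∀ P, P ∈ s ↔ P.absNorm ≤ B ∧ Prime P := fun P => by simp [s]
  have hex : ∀ P : Ideal (𝓞 K), ∃ q : ℕ, Prime P → q.Prime ∧ (q : 𝓞 K) ∈ P ∧ q ∣ P.absNorm := by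
    intro P
    by_cases hP : Prime P
    · have hPp := Ideal.isPrime_of_prime hP
      have h0 : P.absNorm ≠ 0 := fun h => hP.ne_zero (Ideal.absNorm_eq_zero_iff.mp h)
      have h1 := Ideal.absNorm_mem P
      rw [← Nat.prod_primeFactorsList h0, Nat.cast_list_prod, ← Ideal.dvd_span_singleton] at h1
      obtain ⟨q, hq, hxP⟩ : ∃ q ∈ P.absNorm.primeFactorsList, (q : 𝓞 K) ∈ P := by
        have h3 : ∀ l : List ℕ, P ∣ Ideal.span {(l.map Nat.cast).prod} → ∃ q ∈ l, (q : 𝓞 K) ∈ P := by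
          intro l
          induction l with
          | nil =>
            intro h
            simp only [List.map_nil, List.prod_nil, Ideal.span_singleton_one] at h
            exact absurd (isUnit_of_dvd_one (Ideal.one_eq_top (R := 𝓞 K) ▸ h)) hP.not_isUnit
          | cons a l ih =>
            intro h
            rw [List.map_cons, List.prod_cons, Ideal.dvd_span_singleton] at h
            rcases hPp.mem_or_mem h with h | h
            · exact ⟨a, List.mem_cons_self, h⟩
            · obtain ⟨q, hq, h'⟩ := ih (Ideal.dvd_span_singleton.mpr h)
              exact ⟨q, List.mem_cons_of_mem _ hq, h'⟩
        exact h3 _ h1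
      exact ⟨q, fun _ => ⟨Nat.prime_of_mem_primeFactorsList hq, hxP,
        Nat.dvd_of_mem_primeFactorsList hq⟩⟩
    · exact ⟨0, fun h => absurd h hP⟩
  choose g hg using hex
  have hpos : ∀ P : Ideal (𝓞 K), Prime P → 0 < P.absNorm := fun P hP =>
    Nat.pos_of_ne_zero fun h => hP.ne_zero (Ideal.absNorm_eq_zero_iff.mp h)
  have hgle : ∀ P : Ideal (𝓞 K), Prime P → g P ≤ P.absNorm := fun P hP =>
    Nat.le_of_dvd (hpos P hP) (hg P hP).2.2
  have hprod : ∏ P ∈ s, (1 - ((P.absNorm : ℝ) ^ 2)⁻¹)⁻¹ ≤ 2 ^ d := by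
    have hmaps : ∀ P ∈ s, g P ∈ Finset.Icc 2 B := fun P hP => by
      have h := (hmem P).mp hP
      exact Finset.mem_Icc.mpr ⟨(hg P h.2).1.two_le, (hgle P h.2).trans h.1⟩
    have hq1 : ∀ q : ℕ, 2 ≤ q → ((q : ℝ) ^ 2)⁻¹ ≤ 1 / 4 := fun q hq => by
      have : (2 : ℝ) ≤ q := by exact_mod_cast hq
      rw [inv_eq_one_div]
      exact one_div_le_one_div_of_le (by norm_num) (by nlinarith)
    rw [← Finset.prod_fiberwise_of_maps_to hmaps]
    calc ∏ q ∈ Finset.Icc 2 B, ∏ P ∈ s with g P = q, (1 - ((P.absNorm : ℝ) ^ 2)⁻¹)⁻¹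
        ≤ ∏ q ∈ Finset.Icc 2 B, ((1 - ((q : ℝ) ^ 2)⁻¹)⁻¹) ^ d := by
          refine Finset.prod_le_prod (fun q hq => Finset.prod_nonneg fun P hP => ?_) fun q hq => ?_
          · have h := (hmem P).mp (Finset.mem_filter.mp hP).1
            have := hq1 P.absNorm ((hg P h.2).1.two_le.trans (hgle P h.2))
            exact inv_nonneg.mpr (by linarith)
          · have hq2 := (Finset.mem_Icc.mp hq).1
            have hq0 := hq1 q hq2
            have hq0' : (0 : ℝ) < q := by exact_mod_cast (by omega : 0 < q)
            have hone : 1 ≤ (1 - ((q : ℝ) ^ 2)⁻¹)⁻¹ := by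
              refine (one_le_inv₀ (by linarith)).mpr ?_
              have : 0 ≤ ((q : ℝ) ^ 2)⁻¹ := by positivity
              linarith
            have hle : ∀ P ∈ s.filter (fun P => g P = q),
                (1 - ((P.absNorm : ℝ) ^ 2)⁻¹)⁻¹ ≤ (1 - ((q : ℝ) ^ 2)⁻¹)⁻¹ := by
              intro P hP
              obtain ⟨hPs, rfl⟩ := Finset.mem_filter.mp hP
              have h := (hmem P).mp hPs
              have h3 : (g P : ℝ) ≤ P.absNorm := by exact_mod_cast hgle P h.2
              refine inv_anti₀ (by linarith) (sub_le_sub_left (inv_anti₀ (by positivity) ?_) 1)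
              gcongr
            refine (Finset.prod_le_prod (fun P hP => ?_) hle).trans ?_
            · have h := (hmem P).mp (Finset.mem_filter.mp hP).1
              have := hq1 P.absNorm ((hg P h.2).1.two_le.trans (hgle P h.2))
              exact inv_nonneg.mpr (by linarith)
            · rw [Finset.prod_const]
              by_cases hne : (s.filter fun P => g P = q).Nonempty
              · obtain ⟨P₀, hP₀⟩ := hne
                obtain ⟨hPs, hgP⟩ := Finset.mem_filter.mp hP₀
                have hqp : q.Prime := hgP ▸ (hg P₀ ((hmem P₀).mp hPs).2).1
                refine pow_le_pow_right₀ hone (card_primes_of_natCast_mem_le hqp _ ?_ ?_)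
                · exact fun P hP => ((hmem P).mp (Finset.mem_filter.mp hP).1).2
                · intro P hP
                  obtain ⟨hPs, rfl⟩ := Finset.mem_filter.mp hP
                  have h := ((hmem P).mp hPs).2
                  exact ⟨(hg P h).2.1, hgle P h⟩
              · rw [Finset.not_nonempty_iff_eq_empty.mp hne]
                simpa using one_le_pow₀ hone
      _ = (∏ q ∈ Finset.Icc 2 B, (1 - ((q : ℝ) ^ 2)⁻¹)⁻¹) ^ d := Finset.prod_pow _ _ _
      _ ≤ 2 ^ d := by
          refine pow_le_pow_left₀ (Finset.prod_nonneg fun q hq => ?_)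
            (prod_one_sub_inv_sq_inv_le_two B) _
          have := hq1 q (Finset.mem_Icc.mp hq).1
          exact inv_nonneg.mpr (by linarith)
  have hIpos : ∀ I ∈ W, 0 < I.absNorm := fun I hI =>
    Nat.pos_of_ne_zero fun h => (hW I hI).1 (Ideal.absNorm_eq_zero_iff.mp h)
  have hsum := (Ideal.sum_inv_absNorm_sq_le_prod s W (fun P hP => ((hmem P).mp hP).2)
    (fun I hI => (hW I hI).1) (fun I hI P hP hPI => (hmem P).mpr
      ⟨(Nat.le_of_dvd (hIpos I hI) (map_dvd Ideal.absNorm hPI)).trans (hW I hI).2, hP⟩)).trans hprod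
  rcases Nat.eq_zero_or_pos B with hB | hB
  · have : W = ∅ := Finset.eq_empty_of_forall_notMem fun I hI => by
      have := hIpos I hI
      have := (hW I hI).2
      omega
    rw [this]
    simp only [Finset.card_empty, Nat.cast_zero]
    positivity
  · have hB' : (0 : ℝ) < B := by exact_mod_cast hB
    have h4 : (W.card : ℝ) * ((B : ℝ) ^ 2)⁻¹ ≤ ∑ I ∈ W, ((I.absNorm : ℝ) ^ 2)⁻¹ := by
      rw [← nsmul_eq_mul]
      refine Finset.card_nsmul_le_sum _ _ _ fun I hI => ?_
      have h5 : (0 : ℝ) < I.absNorm := by exact_mod_cast hIpos I hI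
      have h6 : (I.absNorm : ℝ) ≤ B := by exact_mod_cast (hW I hI).2
      exact inv_anti₀ (by positivity) (by gcongr)
    have h5 := h4.trans hsum
    rwa [← div_eq_mul_inv, div_le_iff₀ (by positivity)] at h5

theorem Matrix.det_blockDiagonal_sigma {ι : Type*} [Fintype ι] [DecidableEq ι] {m : ι → Type*}
    [∀ i, Fintype (m i)] [∀ i, DecidableEq (m i)] {R : Type*} [CommRing R]
    (M : ∀ i, Matrix (m i) (m i) R) : (Matrix.blockDiagonal' M).det = ∏ i, (M i).det := by
  classical
  let _ : LinearOrder ι := linearOrderOfSTO (WellOrderingRel (α := ι))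
  have h : (Matrix.blockDiagonal' M).BlockTriangular Sigma.fst := by
    rintro ⟨i, a⟩ ⟨j, b⟩ hij
    exact Matrix.blockDiagonal'_apply_ne _ _ _ (ne_of_gt hij)
  have h2 := h.det_fintype
  convert h2 using 2 with i
  rw [← Matrix.det_submatrix_equiv_self (Equiv.sigmaSubtype i).symm]
  congr 1
  ext a b
  change M i a b = Matrix.blockDiagonal' M ⟨i, a⟩ ⟨i, b⟩
  rw [Matrix.blockDiagonal'_apply_eq]

open NumberField in
theorem NumberField.abs_discr_eq_norm_det_sq {K : Type*} [Field K] [NumberField K]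
    (e : (K →+* ℂ) ≃ Module.Free.ChooseBasisIndex ℤ (𝓞 K)) [DecidableEq (K →+* ℂ)] :
    ((|discr K| : ℤ) : ℝ) = ‖(Matrix.of fun φ ψ : K →+* ℂ =>
      ψ (RingOfIntegers.basis K (e φ) : K)).det‖ ^ 2 := by
  classical
  have h1 := Algebra.discr_eq_det_embeddingsMatrixReindex_pow_two ℚ ℂ (integralBasis K)
    (e.symm.trans (RingHom.equivRatAlgHom K ℂ))
  rw [← coe_discr] at h1
  have h2 : (discr K : ℂ) = (Matrix.of fun φ ψ : K →+* ℂ =>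
      ψ (RingOfIntegers.basis K (e φ) : K)).det ^ 2 := by
    rw [← Matrix.det_submatrix_equiv_self e.symm]
    have : (algebraMap ℚ ℂ (discr K : ℚ)) = (discr K : ℂ) := by simp
    rw [← this, h1]
    congr 2
    ext i j
    simp [Algebra.embeddingsMatrixReindex, Algebra.embeddingsMatrix, integralBasis_apply]
  rw [← norm_pow, ← h2, Complex.norm_intCast]
  simp

open NumberField in
/-- A product of discriminants of number fields is bounded by the square of any nonvanishing
determinant formed from all the conjugates of tuples of algebraic integers. -/
theorem NumberField.prod_abs_discr_le {ι : Type*} [Fintype ι] [DecidableEq ι] (L : ι → Type*)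
    [∀ i, Field (L i)] [∀ i, NumberField (L i)] {Λ : Type*} [Fintype Λ] [DecidableEq Λ]
    (e : Λ ≃ Σ i, (L i →+* ℂ)) (g : Λ → ∀ i, 𝓞 (L i))
    (h : (Matrix.of fun a b : Λ => (e b).2 (g a (e b).1 : L (e b).1)).det ≠ 0) :
    ∏ i, ((|discr (L i)| : ℤ) : ℝ) ≤
      ‖(Matrix.of fun a b : Λ => (e b).2 (g a (e b).1 : L (e b).1)).det‖ ^ 2 := by
  classical
  have hcard : ∀ i, Nonempty ((L i →+* ℂ) ≃ Module.Free.ChooseBasisIndex ℤ (𝓞 (L i))) := by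
    intro i
    refine ⟨Fintype.equivOfCardEq ?_⟩
    rw [← Module.finrank_eq_card_chooseBasisIndex, RingOfIntegers.rank, ← Embeddings.card (L i) ℂ]
  let f := fun i => (hcard i).some
  let B : Matrix (Σ i, (L i →+* ℂ)) (Σ i, (L i →+* ℂ)) ℂ := Matrix.blockDiagonal' fun i =>
    Matrix.of fun φ ψ : L i →+* ℂ => ψ (RingOfIntegers.basis (L i) (f i φ) : L i)
  let C : Matrix Λ (Σ i, (L i →+* ℂ)) ℤ := Matrix.of fun a c =>
    (RingOfIntegers.basis (L c.1)).repr (g a c.1) (f _ c.2)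
  have hmul : (Matrix.of fun a b : Λ => (e b).2 (g a (e b).1 : L (e b).1)) =
      (Int.castRingHom ℂ).mapMatrix (C.submatrix id e) * B.submatrix e e := by
    rw [RingHom.mapMatrix_apply, ← Matrix.submatrix_map, Matrix.submatrix_mul_equiv]
    ext a b
    simp only [Matrix.of_apply, Matrix.submatrix_apply, id]
    generalize e b = b'
    obtain ⟨i, ψ⟩ := b'
    rw [Matrix.mul_apply, Fintype.sum_sigma, Finset.sum_eq_single i]
    · simp only [Matrix.map_apply, C, B, Matrix.of_apply, Matrix.blockDiagonal'_apply_eq]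
      rw [(f i).sum_comp fun k => (Int.castRingHom ℂ) ((RingOfIntegers.basis (L i)).repr (g a i) k)
        * ψ (RingOfIntegers.basis (L i) k : L i)]
      conv_lhs => rw [← (RingOfIntegers.basis (L i)).sum_repr (g a i)]
      simp
    · intro j _ hj
      refine Finset.sum_eq_zero fun φ _ => ?_
      exact mul_eq_zero_of_right _ (Matrix.blockDiagonal'_apply_ne _ _ _ hj)
    · simp
  rw [hmul, Matrix.det_mul] at h ⊢
  rw [Matrix.det_submatrix_equiv_self, Matrix.det_blockDiagonal_sigma] at h ⊢
  rw [← RingHom.map_det] at h ⊢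
  rw [norm_mul, mul_pow, norm_prod, ← Finset.prod_pow]
  simp only [← abs_discr_eq_norm_det_sq]
  have hC : (C.submatrix id e).det ≠ 0 := by
    intro h0
    simp [h0] at h
  have : (1 : ℝ) ≤ ‖(Int.castRingHom ℂ) (C.submatrix id e).det‖ ^ 2 := by
    refine one_le_pow₀ ?_
    rw [eq_intCast, Complex.norm_intCast]
    exact_mod_cast Int.one_le_abs hC
  exact le_mul_of_one_le_left (Finset.prod_nonneg fun i _ => by positivity) this

open NumberField NumberField.InfinitePlace in
theorem NumberField.sum_embeddings_eq_sum_mult {K : Type*} [Field K] [NumberField K]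
    (s : (K →+* ℂ) → ℝ) (hs : ∀ φ, s (ComplexEmbedding.conjugate φ) = s φ) :
    ∑ φ : K →+* ℂ, s φ = ∑ w : InfinitePlace K, mult w * s w.embedding := by
  classical
  rw [← Finset.sum_fiberwise (g := fun φ : K →+* ℂ => InfinitePlace.mk φ)]
  refine Finset.sum_congr rfl fun w _ => ?_
  rw [← card_filter_mk_eq w, ← nsmul_eq_mul]
  refine Finset.sum_eq_card_nsmul fun φ hφ => ?_
  have h := (Finset.mem_filter.mp hφ).2
  rw [← mk_embedding w, mk_eq_iff] at h
  rcases h with h | h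
  · rw [h]
  · rw [← h, hs]

open scoped Classical in
open NumberField NumberField.InfinitePlace in
theorem NumberField.minkowskiBound_lt_volume {K : Type*} [Field K] [NumberField K]
    (f : InfinitePlace K → NNReal)
    (hf : ((∏ w, f w ^ mult w : NNReal) : ℝ) = 2 * √(|discr K| : ℤ)) :
    mixedEmbedding.minkowskiBound K ↑1 < MeasureTheory.volume (mixedEmbedding.convexBodyLT K f) := by
  classical
  rw [mixedEmbedding.convexBodyLT_volume, mixedEmbedding.minkowskiBound,
    mixedEmbedding.volume_fundamentalDomain_fractionalIdealLatticeBasis,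
    Units.val_one, FractionalIdeal.absNorm_one, Rat.cast_one,
    ENNReal.ofReal_one, one_mul, mixedEmbedding.finrank,
    mixedEmbedding.volume_fundamentalDomain_latticeBasis]
  have h1 : ((∏ w, f w ^ mult w : NNReal)) = 2 * NNReal.sqrt ‖discr K‖₊ := by
    apply NNReal.coe_injective
    rw [hf]
    simp [Int.norm_eq_abs]
  rw [h1, ← card_add_two_mul_card_eq_rank K]
  have h2 : (2 : ENNReal)⁻¹ = ((2⁻¹ : NNReal) : ENNReal) := by simp
  have h3 : (2 : ENNReal) = ((2 : NNReal) : ENNReal) := by simp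
  rw [h2, h3]
  norm_cast
  rw [← NNReal.coe_lt_coe]
  push_cast
  set r₁ := nrRealPlaces K
  set r₂ := nrComplexPlaces K
  have hd : 0 < √(‖discr K‖) := by
    rw [Real.sqrt_pos, norm_pos_iff]
    exact discr_ne_zero K
  have h4 : (2 : ℝ)⁻¹ ^ r₂ * 2 ^ (r₁ + 2 * r₂) = 2 ^ r₁ * 2 ^ r₂ := by
    rw [pow_add, two_mul, pow_add, inv_pow]
    field_simp
  have h5 : (2 : ℝ) ^ r₂ ≤ Real.pi ^ r₂ := pow_le_pow_left₀ (by norm_num) Real.two_le_pi _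
  have h6 : (0 : ℝ) < 2 ^ r₁ * Real.pi ^ r₂ := by positivity
  calc (2 : ℝ)⁻¹ ^ r₂ * √(‖discr K‖) * 2 ^ (r₁ + 2 * r₂)
      = 2 ^ r₁ * 2 ^ r₂ * √(‖discr K‖) := by rw [← h4]; ring
    _ ≤ 2 ^ r₁ * Real.pi ^ r₂ * √(‖discr K‖) := by gcongr
    _ < 2 ^ r₁ * Real.pi ^ r₂ * (2 * √(‖discr K‖)) := by
        refine mul_lt_mul_of_pos_left ?_ h6
        linarith

open NumberField NumberField.InfinitePlace in
/-- Minkowski's theorem with prescribed logarithmic sizes at all embeddings. -/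
theorem NumberField.exists_integer_log_norm_lt (K : Type*) [Field K] [NumberField K]
    (s : (K →+* ℂ) → ℝ) (hs : ∀ φ, s (ComplexEmbedding.conjugate φ) = s φ) (h0 : ∑ φ, s φ = 0) :
    ∃ x : 𝓞 K, x ≠ 0 ∧ ((Ideal.span {x}).absNorm : ℝ) ≤ 2 * √(|discr K| : ℤ) ∧
      ∀ φ : K →+* ℂ, Real.log ‖φ x‖ - s φ < Real.log (2 * √(|discr K| : ℤ)) / Module.finrank ℚ K ∧
        Real.log (2 * √(|discr K| : ℤ)) / Module.finrank ℚ K - Real.log (2 * √(|discr K| : ℤ)) ≤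
          Real.log ‖φ x‖ - s φ := by
  classical
  set d := Module.finrank ℚ K with hd
  have hd0 : (0 : ℝ) < d := Nat.cast_pos.mpr Module.finrank_pos
  have hdisc : (1 : ℝ) ≤ √(|discr K| : ℤ) := by
    rw [Real.one_le_sqrt]
    exact_mod_cast Int.one_le_abs (discr_ne_zero K)
  obtain ⟨l, hl⟩ : ∃ l, l = Real.log (2 * √(|discr K| : ℤ)) := ⟨_, rfl⟩
  have hexpl : Real.exp l = 2 * √(|discr K| : ℤ) := by
    rw [hl, Real.exp_log (by linarith)]
  let f : InfinitePlace K → NNReal := fun w => Real.toNNReal (Real.exp (s w.embedding + l / d))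
  have hf : ((∏ w, f w ^ mult w : NNReal) : ℝ) = 2 * √(|discr K| : ℤ) := by
    rw [NNReal.coe_prod]
    simp only [NNReal.coe_pow, f, Real.coe_toNNReal _ (Real.exp_pos _).le, ← Real.exp_nat_mul]
    rw [← Real.exp_sum, ← sum_embeddings_eq_sum_mult (fun φ => s φ + l / d) (fun φ => by rw [hs]),
      Finset.sum_add_distrib, h0, Finset.sum_const, Finset.card_univ, Embeddings.card, ← hd,
      nsmul_eq_mul, mul_div_cancel₀ _ hd0.ne', zero_add, hexpl]
  obtain ⟨x, hx0, hx⟩ := mixedEmbedding.exists_ne_zero_mem_ringOfIntegers_lt K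
    (minkowskiBound_lt_volume f hf)
  have hxK : (x : K) ≠ 0 := RingOfIntegers.coe_ne_zero_iff.mpr hx0
  have hpos : ∀ φ : K →+* ℂ, 0 < ‖φ x‖ := fun φ =>
    norm_pos_iff.mpr (by rwa [Ne, map_eq_zero])
  have hup : ∀ φ : K →+* ℂ, Real.log ‖φ x‖ - s φ < l / d := by
    intro φ
    have h1 := hx (InfinitePlace.mk φ)
    rw [apply] at h1
    have h2 : s (InfinitePlace.mk φ).embedding = s φ := by
      rcases embedding_mk_eq φ with h | h <;> rw [h]
      exact hs φ
    simp only [f, Real.coe_toNNReal _ (Real.exp_pos _).le, h2] at h1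
    have h3 := (Real.log_lt_iff_lt_exp (hpos φ)).mpr h1
    linarith
  have hnorm : ((Ideal.span {x}).absNorm : ℝ) = ∏ φ : K →+* ℂ, ‖φ x‖ := by
    have h1 := Algebra.norm_eq_prod_embeddings ℚ ℂ (x : K)
    rw [Ideal.absNorm_span_singleton]
    have h2 : ∏ ψ : K →+* ℂ, ‖ψ x‖ = ‖((Algebra.norm ℚ (x : K) : ℚ) : ℂ)‖ := by
      have e : (algebraMap ℚ ℂ) (Algebra.norm ℚ (x : K)) = ((Algebra.norm ℚ (x : K) : ℚ) : ℂ) := rfl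
      rw [← e, h1, norm_prod]
      exact (Fintype.prod_equiv (RingHom.equivRatAlgHom K ℂ) _ _ fun ψ => rfl)
    rw [h2, ← Algebra.coe_norm_int]
    simp [Nat.cast_natAbs]
  have hsum : Real.log ((Ideal.span {x}).absNorm : ℝ) = ∑ φ : K →+* ℂ, (Real.log ‖φ x‖ - s φ) := by
    rw [hnorm, Real.log_prod (fun φ _ => (hpos φ).ne'), Finset.sum_sub_distrib, h0, sub_zero]
  have hone : (1 : ℝ) ≤ (Ideal.span {x}).absNorm := by
    rw [hnorm]
    exact one_le_prod_norm_of_isIntegral x.isIntegral_coe hxK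
  rw [← hl]
  refine ⟨x, hx0, ?_, fun φ => ⟨hup φ, ?_⟩⟩
  · rw [← hexpl, ← Real.log_le_iff_le_exp (by linarith), hsum]
    calc _ ≤ ∑ φ : K →+* ℂ, l / d := Finset.sum_le_sum fun φ _ => (hup φ).le
      _ = l := by
        rw [Finset.sum_const, Finset.card_univ, Embeddings.card, ← hd, nsmul_eq_mul,
          mul_div_cancel₀ _ hd0.ne']
  · have h1 := Real.log_nonneg hone
    rw [hsum, ← Finset.add_sum_erase _ _ (Finset.mem_univ φ)] at h1
    have h2 : ∑ ψ ∈ Finset.univ.erase φ, (Real.log ‖ψ x‖ - s ψ) ≤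
        ∑ ψ ∈ Finset.univ.erase φ, l / d := Finset.sum_le_sum fun ψ _ => (hup ψ).le
    rw [Finset.sum_const, Finset.card_erase_of_mem (Finset.mem_univ φ), Finset.card_univ,
      Embeddings.card, ← hd, nsmul_eq_mul, Nat.cast_sub Module.finrank_pos] at h2
    have h3 : ((d : ℝ) - (1 : ℕ)) * (l / d) = l - l / d := by
      field_simp
      push_cast
      ring
    simp only [Nat.succ_eq_add_one, zero_add] at h2
    linarith

theorem abs_sub_le_of_floor_eq {a b δ : ℝ} (hδ : 0 < δ) (ha : 0 ≤ a) (hb : 0 ≤ b)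
    (h : ⌊a / δ⌋₊ = ⌊b / δ⌋₊) : |a - b| ≤ δ := by
  have h1 := Nat.floor_le (div_nonneg ha hδ.le)
  have h2 := Nat.floor_le (div_nonneg hb hδ.le)
  have h3 := Nat.lt_floor_add_one (a / δ)
  have h4 := Nat.lt_floor_add_one (b / δ)
  rw [h] at h1 h3
  rw [le_div_iff₀ hδ] at h1 h2
  rw [div_lt_iff₀ hδ] at h3 h4
  rw [abs_le]
  constructor <;> linarith

open NumberField in
/-- In a finite family of number fields, units whose logarithms are simultaneously close to a
common multiple of prescribed logarithmic vectors, and whose arguments at prescribed embeddings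
are small. -/
theorem NumberField.exists_units_log_close {ι : Type*} [Fintype ι] (L : ι → Type*)
    [∀ i, Field (L i)] [∀ i, NumberField (L i)] (s : ∀ i, (L i →+* ℂ) → ℝ)
    (hs : ∀ i φ, s i (ComplexEmbedding.conjugate φ) = s i φ) (h0 : ∀ i, ∑ φ, s i φ = 0)
    {κ : Type*} [Fintype κ] (R : κ → Σ i, (L i →+* ℂ)) {δ W : ℝ} (hδ : 0 < δ)
    (hW : ∀ i, Real.log (2 * √(|discr (L i)| : ℤ)) ≤ W) (P : ℕ)
    (hP : (∏ i, (2 ^ Module.finrank ℚ (L i) * (4 * ((|discr (L i)| : ℤ) : ℝ)))) *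
      (W / δ + 1) ^ Fintype.card (Σ i, (L i →+* ℂ)) * (7 / δ + 1) ^ Fintype.card κ ≤ P) :
    ∃ p : ℕ, 0 < p ∧ p ≤ P ∧ ∃ u : ∀ i, (𝓞 (L i))ˣ,
      (∀ i φ, |Real.log ‖φ (u i : 𝓞 (L i))‖ - p * s i φ| ≤ δ) ∧
      ∀ k, ∃ z : ℂ, Complex.exp z = (R k).2 (u (R k).1 : 𝓞 (L (R k).1)) ∧ |z.im| ≤ δ := by
  classical
  have hex : ∀ (k : ℕ) (i : ι), _ := fun k i => exists_integer_log_norm_lt (L i)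
    (fun φ => k * s i φ) (fun φ => by rw [hs]) (by rw [← Finset.mul_sum, h0, mul_zero])
  choose x hx0 hxN hx using hex
  let l : ι → ℝ := fun i => Real.log (2 * √(|discr (L i)| : ℤ))
  let lo : ι → ℝ := fun i => l i / Module.finrank ℚ (L i) - l i
  let v : ℕ → (Σ i, (L i →+* ℂ)) → ℝ := fun k c =>
    Real.log ‖c.2 (x k c.1)‖ - k * s c.1 c.2 - lo c.1
  let a : ℕ → κ → ℝ := fun k c => ((R c).2 (x k (R c).1)).arg + Real.pi
  have hv0 : ∀ k c, 0 ≤ v k c := fun k c => sub_nonneg.mpr (hx k c.1 c.2).2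
  have hvW : ∀ k c, v k c ≤ W := fun k c => by
    have h1 := (hx k c.1 c.2).1
    have h2 := hW c.1
    simp only [v, lo, l]
    linarith
  have ha0 : ∀ k c, 0 ≤ a k c := fun k c => by
    have := Complex.neg_pi_lt_arg ((R c).2 (x k (R c).1))
    simp only [a]
    linarith
  have ha7 : ∀ k c, a k c ≤ 7 := fun k c => by
    have := Complex.arg_le_pi ((R c).2 (x k (R c).1))
    have := Real.pi_lt_d2
    simp only [a]
    linarith
  let S : ∀ i, Finset (Ideal (𝓞 (L i))) := fun i =>
    (Ideal.finite_setOfPred_absNorm_le ⌊2 * √(|discr (L i)| : ℤ)⌋₊).toFinset.filter (· ≠ 0)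
  let t := Fintype.piFinset S ×ˢ
    (Fintype.piFinset fun _ : (Σ i, (L i →+* ℂ)) => Finset.range (⌊W / δ⌋₊ + 1)) ×ˢ
    (Fintype.piFinset fun _ : κ => Finset.range (⌊7 / δ⌋₊ + 1))
  let g : ℕ → (∀ i, Ideal (𝓞 (L i))) × ((Σ i, (L i →+* ℂ)) → ℕ) × (κ → ℕ) := fun k =>
    (fun i => Ideal.span {x k i}, fun c => ⌊v k c / δ⌋₊, fun c => ⌊a k c / δ⌋₊)
  have hmaps : Set.MapsTo g (Finset.range (P + 1)) t := by
    intro k _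
    simp only [t, g, Finset.coe_product, Set.mem_prod, Finset.mem_coe, Fintype.mem_piFinset,
      Finset.mem_range, Nat.lt_succ_iff]
    refine ⟨fun i => ?_, fun c => ?_, fun c => ?_⟩
    · simp only [S, Finset.mem_filter, Set.Finite.mem_toFinset, Set.mem_ofPred_eq]
      refine ⟨Nat.le_floor (hxN k i), ?_⟩
      simpa using hx0 k i
    · exact Nat.floor_le_floor (by gcongr; exact hvW k c)
    · exact Nat.floor_le_floor (by gcongr; exact ha7 k c)
  have hS : ∀ i, ((S i).card : ℝ) ≤
      2 ^ Module.finrank ℚ (L i) * (4 * ((|discr (L i)| : ℤ) : ℝ)) := by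
    intro i
    refine (card_ideals_absNorm_le ⌊2 * √(|discr (L i)| : ℤ)⌋₊ (S i) ?_).trans ?_
    · intro I hI
      simp only [S, Finset.mem_filter, Set.Finite.mem_toFinset, Set.mem_ofPred_eq] at hI
      exact ⟨hI.2, hI.1⟩
    · gcongr
      have h1 : (⌊2 * √(|discr (L i)| : ℤ)⌋₊ : ℝ) ≤ 2 * √(|discr (L i)| : ℤ) :=
        Nat.floor_le (by positivity)
      refine (pow_le_pow_left₀ (by positivity) h1 2).trans (le_of_eq ?_)
      rw [mul_pow, Real.sq_sqrt (by positivity)]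
      norm_num
  have hcard : t.card < (Finset.range (P + 1)).card := by
    rw [Finset.card_range, Nat.lt_succ_iff]
    have h1 : (t.card : ℝ) ≤ P := by
      refine le_trans ?_ hP
      simp only [t, Finset.card_product, Fintype.card_piFinset, Finset.card_range,
        Finset.prod_const, Finset.card_univ]
      push_cast
      rw [mul_assoc]
      by_cases hne : Nonempty (Σ i, (L i →+* ℂ))
      · have hW0 : 0 ≤ W := (hv0 0 hne.some).trans (hvW 0 hne.some)
        gcongr with i
        · exact (hS i).trans_eq (by push_cast; rfl)
        · exact Nat.floor_le (by positivity)
        · exact Nat.floor_le (by positivity)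
      · have hc : Fintype.card (Σ i, (L i →+* ℂ)) = 0 :=
          Fintype.card_eq_zero_iff.mpr (not_nonempty_iff.mp hne)
        rw [hc, pow_zero, pow_zero]
        gcongr with i
        · exact (hS i).trans_eq (by push_cast; rfl)
        · exact Nat.floor_le (by positivity)
    exact_mod_cast h1
  obtain ⟨k, hk, k', hk', hne, hg⟩ := Finset.exists_ne_map_eq_of_card_lt_of_maps_to hcard hmaps
  wlog hlt : k < k' generalizing k k'
  · exact this k' hk' k hk hne.symm hg.symm (lt_of_le_of_ne (not_lt.mp hlt) hne.symm)
  simp only [g, Prod.mk.injEq] at hg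
  obtain ⟨hg1, hg2, hg3⟩ := hg
  have hu : ∀ i, ∃ u : (𝓞 (L i))ˣ, x k i * u = x k' i := fun i =>
    Ideal.span_singleton_eq_span_singleton.mp (congrFun hg1 i)
  choose u hu using hu
  have hne0 : ∀ k i (φ : L i →+* ℂ), φ (x k i) ≠ 0 := fun k i φ => by
    rw [Ne, map_eq_zero]
    exact RingOfIntegers.coe_ne_zero_iff.mpr (hx0 k i)
  have hφu : ∀ i (φ : L i →+* ℂ), φ (u i : 𝓞 (L i)) = φ (x k' i) / φ (x k i) := fun i φ => by
    rw [eq_div_iff (hne0 k i φ), ← hu i, mul_comm, ← map_mul, ← map_mul]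
  have hp : ((k' - k : ℕ) : ℝ) = k' - k := Nat.cast_sub hlt.le
  refine ⟨k' - k, Nat.sub_pos_of_lt hlt, ?_, u, fun i φ => ?_, fun c => ?_⟩
  · have := Finset.mem_range.mp hk'
    omega
  · have h1 := abs_sub_le_of_floor_eq hδ (hv0 k' ⟨i, φ⟩) (hv0 k ⟨i, φ⟩) (congrFun hg2 _).symm
    rw [hφu, norm_div, Real.log_div (norm_ne_zero_iff.mpr (hne0 _ _ _))
      (norm_ne_zero_iff.mpr (hne0 _ _ _)), hp]
    convert h1 using 2
    simp only [v]
    ring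
  · refine ⟨Complex.log ((R c).2 (x k' (R c).1)) - Complex.log ((R c).2 (x k (R c).1)), ?_, ?_⟩
    · rw [Complex.exp_sub, Complex.exp_log (hne0 _ _ _), Complex.exp_log (hne0 _ _ _), hφu]
    · have h1 := abs_sub_le_of_floor_eq hδ (ha0 k' c) (ha0 k c) (congrFun hg3 _).symm
      rw [Complex.sub_im, Complex.log_im, Complex.log_im]
      convert h1 using 2
      simp only [a]
      ring

open Polynomial in
theorem Polynomial.isIntegral_coeff_of_X_sub_C_mul {A : Type*} [CommRing A] [IsDomain A] {θ : A} (q : A[X])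
    (h : ∀ k, IsIntegral ℤ (((X - C θ) * q).coeff k)) : ∀ k, IsIntegral ℤ (q.coeff k) := by
  induction hc : q.support.card using Nat.strong_induction_on generalizing q with
  | _ N ih =>
    by_cases hq : q = 0
    · intro k
      simpa [hq] using isIntegral_zero
    set m := q.natDegree with hm
    set c := q.leadingCoeff with hcdef
    have hcI : IsIntegral ℤ c := by
      have h1 := h (m + 1)
      rwa [sub_mul, coeff_sub, coeff_X_mul, coeff_C_mul, coeff_eq_zero_of_natDegree_lt (Nat.lt_succ_self _),
        mul_zero, sub_zero] at h1
    have hcθ : IsIntegral ℤ (c * θ) := by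
      let B := integralClosure ℤ A
      let p : B[X] := ∑ k ∈ Finset.range (m + 2), C (⟨((X - C θ) * q).coeff k, h k⟩ : B) * X ^ k
      have hp : p.map (algebraMap B A) = (X - C θ) * q := by
        have hdeg : ((X - C θ) * q).natDegree < m + 2 := by
          rw [(monic_X_sub_C θ).natDegree_mul' hq, natDegree_X_sub_C]
          omega
        rw [as_sum_range' _ _ hdeg, Polynomial.map_sum]
        refine Finset.sum_congr rfl fun k _ => ?_
        rw [← C_mul_X_pow_eq_monomial]
        simp only [Polynomial.map_mul, map_C, Polynomial.map_pow, map_X]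
        rfl
      have hlead : ((p.leadingCoeff : B) : A) = c := by
        have h1 : (p.map (algebraMap B A)).leadingCoeff = algebraMap B A p.leadingCoeff :=
          leadingCoeff_map_of_injective Subtype.val_injective p
        rw [hp, leadingCoeff_mul, leadingCoeff_X_sub_C, one_mul] at h1
        exact h1.symm
      have h0 : aeval θ p = 0 := by
        rw [← eval_map_algebraMap, hp]
        simp
      have h2 := isIntegral_leadingCoeff_smul p θ h0
      have h3 : IsIntegral ℤ (p.leadingCoeff • θ) := isIntegral_trans _ h2
      rwa [Algebra.smul_def, show algebraMap B A p.leadingCoeff = c from hlead] at h3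
    have h1 : ∀ k, IsIntegral ℤ (q.eraseLead.coeff k) := by
      refine ih _ ?_ q.eraseLead ?_ rfl
      · rw [← hc]
        exact eraseLead_support_card_lt hq
      · intro k
        have h2 : (X - C θ) * q.eraseLead = (X - C θ) * q - (monomial (m + 1) c - monomial m (c * θ)) := by
          rw [show q.eraseLead = q - monomial m c from
            eq_sub_of_add_eq q.eraseLead_add_monomial_natDegree_leadingCoeff]
          rw [mul_sub, sub_mul X (C θ) (monomial m c), X_mul_monomial, C_mul_monomial, mul_comm θ]
        rw [h2, coeff_sub, coeff_sub, coeff_monomial, coeff_monomial]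
        refine (h k).sub (IsIntegral.sub ?_ ?_)
        · split_ifs
          exacts [hcI, isIntegral_zero]
        · split_ifs
          exacts [hcθ, isIntegral_zero]
    intro k
    rw [← q.eraseLead_add_monomial_natDegree_leadingCoeff, coeff_add, coeff_monomial]
    refine (h1 k).add ?_
    split_ifs
    exacts [hcI, isIntegral_zero]

section

open Polynomial

variable {n : ℕ} {θ : Fin n → ℂ} {f : ℤ[X]} {c : ℤ}

theorem isIntegral_coeff_prod_X_sub_C
    (hf : f.map (Int.castRingHom ℂ) = C (c : ℂ) * ∏ i, (X - C (θ i))) (S : Finset (Fin n)) (k : ℕ) :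
    IsIntegral ℤ ((C (c : ℂ) * ∏ i ∈ S, (X - C (θ i))).coeff k) := by
  classical
  suffices h : ∀ (T : Finset (Fin n)) (k : ℕ),
      IsIntegral ℤ ((C (c : ℂ) * ∏ i ∈ Tᶜ, (X - C (θ i))).coeff k) by
    simpa using h Sᶜ k
  intro T
  induction T using Finset.induction_on with
  | empty =>
    intro k
    rw [Finset.compl_empty, ← hf, coeff_map]
    exact isIntegral_algebraMap
  | insert a T ha ih =>
    refine Polynomial.isIntegral_coeff_of_X_sub_C_mul (θ := θ a) _ fun k => ?_
    have h1 : a ∈ Tᶜ := Finset.mem_compl.mpr ha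
    have h2 : (insert a T)ᶜ = Tᶜ.erase a := by
      ext x
      simp
    rw [h2, mul_left_comm, Finset.mul_prod_erase Tᶜ (fun i => X - C (θ i)) h1]
    exact ih k

theorem isIntegral_mul_prod_roots
    (hf : f.map (Int.castRingHom ℂ) = C (c : ℂ) * ∏ i, (X - C (θ i))) (S : Finset (Fin n)) :
    IsIntegral ℤ ((c : ℂ) * ∏ i ∈ S, θ i) := by
  have h := isIntegral_coeff_prod_X_sub_C hf S 0
  rw [coeff_C_mul, coeff_zero_prod] at h
  simp only [coeff_sub, coeff_X_zero, coeff_C_zero, zero_sub] at h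
  rw [Finset.prod_neg, mul_left_comm] at h
  rcases neg_one_pow_eq_or ℂ S.card with h1 | h1 <;> rw [h1] at h
  · simpa using h
  · simpa using h.neg

theorem isIntegral_pow_mul_prod_pow
    (hf : f.map (Int.castRingHom ℂ) = C (c : ℂ) * ∏ i, (X - C (θ i))) {m : ℕ} (e : Fin n → ℕ)
    (he : ∀ v, e v ≤ m) : IsIntegral ℤ ((c : ℂ) ^ m * ∏ i, θ i ^ e i) := by
  have h : (c : ℂ) ^ m * ∏ i, θ i ^ e i =
      ∏ r ∈ Finset.range m, ((c : ℂ) * ∏ i with r < e i, θ i) := by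
    rw [Finset.prod_mul_distrib, Finset.prod_const, Finset.card_range]
    congr 1
    simp_rw [Finset.prod_filter]
    rw [Finset.prod_comm]
    refine Finset.prod_congr rfl fun i _ => ?_
    rw [← Finset.prod_filter, Finset.prod_const]
    congr 1
    have : (Finset.range m).filter (fun r => r < e i) = Finset.range (e i) := by
      ext r
      have := he i
      simp only [Finset.mem_filter, Finset.mem_range]
      omega
    rw [this, Finset.card_range]
  rw [h]
  exact IsIntegral.prod _ fun r _ => isIntegral_mul_prod_roots hf _

/-- A power of the leading coefficient times a product of differences of roots is an algebraic
integer if each root occurs at most as often as the leading coefficient. -/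
theorem isIntegral_pow_mul_prod_sub
    (hf : f.map (Int.castRingHom ℂ) = C (c : ℂ) * ∏ i, (X - C (θ i))) {m : ℕ}
    (M : Multiset (Fin n × Fin n))
    (hM : ∀ v, (M.map Prod.fst).count v + (M.map Prod.snd).count v ≤ m) :
    IsIntegral ℤ ((c : ℂ) ^ m * (M.map fun p => θ p.1 - θ p.2).prod) := by
  suffices h : ∀ (e : Fin n → ℕ),
      (∀ v, e v + (M.map Prod.fst).count v + (M.map Prod.snd).count v ≤ m) →
      IsIntegral ℤ ((c : ℂ) ^ m * (∏ i, θ i ^ e i) * (M.map fun p => θ p.1 - θ p.2).prod) by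
    simpa using h 0 (by simpa using hM)
  clear hM
  induction M using Multiset.induction_on with
  | empty =>
    intro e he
    simpa using isIntegral_pow_mul_prod_pow hf e (by simpa using he)
  | cons p M ih =>
    intro e he
    have hmul : ∀ j : Fin n, ∏ i, θ i ^ (e + Pi.single j 1 : Fin n → ℕ) i = (∏ i, θ i ^ e i) * θ j := by
      intro j
      simp only [Pi.add_apply, pow_add, Finset.prod_mul_distrib]
      congr 1
      rw [Finset.prod_eq_single j]
      · simp
      · intro i _ hij
        simp [Pi.single_eq_of_ne hij]
      · simp
    have h1 := ih (e + Pi.single p.1 1) fun v => by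
      have := he v
      simp only [Multiset.map_cons, Multiset.count_cons, Pi.add_apply, Pi.single_apply] at this ⊢
      split_ifs at this ⊢ <;> omega
    have h2 := ih (e + Pi.single p.2 1) fun v => by
      have := he v
      simp only [Multiset.map_cons, Multiset.count_cons, Pi.add_apply, Pi.single_apply] at this ⊢
      split_ifs at this ⊢ <;> omega
    rw [hmul] at h1 h2
    have h3 := h1.sub h2
    rw [Multiset.map_cons, Multiset.prod_cons]
    refine (congrArg (IsIntegral ℤ) ?_).mp h3
    ring

end

section

open Polynomial

/-- The `a`-th partial Horner polynomial of `f`, with the zeroth one replaced by `1`. -/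
noncomputable def hornerPoly (f : ℤ[X]) (n a : ℕ) : ℤ[X] :=
  if a = 0 then 1 else ∑ i ∈ Finset.Icc (n - a) n, monomial (i - (n - a)) (f.coeff i)

theorem natDegree_hornerPoly_le (f : ℤ[X]) (n a : ℕ) : (hornerPoly f n a).natDegree ≤ a := by
  unfold hornerPoly
  split_ifs with h
  · simp
  · refine natDegree_sum_le_of_forall_le _ _ fun i hi => (natDegree_monomial_le _).trans ?_
    have := Finset.mem_Icc.mp hi
    omega

theorem coeff_hornerPoly_self (f : ℤ[X]) {n a : ℕ} (ha : a ≤ n) :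
    (hornerPoly f n a).coeff a = if a = 0 then 1 else f.coeff n := by
  unfold hornerPoly
  split_ifs with h
  · simp [h]
  · rw [finsetSum_coeff, Finset.sum_eq_single n]
    · rw [coeff_monomial, if_pos (by omega)]
    · intro i hi hin
      have := Finset.mem_Icc.mp hi
      rw [coeff_monomial, if_neg (by omega)]
    · intro h
      exact absurd (Finset.mem_Icc.mpr ⟨by omega, le_rfl⟩) h

variable {n : ℕ} {θ : Fin n → ℂ} {f : ℤ[X]} {c : ℤ}

theorem isIntegral_aeval_hornerPoly (hc : c ≠ 0)
    (hf : f.map (Int.castRingHom ℂ) = C (c : ℂ) * ∏ i, (X - C (θ i))) {a : ℕ} (ha : a < n) (i : Fin n) :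
    IsIntegral ℤ (aeval (θ i) (hornerPoly f n a)) := by
  unfold hornerPoly
  split_ifs with h0
  · simpa using isIntegral_one
  have hcC : (c : ℂ) ≠ 0 := by exact_mod_cast hc
  have hdeg : (f.map (Int.castRingHom ℂ)).natDegree = n := by
    rw [hf, natDegree_C_mul hcC, natDegree_prod_of_monic _ _ fun i _ => monic_X_sub_C _]
    simp
  have hdiv : f.map (Int.castRingHom ℂ) /ₘ (X - C (θ i)) =
      C (c : ℂ) * ∏ j ∈ Finset.univ.erase i, (X - C (θ j)) := by
    rw [hf, ← Finset.mul_prod_erase Finset.univ (fun j => X - C (θ j)) (Finset.mem_univ i), mul_left_comm,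
      mul_divByMonic_cancel_left _ (monic_X_sub_C _)]
  have h1 := isIntegral_coeff_prod_X_sub_C hf (Finset.univ.erase i) (n - a - 1)
  rw [← hdiv, coeff_divByMonic_X_sub_C, hdeg, Nat.sub_add_cancel (by omega)] at h1
  refine (congrArg (IsIntegral ℤ) ?_).mp h1
  rw [map_sum]
  refine Finset.sum_congr rfl fun j _ => ?_
  rw [aeval_monomial, coeff_map, mul_comm]
  simp

theorem det_hornerPoly_sq
    (hf : f.map (Int.castRingHom ℂ) = C (c : ℂ) * ∏ i, (X - C (θ i))) :
    (Matrix.of fun a i : Fin n => aeval (θ i) (hornerPoly f n a)).det ^ 2 =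
      (c : ℂ) ^ (2 * n - 2) * (Matrix.vandermonde θ).det ^ 2 := by
  have hfn : f.coeff n = c := by
    have h1 : (f.map (Int.castRingHom ℂ)).coeff n = c := by
      have hm : (∏ i, (X - C (θ i))).Monic := monic_prod_of_monic _ _ fun i _ => monic_X_sub_C _
      have hd : (∏ i, (X - C (θ i))).natDegree = n := by
        rw [natDegree_prod_of_monic _ _ fun i _ => monic_X_sub_C _]
        simp
      rw [hf, coeff_C_mul]
      have h2 := hm.coeff_natDegree
      rw [hd] at h2
      rw [h2, mul_one]
    rw [coeff_map, eq_intCast] at h1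
    exact_mod_cast h1
  have h1 := Matrix.eval_matrixOfPolynomials_eq_vandermonde_mul_matrixOfPolynomials θ
    (fun a : Fin n => (hornerPoly f n a).map (Int.castRingHom ℂ))
    (fun a => natDegree_map_le.trans (natDegree_hornerPoly_le f n a))
  have h2 : (Matrix.of fun a i : Fin n => aeval (θ i) (hornerPoly f n a)) =
      (Matrix.of fun i j : Fin n => eval (θ i) ((hornerPoly f n j).map (Int.castRingHom ℂ))).transpose := by
    ext a i
    simp only [Matrix.of_apply, Matrix.transpose_apply]
    rw [← eval_map_algebraMap]
    rfl
  have h3 : (Matrix.of fun i j : Fin n =>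
      ((hornerPoly f n j).map (Int.castRingHom ℂ)).coeff i).IsUpperTriangular := by
    intro i j hij
    exact coeff_eq_zero_of_natDegree_lt
      ((natDegree_map_le.trans (natDegree_hornerPoly_le f n j)).trans_lt hij)
  rw [h2, Matrix.det_transpose, h1, Matrix.det_mul, Matrix.det_of_isUpperTriangular h3, mul_pow, mul_comm]
  congr 1
  rw [show 2 * n - 2 = (n - 1) * 2 by omega, pow_mul]
  congr 1
  cases n with
  | zero => simp
  | succ m =>
    rw [Fin.prod_univ_succ]
    simp only [Matrix.of_apply, coeff_map, coeff_hornerPoly_self f (Fin.is_le' ..)]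
    simp [hfn]

end

section

open Polynomial

variable {n : ℕ} (θ : Fin n → ℂ)

/-- Evaluation of rational polynomials in two variables at a pair of the numbers `θ i`. -/
noncomputable def pairEval (ω : Fin n × Fin n) : MvPolynomial (Fin 2) ℚ →ₐ[ℚ] ℂ :=
  MvPolynomial.aeval ![θ ω.1, θ ω.2]

/-- The ideal of rational polynomial relations between the members of a pair. -/
noncomputable def pairIdeal (ω : Fin n × Fin n) : Ideal (MvPolynomial (Fin 2) ℚ) :=
  RingHom.ker (pairEval θ ω)

@[simp] theorem pairEval_X_zero (ω : Fin n × Fin n) : pairEval θ ω (MvPolynomial.X 0) = θ ω.1 := by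
  simp [pairEval]

@[simp] theorem pairEval_X_one (ω : Fin n × Fin n) : pairEval θ ω (MvPolynomial.X 1) = θ ω.2 := by
  simp [pairEval]

variable {θ}

theorem mem_pairIdeal {ω : Fin n × Fin n} {x : MvPolynomial (Fin 2) ℚ} :
    x ∈ pairIdeal θ ω ↔ pairEval θ ω x = 0 := RingHom.mem_ker

theorem finite_quotient_pairIdeal (hθ : ∀ i, IsIntegral ℚ (θ i)) (ω : Fin n × Fin n) :
    Module.Finite ℚ (MvPolynomial (Fin 2) ℚ ⧸ pairIdeal θ ω) := by
  have h1 : Module.Finite ℚ (Algebra.adjoin ℚ (Set.range ![θ ω.1, θ ω.2])) := by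
    refine Algebra.finite_adjoin_of_finite_of_isIntegral (Set.finite_range _) ?_
    rintro _ ⟨k, rfl⟩
    fin_cases k
    · exact hθ _
    · exact hθ _
  rw [Algebra.adjoin_range_eq_range_aeval] at h1
  have h2 : Module.Finite ℚ (pairEval θ ω).range := h1
  exact Module.Finite.equiv (Ideal.quotientKerEquivRange (pairEval θ ω)).symm.toLinearEquiv

theorem isMaximal_pairIdeal (hθ : ∀ i, IsIntegral ℚ (θ i)) (ω : Fin n × Fin n) :
    (pairIdeal θ ω).IsMaximal := by
  have h1 := finite_quotient_pairIdeal hθ ω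
  have h2 : (pairIdeal θ ω).IsPrime := RingHom.ker_isPrime _
  exact Ideal.Quotient.maximal_of_isField _
    (isField_of_isIntegral_of_isField' (R := ℚ) (Field.toIsField ℚ))

theorem pairEval_injective (hinj : Function.Injective θ) : Function.Injective (pairEval θ) := by
  intro ω ω' h
  refine Prod.ext (hinj ?_) (hinj ?_)
  · rw [← pairEval_X_zero θ ω, h, pairEval_X_zero]
  · rw [← pairEval_X_one θ ω, h, pairEval_X_one]

/-- Every complex embedding of the quotient by the ideal of a pair comes from a pair. -/
theorem exists_pairEval_eq {f : ℤ[X]} {c : ℤ} (hc : c ≠ 0)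
    (hf : f.map (Int.castRingHom ℂ) = C (c : ℂ) * ∏ i, (X - C (θ i))) (φ : MvPolynomial (Fin 2) ℚ →+* ℂ)
    {ω : Fin n × Fin n} (hφ : ∀ x ∈ pairIdeal θ ω, φ x = 0) :
    ∃ ω', φ = (pairEval θ ω' : MvPolynomial (Fin 2) ℚ →+* ℂ) := by
  have hroot : ∀ z : ℂ, aeval z f = 0 ↔ ∃ i, z = θ i := by
    intro z
    have h1 : aeval z f = c * ∏ i, (z - θ i) := by
      rw [← eval_map_algebraMap, show algebraMap ℤ ℂ = Int.castRingHom ℂ from rfl, hf, eval_mul, eval_prod]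
      simp
    have hcC : (c : ℂ) ≠ 0 := by exact_mod_cast hc
    rw [h1]
    simp [hcC, Finset.prod_eq_zero_iff, sub_eq_zero]
  have hX : ∀ (k : Fin 2) (i : Fin n), pairEval θ ω (MvPolynomial.X k) = θ i →
      ∃ i', φ (MvPolynomial.X k) = θ i' := by
    intro k i hk
    rw [← hroot]
    have h1 : aeval (MvPolynomial.X k : MvPolynomial (Fin 2) ℚ) f ∈ pairIdeal θ ω := by
      rw [mem_pairIdeal, ← AlgHom.coe_restrictScalars' ℤ, ← aeval_algHom_apply, AlgHom.coe_restrictScalars', hk]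
      exact (hroot _).mpr ⟨i, rfl⟩
    have h2 := hφ _ h1
    have h3 : φ (aeval (MvPolynomial.X k : MvPolynomial (Fin 2) ℚ) f) =
        aeval (φ (MvPolynomial.X k)) f := by
      have := aeval_algHom_apply (φ.toIntAlgHom) (MvPolynomial.X k : MvPolynomial (Fin 2) ℚ) f
      exact this.symm
    rwa [h3] at h2
  obtain ⟨i, hi⟩ := hX 0 _ (pairEval_X_zero θ ω)
  obtain ⟨j, hj⟩ := hX 1 _ (pairEval_X_one θ ω)
  refine ⟨(i, j), MvPolynomial.ringHom_ext (fun r => ?_) fun k => ?_⟩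
  · have := RingHom.ext_iff.mp (Subsingleton.elim (φ.comp MvPolynomial.C)
      (((pairEval θ (i, j) : MvPolynomial (Fin 2) ℚ →+* ℂ)).comp MvPolynomial.C)) r
    exact this
  · fin_cases k
    · exact hi.trans (pairEval_X_zero θ (i, j)).symm
    · exact hj.trans (pairEval_X_one θ (i, j)).symm

/-- The field attached to an orbit of pairs. -/
abbrev OrbitField (θ : Fin n → ℂ) (I : Set.range (pairIdeal θ)) : Type :=
  MvPolynomial (Fin 2) ℚ ⧸ (I : Ideal (MvPolynomial (Fin 2) ℚ))

/-- The orbit of a pair. -/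
noncomputable def pairOrbit (θ : Fin n → ℂ) (ω : Fin n × Fin n) : Set.range (pairIdeal θ) := ⟨_, ω, rfl⟩

/-- The embedding of the field of the orbit of a pair which is given by the pair. -/
noncomputable def pairEmbedding (θ : Fin n → ℂ) (ω : Fin n × Fin n) : OrbitField θ (pairOrbit θ ω) →+* ℂ :=
  Ideal.Quotient.lift _ (pairEval θ ω : MvPolynomial (Fin 2) ℚ →+* ℂ) fun _ hx => hx

/-- Pairs correspond to embeddings of orbit fields. -/
theorem bijective_pairEmbedding {f : ℤ[X]} {c : ℤ} (hc : c ≠ 0)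
    (hf : f.map (Int.castRingHom ℂ) = C (c : ℂ) * ∏ i, (X - C (θ i))) (hθ : ∀ i, IsIntegral ℚ (θ i))
    (hinj : Function.Injective θ) :
    Function.Bijective fun ω : Fin n × Fin n =>
      (⟨pairOrbit θ ω, pairEmbedding θ ω⟩ : Σ I, (OrbitField θ I →+* ℂ)) := by
  let Φ : (Σ I, (OrbitField θ I →+* ℂ)) → (MvPolynomial (Fin 2) ℚ →+* ℂ) :=
    fun x => x.2.comp (Ideal.Quotient.mk _)
  have hker : ∀ x : Σ I, (OrbitField θ I →+* ℂ), RingHom.ker (Φ x) = x.1 := by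
    rintro ⟨⟨_, ω, rfl⟩, ψ⟩
    have := isMaximal_pairIdeal hθ ω
    let := Ideal.Quotient.field (pairIdeal θ ω)
    have hψ : Function.Injective ψ := ψ.injective
    ext x
    rw [RingHom.mem_ker]
    change ψ (Ideal.Quotient.mk _ x) = 0 ↔ x ∈ pairIdeal θ ω
    rw [map_eq_zero_iff ψ hψ, Ideal.Quotient.eq_zero_iff_mem]
  have hΦ : Function.Injective Φ := by
    intro x y h
    have h1 : x.1 = y.1 := Subtype.ext (by rw [← hker, ← hker, h])
    obtain ⟨I, ψ⟩ := x
    obtain ⟨J, χ⟩ := y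
    obtain rfl : I = J := h1
    obtain rfl : ψ = χ := Ideal.Quotient.ringHom_ext h
    rfl
  have hΦe : ∀ ω, Φ ⟨pairOrbit θ ω, pairEmbedding θ ω⟩ = (pairEval θ ω : MvPolynomial (Fin 2) ℚ →+* ℂ) :=
    fun ω => RingHom.ext fun x => rfl
  constructor
  · intro ω ω' h
    refine pairEval_injective hinj (AlgHom.coe_ringHom_injective ?_)
    rw [← hΦe, ← hΦe]
    exact congrArg Φ h
  · intro x
    have h1 : ∃ ω, ∀ y ∈ pairIdeal θ ω, Φ x y = 0 := by
      obtain ⟨ω, hω⟩ := x.1.2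
      refine ⟨ω, fun y hy => ?_⟩
      rw [hω, ← hker] at hy
      exact hy
    obtain ⟨ω, hω⟩ := h1
    obtain ⟨ω', hω'⟩ := exists_pairEval_eq hc hf (Φ x) hω
    exact ⟨ω', hΦ ((hΦe ω').trans hω'.symm)⟩

end

section

open Polynomial NumberField

variable {n : ℕ} {θ : Fin n → ℂ}

/-- The field structure of an orbit field. -/
noncomputable abbrev orbitFieldField (hθ : ∀ i, IsIntegral ℚ (θ i)) (I : Set.range (pairIdeal θ)) :
    Field (OrbitField θ I) :=
  have : (I : Ideal (MvPolynomial (Fin 2) ℚ)).IsMaximal := by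
    obtain ⟨_, ω, rfl⟩ := I
    exact isMaximal_pairIdeal hθ ω
  Ideal.Quotient.field _

theorem orbitField_numberField (hθ : ∀ i, IsIntegral ℚ (θ i)) (I : Set.range (pairIdeal θ)) :
    letI := orbitFieldField hθ I
    NumberField (OrbitField θ I) := by
  let := orbitFieldField hθ I
  have h : Module.Finite ℚ (OrbitField θ I) := by
    obtain ⟨_, ω, rfl⟩ := I
    exact finite_quotient_pairIdeal hθ ω
  have h0 : CharZero (OrbitField θ I) := algebraRat.charZero _
  refine { to_charZero := h0, to_finiteDimensional := ?_ }
  have h2 : (Ideal.Quotient.algebra ℚ : Algebra ℚ (OrbitField θ I)) = DivisionRing.toRatAlgebra :=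
    Rat.algebra_rat_subsingleton.elim _ _
  rw [← h2]
  exact h

theorem prod_abs_discr_orbitField_le {f : ℤ[X]} {c D : ℤ} (hc : c ≠ 0) (hD : D ≠ 0)
    (hf : f.map (Int.castRingHom ℂ) = C (c : ℂ) * ∏ i, (X - C (θ i))) (hθ : ∀ i, IsIntegral ℚ (θ i))
    (hinj : Function.Injective θ) (hdisc : (c : ℂ) ^ (2 * n - 2) * (Matrix.vandermonde θ).det ^ 2 = D)
    [Fintype (Set.range (pairIdeal θ))] :
    letI := orbitFieldField hθ
    haveI := orbitField_numberField hθ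
    ∏ I, ((|discr (OrbitField θ I)| : ℤ) : ℝ) ≤ (|D| : ℝ) ^ (2 * n) := by
  classical
  let := orbitFieldField hθ
  have := orbitField_numberField hθ
  let e := Equiv.ofBijective _ (bijective_pairEmbedding hc hf hθ hinj)
  have he : ∀ ω x, (e ω).2 (Ideal.Quotient.mk _ x) = pairEval θ ω x := fun ω x => rfl
  let G : Fin n × Fin n → MvPolynomial (Fin 2) ℚ := fun a =>
    aeval (MvPolynomial.X 0) (hornerPoly f n a.1) * aeval (MvPolynomial.X 1) (hornerPoly f n a.2)
  have hG : ∀ a ω, pairEval θ ω (G a) =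
      aeval (θ ω.1) (hornerPoly f n a.1) * aeval (θ ω.2) (hornerPoly f n a.2) := by
    intro a ω
    have h1 : ∀ (k : Fin 2) (p : ℤ[X]), pairEval θ ω (aeval (MvPolynomial.X k) p) =
        aeval (pairEval θ ω (MvPolynomial.X k)) p := by
      intro k p
      exact (aeval_algHom_apply ((pairEval θ ω).restrictScalars ℤ)
        (MvPolynomial.X k : MvPolynomial (Fin 2) ℚ) p).symm
    rw [map_mul, h1, h1, pairEval_X_zero, pairEval_X_one]
  have hintegral : ∀ a I, IsIntegral ℤ (Ideal.Quotient.mk _ (G a) : OrbitField θ I) := by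
    rintro a ⟨_, ω, rfl⟩
    have h1 : Function.Injective (e ω).2.toIntAlgHom := (e ω).2.injective
    refine (isIntegral_algHom_iff _ h1).mp ?_
    change IsIntegral ℤ (pairEval θ ω (G a))
    rw [hG]
    exact (isIntegral_aeval_hornerPoly hc hf a.1.2 _).mul (isIntegral_aeval_hornerPoly hc hf a.2.2 _)
  let g : Fin n × Fin n → ∀ I, 𝓞 (OrbitField θ I) := fun a I => ⟨Ideal.Quotient.mk _ (G a), hintegral a I⟩
  let Z : Matrix (Fin n) (Fin n) ℂ := Matrix.of fun a i => aeval (θ i) (hornerPoly f n a)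
  have hM : (Matrix.of fun a b : Fin n × Fin n => (e b).2 (g a (e b).1 : OrbitField θ (e b).1)) =
      Matrix.kroneckerMap (fun x y => x * y) Z Z := by
    ext a ω
    exact (he ω (G a)).trans (hG a ω)
  have hZ : Z.det ^ 2 = D := (det_hornerPoly_sq hf).trans hdisc
  have hZ0 : Z.det ≠ 0 := by
    intro h
    rw [h] at hZ
    have : (D : ℂ) = 0 := by rw [← hZ]; ring
    exact hD (by exact_mod_cast this)
  have hdet : (Matrix.of fun a b : Fin n × Fin n => (e b).2 (g a (e b).1 : OrbitField θ (e b).1)).det =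
      (Z.det ^ 2) ^ n := by
    rw [hM, Matrix.det_kronecker, Fintype.card_fin]
    ring
  refine (NumberField.prod_abs_discr_le (fun I => OrbitField θ I) e g ?_).trans_eq ?_
  · rw [hdet]
    exact pow_ne_zero _ (pow_ne_zero _ hZ0)
  · rw [hdet, hZ, norm_pow, Complex.norm_intCast, ← pow_mul, mul_comm]

end

section

open Polynomial NumberField Module

variable {n : ℕ} {θ : Fin n → ℂ}

open Classical in
/-- The mean of a function over the orbit of a pair. -/
noncomputable def orbitMean (θ : Fin n → ℂ) (t : Fin n × Fin n → ℝ) (ω : Fin n × Fin n) : ℝ :=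
  (∑ ω' with pairIdeal θ ω' = pairIdeal θ ω, t ω') / {ω' | pairIdeal θ ω' = pairIdeal θ ω}.ncard

theorem orbitMean_congr (t : Fin n × Fin n → ℝ) {ω ω' : Fin n × Fin n}
    (h : pairIdeal θ ω = pairIdeal θ ω') : orbitMean θ t ω = orbitMean θ t ω' := by
  rw [orbitMean, orbitMean, h]

open Classical in
theorem sum_sub_orbitMean (t : Fin n × Fin n → ℝ) (ω : Fin n × Fin n) :
    ∑ ω' with pairIdeal θ ω' = pairIdeal θ ω, (t ω' - orbitMean θ t ω') = 0 := by
  rw [Finset.sum_sub_distrib, Finset.sum_congr rfl (g := fun _ => orbitMean θ t ω) fun ω' hω' =>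
    orbitMean_congr t (Finset.mem_filter.mp hω').2, Finset.sum_const, orbitMean, nsmul_eq_mul,
    Set.ncard_eq_toFinset_card', Set.toFinset_ofPred, mul_div_cancel₀, sub_self]
  rw [Nat.cast_ne_zero, Finset.card_ne_zero]
  exact ⟨ω, by simp⟩

theorem pairIdeal_eq_of_conj {ω ω' : Fin n × Fin n} (h1 : θ ω'.1 = starRingEnd ℂ (θ ω.1))
    (h2 : θ ω'.2 = starRingEnd ℂ (θ ω.2)) : pairIdeal θ ω' = pairIdeal θ ω := by
  have h : (pairEval θ ω' : MvPolynomial (Fin 2) ℚ →+* ℂ) =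
      (starRingEnd ℂ).comp (pairEval θ ω : MvPolynomial (Fin 2) ℚ →+* ℂ) := by
    refine MvPolynomial.ringHom_ext (fun r => ?_) fun k => ?_
    · simp
    · fin_cases k
      · simpa using h1
      · simpa using h2
  ext x
  rw [mem_pairIdeal, mem_pairIdeal]
  have h3 : pairEval θ ω' x = starRingEnd ℂ (pairEval θ ω x) := RingHom.ext_iff.mp h x
  rw [h3, map_eq_zero]

theorem NumberField.exists_units_log_close_of_prod_discr_le {ι : Type*} [Fintype ι] (L : ι → Type*)
    [∀ i, Field (L i)] [∀ i, NumberField (L i)] (s : ∀ i, (L i →+* ℂ) → ℝ)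
    (hs : ∀ i φ, s i (ComplexEmbedding.conjugate φ) = s i φ) (h0 : ∀ i, ∑ φ, s i φ = 0)
    {κ : Type*} [Fintype κ] (R : κ → Σ i, (L i →+* ℂ)) {δ : ℝ} (hδ : 0 < δ) {N : ℕ}
    (hN : Fintype.card (Σ i, (L i →+* ℂ)) = N) {B : ℝ} (hB : ∏ i, ((|discr (L i)| : ℤ) : ℝ) ≤ B) (P : ℕ)
    (hP : 8 ^ N * B * ((1 + Real.log B / 2) / δ + 1) ^ N * (7 / δ + 1) ^ Fintype.card κ ≤ P) :
    ∃ p : ℕ, 0 < p ∧ p ≤ P ∧ ∃ u : ∀ i, (𝓞 (L i))ˣ,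
      (∀ i φ, |Real.log ‖φ (u i : 𝓞 (L i))‖ - p * s i φ| ≤ δ) ∧
      ∀ k, ∃ z : ℂ, Complex.exp z = (R k).2 (u (R k).1) ∧ |z.im| ≤ δ := by
  have hdisc1 : ∀ i, (1 : ℝ) ≤ ((|discr (L i)| : ℤ) : ℝ) := fun i => by
    exact_mod_cast Int.one_le_abs (discr_ne_zero (L i))
  have hB1 : 1 ≤ B := le_trans (Finset.one_le_prod fun i _ => hdisc1 i) hB
  have hdiscI : ∀ i, ((|discr (L i)| : ℤ) : ℝ) ≤ B := by
    classical
    intro i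
    refine le_trans ?_ hB
    rw [← Finset.mul_prod_erase Finset.univ _ (Finset.mem_univ i)]
    exact le_mul_of_one_le_right (by linarith [hdisc1 i]) (Finset.one_le_prod fun j _ => hdisc1 j)
  have hW : ∀ i, Real.log (2 * √(|discr (L i)| : ℤ)) ≤ 1 + Real.log B / 2 := by
    intro i
    have h0 := hdisc1 i
    rw [Real.log_mul two_ne_zero (Real.sqrt_pos.mpr (by linarith)).ne', Real.log_sqrt (by linarith)]
    have h1 := Real.log_le_log (by linarith) (hdiscI i)
    have := Real.log_two_lt_d9
    linarith
  have hsum : ∑ i, finrank ℚ (L i) = N := by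
    rw [← hN, Fintype.card_sigma]
    exact Finset.sum_congr rfl fun i _ => (Embeddings.card (L i) ℂ).symm
  have hι : Fintype.card ι ≤ N := by
    rw [← hsum, Fintype.card, Finset.card_eq_sum_ones]
    exact Finset.sum_le_sum fun i _ => finrank_pos
  refine exists_units_log_close L s hs h0 R hδ hW P (le_trans ?_ hP)
  have hlog : 0 ≤ Real.log B := Real.log_nonneg hB1
  rw [hN]
  gcongr
  rw [Finset.prod_mul_distrib, Finset.prod_mul_distrib, Finset.prod_pow_eq_pow_sum, hsum, ← mul_assoc,
    Finset.prod_const, Finset.card_univ]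
  have hprod0 : 0 ≤ ∏ i, ((|discr (L i)| : ℤ) : ℝ) := Finset.prod_nonneg fun i _ => by linarith [hdisc1 i]
  gcongr
  calc (2 : ℝ) ^ N * 4 ^ Fintype.card ι ≤ 2 ^ N * 4 ^ N := by
        gcongr
        norm_num
    _ = 8 ^ N := by rw [← mul_pow]; norm_num

theorem exists_pair_units {f : ℤ[X]} {c D : ℤ} (hc : c ≠ 0) (hD : D ≠ 0)
    (hf : f.map (Int.castRingHom ℂ) = C (c : ℂ) * ∏ i, (X - C (θ i))) (hθ : ∀ i, IsIntegral ℚ (θ i))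
    (hinj : Function.Injective θ) (hdisc : (c : ℂ) ^ (2 * n - 2) * (Matrix.vandermonde θ).det ^ 2 = D)
    (t : Fin n × Fin n → ℝ)
    (ht : ∀ ω ω' : Fin n × Fin n, θ ω'.1 = starRingEnd ℂ (θ ω.1) → θ ω'.2 = starRingEnd ℂ (θ ω.2) →
      t ω' = t ω)
    {k : ℕ} (R : Fin k → Fin n × Fin n) {δ : ℝ} (hδ : 0 < δ) (P : ℕ)
    (hP : 8 ^ n ^ 2 * (|D| : ℝ) ^ (2 * n) * ((1 + n * Real.log |D|) / δ + 1) ^ n ^ 2 * (7 / δ + 1) ^ k ≤ P) :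
    ∃ p : ℕ, 0 < p ∧ p ≤ P ∧ ∃ Y : Fin n × Fin n → MvPolynomial (Fin 2) ℚ,
      (∀ ω ω', pairIdeal θ ω = pairIdeal θ ω' → Y ω = Y ω') ∧
      (∀ ω, IsIntegral ℤ (pairEval θ ω (Y ω)) ∧ IsIntegral ℤ (pairEval θ ω (Y ω))⁻¹ ∧
        pairEval θ ω (Y ω) ≠ 0) ∧
      (∀ ω, |Real.log ‖pairEval θ ω (Y ω)‖ - p * (t ω - orbitMean θ t ω)| ≤ δ) ∧
      ∀ j, ∃ z : ℂ, Complex.exp z = pairEval θ (R j) (Y (R j)) ∧ |z.im| ≤ δ := by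
  classical
  let := orbitFieldField hθ
  have := orbitField_numberField hθ
  let : Fintype (Set.range (pairIdeal θ)) := Fintype.ofFinite _
  let e := Equiv.ofBijective _ (bijective_pairEmbedding hc hf hθ hinj)
  have he : ∀ ω x, (e ω).2 (Ideal.Quotient.mk _ x) = pairEval θ ω x := fun ω x => rfl
  have he1 : ∀ ω, ((e ω).1 : Ideal _) = pairIdeal θ ω := fun ω => rfl
  have he2 : ∀ ω, e ω = ⟨pairOrbit θ ω, pairEmbedding θ ω⟩ := fun ω => rfl
  have hcard : Fintype.card (Σ I, (OrbitField θ I →+* ℂ)) = n ^ 2 := by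
    rw [← Fintype.card_congr e, Fintype.card_prod, Fintype.card_fin, sq]
  let s : ∀ I, (OrbitField θ I →+* ℂ) → ℝ := fun I φ =>
    t (e.symm ⟨I, φ⟩) - orbitMean θ t (e.symm ⟨I, φ⟩)
  have hse : ∀ ω, s (e ω).1 (e ω).2 = t ω - orbitMean θ t ω := by
    intro ω
    change t (e.symm (e ω)) - orbitMean θ t (e.symm (e ω)) = _
    rw [e.symm_apply_apply]
  have hsconj : ∀ I φ, s I (ComplexEmbedding.conjugate φ) = s I φ := by
    intro I φ
    obtain ⟨ω, hω⟩ : ∃ ω, e ω = ⟨I, φ⟩ := e.surjective _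
    obtain ⟨ω', hω'⟩ : ∃ ω', e ω' = ⟨I, ComplexEmbedding.conjugate φ⟩ := e.surjective _
    have h1 : ∀ x, pairEval θ ω' x = starRingEnd ℂ (pairEval θ ω x) := by
      intro x
      rw [← he, ← he, hω, hω']
      rfl
    have h2 := h1 (MvPolynomial.X 0)
    have h3 := h1 (MvPolynomial.X 1)
    rw [pairEval_X_zero, pairEval_X_zero] at h2
    rw [pairEval_X_one, pairEval_X_one] at h3
    change t (e.symm _) - orbitMean θ t (e.symm _) = t (e.symm _) - orbitMean θ t (e.symm _)
    rw [← hω, ← hω', e.symm_apply_apply, e.symm_apply_apply, ht ω ω' h2 h3,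
      orbitMean_congr t (pairIdeal_eq_of_conj h2 h3)]
  have hs0 : ∀ I, ∑ φ, s I φ = 0 := by
    intro I
    obtain ⟨ω₀, hω₀⟩ := I.2
    rw [← sum_sub_orbitMean (θ := θ) t ω₀]
    refine Finset.sum_bij' (fun φ _ => e.symm ⟨I, φ⟩)
      (fun ω hω => cast (by rw [show (e ω).1 = I from Subtype.ext
        ((Finset.mem_filter.mp hω).2.trans hω₀)]) (e ω).2) ?_ ?_ ?_ ?_ ?_
    · intro φ _
      rw [Finset.mem_filter]
      refine ⟨Finset.mem_univ _, ?_⟩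
      rw [← he1, e.apply_symm_apply, hω₀]
    · intro ω _
      exact Finset.mem_univ _
    · intro φ _
      refine eq_of_heq ((cast_heq _ _).trans ?_)
      rw [e.apply_symm_apply]
    · intro ω hω
      rw [e.symm_apply_eq]
      refine Sigma.ext (Subtype.ext ((Finset.mem_filter.mp hω).2.trans hω₀)).symm ?_
      exact cast_heq _ _
    · intro φ _
      rfl
  have hprod := prod_abs_discr_orbitField_le hc hD hf hθ hinj hdisc
  obtain ⟨p, hp, hpP, u, hu1, hu2⟩ := exists_units_log_close_of_prod_discr_le (fun I => OrbitField θ I) s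
    hsconj hs0 (fun j => e (R j)) hδ hcard hprod P (by
      rw [Real.log_pow, Fintype.card_fin]
      push_cast at hP ⊢
      convert hP using 6
      ring)
  choose Y' hY' using fun I => Ideal.Quotient.mk_surjective (u I : OrbitField θ I)
  have hYe : ∀ ω, pairEval θ ω (Y' (pairOrbit θ ω)) = (e ω).2 (u (e ω).1 : OrbitField θ (e ω).1) := by
    intro ω
    rw [← he]
    exact congrArg (e ω).2 (hY' (e ω).1)
  refine ⟨p, hp, hpP, fun ω => Y' (pairOrbit θ ω), ?_, ?_, ?_, ?_⟩
  · intro ω ω' h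
    exact congrArg Y' (Subtype.ext h)
  · intro ω
    rw [hYe]
    have h1 : ∀ v : 𝓞 (OrbitField θ (e ω).1), IsIntegral ℤ ((e ω).2 (v : OrbitField θ (e ω).1)) := fun v =>
      map_isIntegral_int (e ω).2 v.2
    have h2 : (e ω).2 (((u (e ω).1)⁻¹ : (𝓞 (OrbitField θ (e ω).1))ˣ) : OrbitField θ (e ω).1) =
        ((e ω).2 (u (e ω).1 : OrbitField θ (e ω).1))⁻¹ := by
      rw [← map_inv₀]
      congr 1
      refine eq_inv_of_mul_eq_one_left ?_
      exact_mod_cast congrArg (algebraMap (𝓞 (OrbitField θ (e ω).1)) (OrbitField θ (e ω).1))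
        (u (e ω).1).inv_mul
    refine ⟨h1 _, ?_, ?_⟩
    · rw [← h2]
      exact h1 _
    · rw [_root_.map_ne_zero]
      exact fun h => (u (e ω).1).ne_zero (RingOfIntegers.ext h)
  · intro ω
    rw [hYe, ← hse]
    exact hu1 (e ω).1 (e ω).2
  · intro j
    obtain ⟨z, hz, hz'⟩ := hu2 j
    exact ⟨z, hz.trans (hYe _).symm, hz'⟩

end

section

open NumberField Module

variable {F : Type*} [Field F] [NumberField F]

theorem NumberField.sum_log_norm_nonneg {y : F} (hy : IsIntegral ℤ y) (hy0 : y ≠ 0) :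
    0 ≤ ∑ ψ : F →+* ℂ, Real.log ‖ψ y‖ := by
  rw [← Real.log_prod fun ψ _ => norm_ne_zero_iff.mpr ((map_ne_zero ψ).mpr hy0)]
  exact Real.log_nonneg (one_le_prod_norm_of_isIntegral hy hy0)

theorem NumberField.abs_sum_log_norm_le {D : ℕ} (hD : 0 < D) {ξ : F} (hξ0 : ξ ≠ 0)
    (hξ : IsIntegral ℤ ((D : F) * ξ)) (hξ' : IsIntegral ℤ ((D : F) * ξ⁻¹)) :
    |∑ ψ : F →+* ℂ, Real.log ‖ψ ξ‖| ≤ Fintype.card (F →+* ℂ) * Real.log D := by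
  have hDF : (D : F) ≠ 0 := by exact_mod_cast hD.ne'
  have key : ∀ y : F, y ≠ 0 → IsIntegral ℤ ((D : F) * y) →
      0 ≤ Fintype.card (F →+* ℂ) * Real.log D + ∑ ψ : F →+* ℂ, Real.log ‖ψ y‖ := by
    intro y hy0 hy
    have h1 := sum_log_norm_nonneg hy (mul_ne_zero hDF hy0)
    refine h1.trans_eq ?_
    have h2 : ∀ ψ : F →+* ℂ, Real.log ‖ψ ((D : F) * y)‖ = Real.log D + Real.log ‖ψ y‖ := by
      intro ψ
      rw [map_mul, map_natCast, norm_mul, Complex.norm_natCast, Real.log_mul]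
      · exact_mod_cast hD.ne'
      · exact norm_ne_zero_iff.mpr ((map_ne_zero ψ).mpr hy0)
    simp only [h2, Finset.sum_add_distrib, Finset.sum_const, Finset.card_univ, nsmul_eq_mul]
  have h1 := key ξ hξ0 hξ
  have h2 := key ξ⁻¹ (inv_ne_zero hξ0) hξ'
  simp only [map_inv₀, norm_inv, Real.log_inv, Finset.sum_neg_distrib] at h2
  rw [abs_le]
  constructor <;> linarith

set_option maxHeartbeats 2000000 in
/-- A number `ξ` close to `1` and a unit `η` whose logarithmic embedding is nearly proportional to that of
`ξ` up to translation cannot coexist, if the constant of proportionality is large. -/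
theorem NumberField.false_of_unit_close (φ : F →+* ℂ) {ξ η : F} (hξ0 : ξ ≠ 0) {D d L p : ℕ} (hD : 0 < D)
    (hξ : IsIntegral ℤ ((D : F) * ξ)) (hξ' : IsIntegral ℤ ((D : F) * ξ⁻¹)) (hη : IsIntegral ℤ η)
    (hη' : IsIntegral ℤ η⁻¹) (hη0 : η ≠ 0) {T δ μ P : ℝ} (hδ : 0 < δ) (hp : 0 < p) (hpP : p ≤ P)
    (hDP : 1 + Real.log D ≤ P) (hT : 10 * P ^ 2 / δ ≤ T) (hd : finrank ℚ F ≤ d) (hL0 : 0 < L)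
    (hL : 12 * d * Real.log (1 / (40 * δ)) ≤ L) (hν : 1248 * (d ^ 2 * L ^ 2) * (40 * δ) ≤ 1)
    (hclose : ∀ ψ : F →+* ℂ, |Real.log ‖ψ η‖ - p / T * (Real.log ‖ψ ξ‖ - μ)| ≤ 4 * δ)
    (hξT : ∀ ψ : F →+* ℂ, |Real.log ‖ψ ξ‖| ≤ T) (hφξ : ‖1 - φ ξ‖ = Real.exp (-T))
    {ω : ℂ} (hω : Complex.exp ω = φ η) (hωim : |ω.im| ≤ 4 * δ) : False := by
  obtain ⟨x, hx⟩ : ∃ x, x = Real.log D := ⟨_, rfl⟩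
  have hx0 : 0 ≤ x := by
    rw [hx]
    exact Real.log_nonneg (by exact_mod_cast hD)
  rw [← hx] at hDP
  have hP1 : 1 ≤ P := by linarith
  have hd1 : 1 ≤ d := le_trans finrank_pos hd
  have hd1R : (1 : ℝ) ≤ d := by exact_mod_cast hd1
  have hL1R : (1 : ℝ) ≤ L := by exact_mod_cast hL0
  have hp1R : (1 : ℝ) ≤ p := by exact_mod_cast hp
  have hdL : (d : ℝ) ≤ d ^ 2 * L ^ 2 := by
    calc (d : ℝ) = d * 1 * 1 := by ring
      _ ≤ d * d * L ^ 2 := by gcongr; exact one_le_pow₀ hL1R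
      _ = _ := by ring
  have hdδ : 1248 * 40 * (d * δ) ≤ 1 := by
    refine le_trans ?_ hν
    calc 1248 * 40 * (d * δ) = 1248 * d * (40 * δ) := by ring
      _ ≤ _ := by gcongr
  have hδ1 : 1248 * 40 * δ ≤ 1 := by
    refine le_trans ?_ hdδ
    have := mul_le_mul_of_nonneg_right hd1R hδ.le
    linarith
  have hTδ : 10 * P ^ 2 ≤ T * δ := by rwa [div_le_iff₀ hδ] at hT
  have hPP : P ≤ P ^ 2 := by nlinarith
  have hT1 : 10 * 1248 * 40 * P ^ 2 ≤ T := by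
    have hT0 : 0 ≤ T := by
      refine le_trans ?_ hT
      positivity
    have := mul_le_mul_of_nonneg_left hδ1 hT0
    nlinarith
  have hTpos : 0 < T := by nlinarith
  have hpTpos : 0 < p / T := by positivity
  have hpT : p / T * P ≤ δ / 10 := by
    rw [div_mul_eq_mul_div, div_le_iff₀ hTpos]
    have : p * P ≤ P * P := by gcongr
    nlinarith
  have hpTx : p / T * (1 + x) ≤ δ / 10 := le_trans (by gcongr) hpT
  -- the translation is small
  have hμ : |p / T * μ| ≤ p / T * x + 4 * δ := by
    have hm : (0 : ℝ) < Fintype.card (F →+* ℂ) := by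
      exact_mod_cast Fintype.card_pos_iff.mpr ⟨φ⟩
    have h1 := sum_log_norm_nonneg hη hη0
    have h2 := sum_log_norm_nonneg hη' (inv_ne_zero hη0)
    simp only [map_inv₀, norm_inv, Real.log_inv, Finset.sum_neg_distrib] at h2
    have h3 := abs_sum_log_norm_le hD hξ0 hξ hξ'
    rw [← hx] at h3
    have h4 : |∑ ψ : F →+* ℂ, (Real.log ‖ψ η‖ - p / T * (Real.log ‖ψ ξ‖ - μ))| ≤
        Fintype.card (F →+* ℂ) * (4 * δ) := by
      refine (Finset.abs_sum_le_sum_abs _ _).trans ?_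
      refine (Finset.sum_le_card_nsmul _ _ _ fun ψ _ => hclose ψ).trans_eq ?_
      rw [Finset.card_univ, nsmul_eq_mul]
    rw [Finset.sum_sub_distrib, ← Finset.mul_sum, Finset.sum_sub_distrib, Finset.sum_const,
      Finset.card_univ, nsmul_eq_mul] at h4
    obtain ⟨m, hm'⟩ : ∃ m : ℝ, m = Fintype.card (F →+* ℂ) := ⟨_, rfl⟩
    obtain ⟨S, hS⟩ : ∃ S, S = ∑ ψ : F →+* ℂ, Real.log ‖ψ ξ‖ := ⟨_, rfl⟩
    rw [← hm', ← hS] at h4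
    rw [← hm', ← hS] at h3
    rw [← hm'] at hm
    have h5 : |p / T * S| ≤ p / T * (m * x) := by
      rw [abs_mul, abs_of_pos hpTpos]
      gcongr
    rw [abs_le] at h4 h5
    have h6 : |m * (p / T * μ)| ≤ m * (p / T * x + 4 * δ) := by
      rw [abs_le]
      constructor <;> nlinarith
    rw [abs_mul, abs_of_pos hm] at h6
    exact le_of_mul_le_mul_left h6 hm
  have hηψ : ∀ ψ : F →+* ℂ, |Real.log ‖ψ η‖ - p / T * Real.log ‖ψ ξ‖| ≤ p / T * x + 8 * δ := by
    intro ψ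
    have h1 := hclose ψ
    rw [mul_sub] at h1
    rw [abs_le] at h1 hμ ⊢
    constructor <;> linarith
  have hφξ2 : ‖1 - φ ξ‖ ≤ 1 / 2 := by
    rw [hφξ, Real.exp_neg, one_div]
    refine inv_anti₀ two_pos ?_
    have := Real.add_one_le_exp T
    nlinarith
  have hφξl : 1 / 2 ≤ ‖φ ξ‖ := by
    have := norm_sub_norm_le (1 : ℂ) (1 - φ ξ)
    rw [norm_one, sub_sub_cancel] at this
    linarith
  have hφξu : ‖φ ξ‖ ≤ 3 / 2 := by
    have := norm_sub_le (1 : ℂ) (1 - φ ξ)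
    rw [norm_one, sub_sub_cancel] at this
    linarith
  have hlogφξ : |Real.log ‖φ ξ‖| ≤ 1 := by
    rw [abs_le]
    have h1 := Real.log_le_sub_one_of_pos (x := ‖φ ξ‖) (by linarith)
    have h2 := Real.one_sub_inv_le_log_of_pos (x := ‖φ ξ‖) (by linarith)
    have h3 : ‖φ ξ‖⁻¹ ≤ 2 := by
      rw [inv_le_comm₀ (by linarith) two_pos]
      linarith
    constructor <;> linarith
  have hων : ‖ω‖ ≤ 40 * δ / 3 := by
    have h1 : ω.re = Real.log ‖φ η‖ := by rw [← hω, Complex.norm_exp, Real.log_exp]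
    have h2 : |ω.re| ≤ 8 * δ + δ / 10 := by
      rw [h1]
      have h3 := hηψ φ
      have h4 : |p / T * Real.log ‖φ ξ‖| ≤ p / T * 1 := by
        rw [abs_mul, abs_of_pos hpTpos]
        gcongr
      rw [abs_le] at h3 h4 ⊢
      constructor <;> linarith
    have h3 := Complex.norm_le_abs_re_add_abs_im ω
    linarith
  obtain ⟨N, hN⟩ : ∃ N, N = ⌊T / p⌋₊ := ⟨_, rfl⟩
  have hNT : p * N ≤ T := by
    have h1 : (N : ℝ) ≤ T / p := by
      rw [hN]
      exact Nat.floor_le (by positivity)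
    rw [le_div_iff₀ (by positivity)] at h1
    linarith
  have hNT' : T < p * N + p := by
    have h1 : T / p < N + 1 := by
      rw [hN]
      exact Nat.lt_floor_add_one _
    rw [div_lt_iff₀ (by positivity)] at h1
    linarith
  have hNδ : 9 * P ≤ N * δ := by
    have h1 : P * (9 * P) ≤ P * (N * δ) := by
      have h2 : T * δ ≤ (p * N + p) * δ := by gcongr
      have h3 : p * (N * δ) ≤ P * (N * δ) := by gcongr
      have h4 : p * δ ≤ P * 1 := by
        gcongr
        linarith
      nlinarith
    exact le_of_mul_le_mul_left h1 (by linarith)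
  have hNp : ∀ y : ℝ, |y| ≤ T → |N * (p / T * y) - y| ≤ p := by
    intro y hy
    have h1 : N * (p / T * y) - y = -((1 - p * N / T) * y) := by ring
    have h2 : 0 ≤ 1 - p * N / T := by
      rw [sub_nonneg, div_le_one hTpos]
      exact hNT
    rw [h1, abs_neg, abs_mul, abs_of_nonneg h2]
    calc (1 - p * N / T) * |y| ≤ (1 - p * N / T) * T := by gcongr
      _ = T - p * N := by field_simp
      _ ≤ p := by linarith
  have hα : ∀ ψ : F →+* ℂ, Real.log ‖ψ (η ^ N / ξ)‖ ≤ p + x + 8 * δ * N := by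
    intro ψ
    have hψξ : ‖ψ ξ‖ ≠ 0 := norm_ne_zero_iff.mpr ((map_ne_zero ψ).mpr hξ0)
    have hψη : ‖ψ η‖ ≠ 0 := norm_ne_zero_iff.mpr ((map_ne_zero ψ).mpr hη0)
    rw [map_div₀, map_pow, norm_div, norm_pow, Real.log_div (pow_ne_zero _ hψη) hψξ, Real.log_pow]
    have h1 := hNp _ (hξT ψ)
    have h2 : N * (Real.log ‖ψ η‖ - p / T * Real.log ‖ψ ξ‖) ≤ N * (p / T * x + 8 * δ) := by
      have := (abs_le.mp (hηψ ψ)).2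
      gcongr
    have h3 : N * (p / T * x) ≤ x := by
      calc N * (p / T * x) = (p * N) / T * x := by ring
        _ ≤ 1 * x := by
            gcongr
            exact (div_le_one hTpos).mpr hNT
        _ = x := one_mul x
    rw [abs_le] at h1
    nlinarith
  have hαN : ∀ ψ : F →+* ℂ, ‖ψ (η ^ N / ξ)‖ ≤ Real.exp (40 * δ * N) := by
    intro ψ
    have hα0 : ψ (η ^ N / ξ) ≠ 0 := (map_ne_zero ψ).mpr (div_ne_zero (pow_ne_zero _ hη0) hξ0)
    rw [← Real.log_le_iff_le_exp (norm_pos_iff.mpr hα0)]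
    refine (hα ψ).trans ?_
    linarith
  obtain ⟨m, hm, hηm⟩ := exists_pow_eq_one_of_close φ (η := η) (α := η ^ N / ξ) hη0
    (div_ne_zero (pow_ne_zero _ hη0) hξ0) hη hD
    (by
      have := (hη.pow N).mul hξ'
      refine (congrArg (IsIntegral ℤ) ?_).mp this
      ring)
    (by positivity : 0 < 40 * δ) hd hL0 hp
    (by
      intro ψ
      have hψη : ψ η ≠ 0 := (map_ne_zero ψ).mpr hη0
      rw [← Real.log_le_iff_le_exp (norm_pos_iff.mpr hψη)]
      have h1 := hηψ ψ
      have h2 : |p / T * Real.log ‖ψ ξ‖| ≤ p / T * T := by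
        rw [abs_mul, abs_of_pos hpTpos]
        gcongr
        exact hξT ψ
      rw [div_mul_cancel₀ _ hTpos.ne'] at h2
      rw [abs_le] at h1 h2
      linarith)
    hαN
    (by
      rw [← Real.log_le_iff_le_exp (by exact_mod_cast hD), ← hx]
      linarith)
    hω hων
    (by
      have h0 : φ ξ ≠ 0 := (map_ne_zero φ).mpr hξ0
      have hη0' : φ η ≠ 0 := (map_ne_zero φ).mpr hη0
      have h1 : φ (η ^ N / ξ) / φ η ^ N - 1 = (1 - φ ξ) / φ ξ := by
        rw [map_div₀, map_pow]
        field_simp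
      rw [h1, norm_div, hφξ, div_le_iff₀ (by linarith)]
      have h2 : Real.exp (-T) ≤ Real.exp (-(p * N)) := Real.exp_le_exp.mpr (by linarith)
      have h3 := Real.exp_pos (-(p * N : ℝ))
      nlinarith)
    hL hν
    (by
      have h1 : 2496 * (d ^ 2 * L ^ 2 : ℝ) * δ ≤ N * δ := by nlinarith
      exact_mod_cast le_of_mul_le_mul_right h1 hδ)
  -- a root of unity contradicts the Liouville inequality for `1 - ξ`
  have hηψ1 : ∀ ψ : F →+* ℂ, Real.log ‖ψ η‖ = 0 := by
    intro ψ
    have h1 : ‖ψ η‖ ^ m = 1 := by rw [← norm_pow, ← map_pow, hηm, map_one, norm_one]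
    rw [(pow_eq_one_iff_of_nonneg (norm_nonneg _) hm.ne').mp h1, Real.log_one]
  have hξψ : ∀ ψ : F →+* ℂ, Real.log ‖ψ ξ‖ ≤ x + 8 * δ * T := by
    intro ψ
    have h1 := (abs_le.mp (hηψ ψ)).1
    rw [hηψ1, zero_sub] at h1
    have h2 : p / T * Real.log ‖ψ ξ‖ ≤ p / T * (x + 8 * δ * T) := by
      have h3 : p / T * (8 * δ * T) = p * (8 * δ) := by field_simp
      nlinarith
    exact le_of_mul_le_mul_left h2 hpTpos
  have h1ξ : 1 - ξ ≠ 0 := by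
    intro h
    have h1 : φ (1 - ξ) = 0 := by rw [h, map_zero]
    rw [map_sub, map_one] at h1
    rw [h1, norm_zero] at hφξ
    exact (Real.exp_pos _).ne hφξ
  have hDF : (D : F) ≠ 0 := by exact_mod_cast hD.ne'
  have hintegral : IsIntegral ℤ ((D : F) * (1 - ξ)) := by
    have h1 : IsIntegral ℤ (D : F) := by
      have : IsIntegral ℤ (algebraMap ℤ F D) := isIntegral_algebraMap
      simpa using this
    rw [mul_sub, mul_one]
    exact h1.sub hξ
  have hsum := sum_log_norm_nonneg hintegral (mul_ne_zero hDF h1ξ)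
  have hterm : ∀ ψ : F →+* ℂ, Real.log ‖ψ ((D : F) * (1 - ξ))‖ ≤ x + (1 + x + 8 * δ * T) := by
    intro ψ
    have hψ1 : ‖ψ (1 - ξ)‖ ≠ 0 := norm_ne_zero_iff.mpr ((map_ne_zero ψ).mpr h1ξ)
    rw [map_mul, map_natCast, norm_mul, Complex.norm_natCast, Real.log_mul (by exact_mod_cast hD.ne') hψ1,
      ← hx]
    gcongr
    rw [Real.log_le_iff_le_exp (norm_pos_iff.mpr (norm_ne_zero_iff.mp hψ1)), map_sub, map_one]
    have h2 : ‖ψ ξ‖ ≤ Real.exp (x + 8 * δ * T) := by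
      rw [← Real.log_le_iff_le_exp (norm_pos_iff.mpr ((map_ne_zero ψ).mpr hξ0))]
      exact hξψ ψ
    have h3 : 1 ≤ Real.exp (x + 8 * δ * T) := Real.one_le_exp (by positivity)
    have h4 := norm_sub_le (1 : ℂ) (ψ ξ)
    rw [norm_one] at h4
    rw [add_assoc 1 x, Real.exp_add 1]
    have h5 := Real.add_one_le_exp (1 : ℝ)
    nlinarith
  have hφterm : Real.log ‖φ ((D : F) * (1 - ξ))‖ = x - T := by
    rw [map_mul, map_natCast, norm_mul, Complex.norm_natCast, map_sub, map_one, hφξ,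
      Real.log_mul (by exact_mod_cast hD.ne') (Real.exp_pos _).ne', Real.log_exp, ← hx]
    ring
  classical
  rw [← Finset.add_sum_erase Finset.univ _ (Finset.mem_univ φ), hφterm] at hsum
  have hrest : ∑ ψ ∈ Finset.univ.erase φ, Real.log ‖ψ ((D : F) * (1 - ξ))‖ ≤
      d * (x + (1 + x + 8 * δ * T)) := by
    refine (Finset.sum_le_card_nsmul _ _ _ fun ψ _ => hterm ψ).trans ?_
    rw [nsmul_eq_mul]
    have : ((Finset.univ.erase φ).card : ℝ) ≤ d := by
      have h1 : (Finset.univ.erase φ).card ≤ Fintype.card (F →+* ℂ) := Finset.card_le_univ _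
      rw [Embeddings.card] at h1
      exact_mod_cast h1.trans hd
    gcongr
  have h1 : d * (8 * δ * T) ≤ T / 2 := by nlinarith
  have h2 : d * (2 * P) ≤ T / 4 := by
    have h3 : (1248 * 40 * (d * δ)) * T ≤ 1 * T := by gcongr
    nlinarith
  have h3 : d * (x + (1 + x)) ≤ d * (2 * P) := by
    gcongr
    linarith
  nlinarith

end

section

open Polynomial

variable {n : ℕ} {θ : Fin n → ℂ}

theorem prod_offDiag_sub_eq (θ : Fin n → ℂ) :
    ∏ p ∈ Finset.univ.offDiag, (θ p.1 - θ p.2) = (Matrix.vandermonde θ).det ^ 2 ∨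
      ∏ p ∈ Finset.univ.offDiag, (θ p.1 - θ p.2) = -(Matrix.vandermonde θ).det ^ 2 := by
  have h1 : ∏ p ∈ Finset.univ.offDiag, (θ p.1 - θ p.2) =
      ∏ i, ∏ j ∈ Finset.Ioi i, (-1) * (θ j - θ i) ^ 2 := by
    have h2 : ∀ g : Fin n → Fin n → ℂ, ∏ p ∈ (Finset.univ : Finset (Fin n)).offDiag, g p.1 p.2 =
        (∏ i, ∏ j ∈ Finset.Ioi i, g i j) * ∏ i, ∏ j ∈ Finset.Ioi i, g j i := by
      intro g
      have h3 : ∏ i, ∏ j ∈ Finset.Ioi i, g j i = ∏ i, ∏ j ∈ Finset.Iio i, g i j := by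
        rw [Finset.prod_sigma', Finset.prod_sigma']
        refine Finset.prod_nbij' (fun x => ⟨x.2, x.1⟩) (fun x => ⟨x.2, x.1⟩) ?_ ?_ ?_ ?_ ?_ <;> simp
      have h4 : ∏ p ∈ (Finset.univ : Finset (Fin n)).offDiag, g p.1 p.2 =
          ∏ i, ∏ j ∈ Finset.univ.erase i, g i j := by
        rw [Finset.prod_sigma']
        refine Finset.prod_nbij' (fun x => ⟨x.1, x.2⟩) (fun x => (x.1, x.2)) ?_ ?_ ?_ ?_ ?_ <;>
          simp [ne_comm]
      rw [h3, ← Finset.prod_mul_distrib, h4]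
      refine Finset.prod_congr rfl fun i _ => ?_
      rw [← Finset.prod_union]
      · refine Finset.prod_congr ?_ fun _ _ => rfl
        ext j
        simp [lt_or_lt_iff_ne, ne_comm (a := i)]
      · rw [Finset.disjoint_left]
        intro j hj hj'
        exact absurd (Finset.mem_Ioi.mp hj) (Finset.mem_Iio.mp hj').asymm
    rw [h2 fun i j => θ i - θ j]
    simp only [← Finset.prod_mul_distrib]
    refine Finset.prod_congr rfl fun i _ => Finset.prod_congr rfl fun j _ => ?_
    ring
  rw [h1, Matrix.det_vandermonde]
  simp only [Finset.prod_mul_distrib, Finset.prod_pow, Finset.prod_const, Finset.prod_pow_eq_pow_sum]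
  rcases neg_one_pow_eq_or ℂ (∑ i : Fin n, (Finset.Ioi i).card) with h | h
  · left
    rw [h, one_mul]
  · right
    rw [h, neg_one_mul]

theorem isIntegral_disc_mul_cross_ratio {f : ℤ[X]} {c D : ℤ}
    (hf : f.map (Int.castRingHom ℂ) = C (c : ℂ) * ∏ i, (X - C (θ i)))
    (hdisc : (c : ℂ) ^ (2 * n - 2) * (Matrix.vandermonde θ).det ^ 2 = D) (hinj : Function.Injective θ)
    {i j k l : Fin n} (hij : i ≠ j) (hik : i ≠ k) (hkl : k ≠ l) :
    IsIntegral ℤ ((D : ℂ) * ((θ i - θ k) * (θ l - θ j) / ((θ i - θ j) * (θ k - θ l)))) := by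
  classical
  obtain ⟨M, hM⟩ : ∃ M : Multiset (Fin n × Fin n),
      (Finset.univ : Finset (Fin n)).offDiag.val = (i, j) ::ₘ (k, l) ::ₘ M := by
    refine ⟨((Finset.univ : Finset (Fin n)).offDiag.val.erase (i, j)).erase (k, l), ?_⟩
    rw [Multiset.cons_erase, Multiset.cons_erase]
    · simp [hij]
    · rw [Multiset.mem_erase_of_ne]
      · simp [hkl]
      · simp [hik.symm]
  have hcount : ∀ v : Fin n, (((Finset.univ : Finset (Fin n)).offDiag.val.map Prod.fst).count v +
      ((Finset.univ : Finset (Fin n)).offDiag.val.map Prod.snd).count v) ≤ 2 * n - 2 := by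
    intro v
    rw [Multiset.count_map, Multiset.count_map, ← Finset.filter_val, ← Finset.filter_val, Finset.card_val,
      Finset.card_val]
    have h1 : ((Finset.univ : Finset (Fin n)).offDiag.filter fun a => v = a.1).card ≤ n - 1 := by
      have h2 : (Finset.univ.erase v : Finset (Fin n)).card = n - 1 := by simp
      rw [← h2]
      refine Finset.card_le_card_of_injOn Prod.snd ?_ ?_
      · intro a ha
        have ha' := Finset.mem_filter.mp ha
        simp only [Finset.coe_erase, Finset.coe_univ, Set.mem_sdiff, Set.mem_univ, true_and,
          Set.mem_singleton_iff]
        intro h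
        exact (Finset.mem_offDiag.mp ha'.1).2.2 (ha'.2.symm.trans h.symm)
      · intro a ha b hb hab
        exact Prod.ext ((Finset.mem_filter.mp ha).2.symm.trans (Finset.mem_filter.mp hb).2) hab
    have h3 : ((Finset.univ : Finset (Fin n)).offDiag.filter fun a => v = a.2).card ≤ n - 1 := by
      have h2 : (Finset.univ.erase v : Finset (Fin n)).card = n - 1 := by simp
      rw [← h2]
      refine Finset.card_le_card_of_injOn Prod.fst ?_ ?_
      · intro a ha
        have ha' := Finset.mem_filter.mp ha
        simp only [Finset.coe_erase, Finset.coe_univ, Set.mem_sdiff, Set.mem_univ, true_and,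
          Set.mem_singleton_iff]
        intro h
        exact (Finset.mem_offDiag.mp ha'.1).2.2 (h.trans ha'.2)
      · intro a ha b hb hab
        exact Prod.ext hab ((Finset.mem_filter.mp ha).2.symm.trans (Finset.mem_filter.mp hb).2)
    omega
  have hintegral := isIntegral_pow_mul_prod_sub hf (m := 2 * n - 2) ((i, k) ::ₘ (l, j) ::ₘ M) (by
    intro v
    have := hcount v
    rw [hM] at this
    simp only [Multiset.map_cons, Multiset.count_cons] at this ⊢
    linarith)
  have hprod : ∏ p ∈ Finset.univ.offDiag, (θ p.1 - θ p.2) =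
      (θ i - θ j) * ((θ k - θ l) * (M.map fun p => θ p.1 - θ p.2).prod) := by
    rw [Finset.prod, hM]
    simp
  have h1 : θ i - θ j ≠ 0 := sub_ne_zero.mpr (hinj.ne hij)
  have h2 : θ k - θ l ≠ 0 := sub_ne_zero.mpr (hinj.ne hkl)
  simp only [Multiset.map_cons, Multiset.prod_cons] at hintegral
  rw [← hdisc]
  rcases prod_offDiag_sub_eq θ with h | h
  · rw [← h, hprod]
    refine (congrArg (IsIntegral ℤ) ?_).mp hintegral
    field_simp
  · rw [← neg_eq_iff_eq_neg] at h
    rw [← h, hprod]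
    refine (congrArg (IsIntegral ℤ) ?_).mp hintegral.neg
    field_simp

end

section

open Polynomial NumberField Module

variable {n : ℕ} {θ : Fin n → ℂ}

theorem pairEval_eq_map_aeval {F : Type*} [Field F] [NumberField F] (φ : F →+* ℂ) {a b : F}
    {ω : Fin n × Fin n} (ha : φ a = θ ω.1) (hb : φ b = θ ω.2) (x : MvPolynomial (Fin 2) ℚ) :
    pairEval θ ω x = φ (MvPolynomial.aeval ![a, b] x) := by
  have h : (pairEval θ ω : MvPolynomial (Fin 2) ℚ →+* ℂ) =
      φ.comp (MvPolynomial.aeval ![a, b] : MvPolynomial (Fin 2) ℚ →ₐ[ℚ] F).toRingHom := by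
    refine MvPolynomial.ringHom_ext (fun r => ?_) fun k => ?_
    · simp
    · fin_cases k
      · simpa using ha.symm
      · simpa using hb.symm
  exact RingHom.ext_iff.mp h x

theorem pairIdeal_eq_of_embeddings {F : Type*} [Field F] [NumberField F] (φ ψ : F →+* ℂ) {a b : F}
    {ω ω' : Fin n × Fin n} (ha : φ a = θ ω.1) (hb : φ b = θ ω.2) (ha' : ψ a = θ ω'.1)
    (hb' : ψ b = θ ω'.2) : pairIdeal θ ω' = pairIdeal θ ω := by
  ext x
  rw [mem_pairIdeal, mem_pairIdeal, pairEval_eq_map_aeval φ ha hb, pairEval_eq_map_aeval ψ ha' hb',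
    _root_.map_eq_zero φ, _root_.map_eq_zero ψ]

theorem aeval_eq_zero_iff_exists {f : ℤ[X]} {c : ℤ} (hc : c ≠ 0)
    (hf : f.map (Int.castRingHom ℂ) = C (c : ℂ) * ∏ i, (X - C (θ i))) (z : ℂ) :
    aeval z f = 0 ↔ ∃ i, z = θ i := by
  have h1 : aeval z f = c * ∏ i, (z - θ i) := by
    rw [← eval_map_algebraMap, show algebraMap ℤ ℂ = Int.castRingHom ℂ from rfl, hf, eval_mul, eval_prod]
    simp
  have hcC : (c : ℂ) ≠ 0 := by exact_mod_cast hc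
  rw [h1]
  simp [hcC, Finset.prod_eq_zero_iff, sub_eq_zero]

theorem exists_embedding_eq {f : ℤ[X]} {c : ℤ} (hc : c ≠ 0)
    (hf : f.map (Int.castRingHom ℂ) = C (c : ℂ) * ∏ i, (X - C (θ i))) {F : Type*} [Field F]
    (φ ψ : F →+* ℂ) {a : F} {i : Fin n} (ha : φ a = θ i) : ∃ j, ψ a = θ j := by
  rw [← aeval_eq_zero_iff_exists hc hf]
  have h1 : ∀ χ : F →+* ℂ, aeval (χ a) f = χ (aeval a f) := fun χ =>
    aeval_algHom_apply χ.toIntAlgHom a f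
  have h2 := (aeval_eq_zero_iff_exists hc hf (φ a)).mpr ⟨i, ha⟩
  rw [h1, map_eq_zero] at h2
  rw [h1, h2, map_zero]

/-- The field generated by the roots indexed by a family. -/
noncomputable abbrev rootField (θ : Fin n → ℂ) {k : ℕ} (q : Fin k → Fin n) : IntermediateField ℚ ℂ :=
  IntermediateField.adjoin ℚ (Set.range fun x => θ (q x))

theorem numberField_rootField (hθ : ∀ i, IsIntegral ℚ (θ i)) {k : ℕ} (q : Fin k → Fin n) :
    NumberField (rootField θ q) := by
  have : FiniteDimensional ℚ (rootField θ q) := by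
    refine IntermediateField.finiteDimensional_adjoin ?_
    rintro _ ⟨x, rfl⟩
    exact hθ _
  exact { to_charZero := inferInstance, to_finiteDimensional := this }

theorem finrank_rootField_le {f : ℤ[X]} {c : ℤ} (hc : c ≠ 0)
    (hf : f.map (Int.castRingHom ℂ) = C (c : ℂ) * ∏ i, (X - C (θ i))) (hθ : ∀ i, IsIntegral ℚ (θ i))
    {k : ℕ} (q : Fin k → Fin n) : finrank ℚ (rootField θ q) ≤ n ^ k := by
  have := numberField_rootField hθ q
  rw [← Embeddings.card (rootField θ q) ℂ]
  have hmem : ∀ x, θ (q x) ∈ rootField θ q := fun x => IntermediateField.subset_adjoin _ _ ⟨x, rfl⟩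
  have h1 : ∀ (ψ : rootField θ q →+* ℂ) (x : Fin k), ∃ j, ψ ⟨θ (q x), hmem x⟩ = θ j := fun ψ x =>
    exists_embedding_eq hc hf (algebraMap (rootField θ q) ℂ) ψ (i := q x) rfl
  choose r hr using h1
  have hinj : Function.Injective r := by
    intro ψ χ h
    have h2 : ψ.toRatAlgHom = χ.toRatAlgHom := by
      refine IntermediateField.algHom_ext_of_eq_adjoin ℚ (s := Set.range fun x => θ (q x)) rfl ?_
      rintro _ ⟨x, rfl⟩
      exact (hr ψ x).trans ((congrArg (fun g => θ (g x)) h).trans (hr χ x).symm)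
    refine RingHom.ext fun y => ?_
    exact DFunLike.congr_fun h2 y
  refine (Fintype.card_le_of_injective r hinj).trans_eq ?_
  simp

/-- The logarithm of a cross ratio of absolute differences. -/
noncomputable def logCrossRatio (θ : Fin n → ℂ) (q : Fin 4 → Fin n) : ℝ :=
  Real.log ‖θ (q 0) - θ (q 1)‖ + Real.log ‖θ (q 2) - θ (q 3)‖ - Real.log ‖θ (q 0) - θ (q 3)‖ -
    Real.log ‖θ (q 1) - θ (q 2)‖

theorem false_of_logCrossRatio_gt {f : ℤ[X]} {c D : ℤ} (hc : c ≠ 0) (hD : D ≠ 0)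
    (hf : f.map (Int.castRingHom ℂ) = C (c : ℂ) * ∏ i, (X - C (θ i)))
    (hinj : Function.Injective θ) (hdisc : (c : ℂ) ^ (2 * n - 2) * (Matrix.vandermonde θ).det ^ 2 = D)
    {F : Type*} [Field F] [NumberField F] (φ : F →+* ℂ) {a : Fin 4 → F} {q : Fin 4 → Fin n}
    (hq : Function.Injective q) (ha : ∀ x, φ (a x) = θ (q x)) {d L p : ℕ} (hd : finrank ℚ F ≤ d)
    {T δ P : ℝ} (hTq : T = logCrossRatio θ q)
    (hmax : ∀ q', Function.Injective q' → logCrossRatio θ q' ≤ T) (hδ : 0 < δ)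
    (hp : 0 < p) (hpP : p ≤ P) (hDP : 1 + Real.log |(D : ℝ)| ≤ P) (hT : 10 * P ^ 2 / δ ≤ T)
    (hL0 : 0 < L) (hL : 12 * d * Real.log (1 / (40 * δ)) ≤ L)
    (hν : 1248 * (d ^ 2 * L ^ 2) * (40 * δ) ≤ 1)
    {Y : Fin n × Fin n → MvPolynomial (Fin 2) ℚ}
    (hYorb : ∀ ω ω', pairIdeal θ ω = pairIdeal θ ω' → Y ω = Y ω')
    (hYint : ∀ ω, IsIntegral ℤ (pairEval θ ω (Y ω)) ∧ IsIntegral ℤ (pairEval θ ω (Y ω))⁻¹ ∧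
      pairEval θ ω (Y ω) ≠ 0) {t : Fin n × Fin n → ℝ}
    (ht : ∀ ω, t ω = Real.log ‖θ ω.1 - θ ω.2‖ / T)
    (hYlog : ∀ ω, |Real.log ‖pairEval θ ω (Y ω)‖ - p * (t ω - orbitMean θ t ω)| ≤ δ)
    (hYim : ∀ j : Fin 4, ∃ z : ℂ, Complex.exp z = pairEval θ ((![(q 0, q 2), (q 3, q 1), (q 0, q 1),
      (q 2, q 3)] : Fin 4 → Fin n × Fin n) j) (Y ((![(q 0, q 2), (q 3, q 1), (q 0, q 1),
      (q 2, q 3)] : Fin 4 → Fin n × Fin n) j)) ∧ |z.im| ≤ δ) : False := by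
  have hTpos : 0 < T := lt_of_lt_of_le (by have : (0:ℝ) < p := by exact_mod_cast hp
                                           have : 0 < P := this.trans_le hpP
                                           positivity) hT
  obtain ⟨e, he⟩ : ∃ e : Fin 4 → Fin 4 → F, ∀ x y, e x y =
      MvPolynomial.aeval ![a x, a y] (Y (q x, q y)) := ⟨_, fun x y => rfl⟩
  have hinja : Function.Injective a := by
    intro x y h
    exact hq (hinj (by rw [← ha, ← ha, h]))
  have hψq : ∀ ψ : F →+* ℂ, ∃ q' : Fin 4 → Fin n, Function.Injective q' ∧ ∀ x, ψ (a x) = θ (q' x) := by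
    intro ψ
    choose q' hq' using fun x => exists_embedding_eq hc hf φ ψ (ha x)
    refine ⟨q', fun x y h => hinja (ψ.injective ?_), hq'⟩
    rw [hq', hq', h]
  have hid : ∀ (ψ : F →+* ℂ) (q' : Fin 4 → Fin n), (∀ x, ψ (a x) = θ (q' x)) → ∀ x y,
      pairIdeal θ (q' x, q' y) = pairIdeal θ (q x, q y) := fun ψ q' h x y =>
    pairIdeal_eq_of_embeddings φ ψ (ω := (q x, q y)) (ω' := (q' x, q' y)) (ha x) (ha y) (h x) (h y)
  have hψe : ∀ (ψ : F →+* ℂ) (q' : Fin 4 → Fin n), (∀ x, ψ (a x) = θ (q' x)) → ∀ x y,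
      ψ (e x y) = pairEval θ (q' x, q' y) (Y (q' x, q' y)) := by
    intro ψ q' h x y
    rw [he, hYorb _ _ (hid ψ q' h x y),
      pairEval_eq_map_aeval ψ (ω := (q' x, q' y)) (h x) (h y)]
  have hφe := hψe φ q ha
  have he0 : ∀ x y, e x y ≠ 0 := fun x y h => (hYint (q x, q y)).2.2 (by rw [← hφe, h, map_zero])
  have hintegral : ∀ x : F, IsIntegral ℤ (φ x) → IsIntegral ℤ x := fun x hx =>
    (isIntegral_algHom_iff φ.toIntAlgHom φ.injective).mp hx
  have heI : ∀ x y, IsIntegral ℤ (e x y) := fun x y => hintegral _ (by rw [hφe]; exact (hYint _).1)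
  have heI' : ∀ x y, IsIntegral ℤ (e x y)⁻¹ := fun x y =>
    hintegral _ (by rw [map_inv₀, hφe]; exact (hYint _).2.1)
  have hsub : ∀ {x y : Fin 4}, x ≠ y → a x - a y ≠ 0 := fun h => sub_ne_zero.mpr (hinja.ne h)
  have h01 := hsub (show (0 : Fin 4) ≠ 1 by decide)
  have h02 := hsub (show (0 : Fin 4) ≠ 2 by decide)
  have h23 := hsub (show (2 : Fin 4) ≠ 3 by decide)
  have h31 := hsub (show (3 : Fin 4) ≠ 1 by decide)
  have h03 := hsub (show (0 : Fin 4) ≠ 3 by decide)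
  have h12 := hsub (show (1 : Fin 4) ≠ 2 by decide)
  obtain ⟨ξ, hξ⟩ : ∃ ξ, ξ = -((a 0 - a 2) * (a 3 - a 1) / ((a 0 - a 1) * (a 2 - a 3))) := ⟨_, rfl⟩
  obtain ⟨η, hη⟩ : ∃ η, η = e 0 2 * e 3 1 * ((e 0 1)⁻¹ * (e 2 3)⁻¹) := ⟨_, rfl⟩
  have hξ0 : ξ ≠ 0 := by
    rw [hξ, neg_ne_zero]
    exact div_ne_zero (mul_ne_zero h02 h31) (mul_ne_zero h01 h23)
  have hη0 : η ≠ 0 := by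
    rw [hη]
    exact mul_ne_zero (mul_ne_zero (he0 _ _) (he0 _ _))
      (mul_ne_zero (inv_ne_zero (he0 _ _)) (inv_ne_zero (he0 _ _)))
  have hnorm_sub : ∀ (ψ : F →+* ℂ) (q' : Fin 4 → Fin n), (∀ x, ψ (a x) = θ (q' x)) → ∀ x y,
      ‖ψ (a x - a y)‖ = ‖θ (q' x) - θ (q' y)‖ := fun ψ q' h x y => by rw [map_sub, h, h]
  have hne : ∀ (ψ : F →+* ℂ) {x : F}, x ≠ 0 → ‖ψ x‖ ≠ 0 := fun ψ x hx =>
    norm_ne_zero_iff.mpr ((_root_.map_ne_zero ψ).mpr hx)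
  have hlogξ : ∀ (ψ : F →+* ℂ) (q' : Fin 4 → Fin n), (∀ x, ψ (a x) = θ (q' x)) →
      Real.log ‖ψ ξ‖ = Real.log ‖θ (q' 0) - θ (q' 2)‖ + Real.log ‖θ (q' 3) - θ (q' 1)‖ -
        (Real.log ‖θ (q' 0) - θ (q' 1)‖ + Real.log ‖θ (q' 2) - θ (q' 3)‖) := by
    intro ψ q' h
    rw [hξ, map_neg, norm_neg, map_div₀, map_mul, map_mul, norm_div, norm_mul, norm_mul,
      Real.log_div (mul_ne_zero (hne ψ h02) (hne ψ h31)) (mul_ne_zero (hne ψ h01) (hne ψ h23)),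
      Real.log_mul (hne ψ h02) (hne ψ h31), Real.log_mul (hne ψ h01) (hne ψ h23)]
    simp only [hnorm_sub ψ q' h]
  obtain ⟨μ, hμ⟩ : ∃ μ, μ = T * (orbitMean θ t (q 0, q 2) + orbitMean θ t (q 3, q 1) -
    (orbitMean θ t (q 0, q 1) + orbitMean θ t (q 2, q 3))) := ⟨_, rfl⟩
  obtain ⟨z0, hz0, hz0'⟩ := hYim 0
  obtain ⟨z1, hz1, hz1'⟩ := hYim 1
  obtain ⟨z2, hz2, hz2'⟩ := hYim 2
  obtain ⟨z3, hz3, hz3'⟩ := hYim 3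
  simp only [Matrix.cons_val] at hz0 hz1 hz2 hz3
  have hDnat : ((D.natAbs : ℕ) : ℝ) = |(D : ℝ)| := by rw [Nat.cast_natAbs, Int.cast_abs]
  have hDint : ∀ x : F, IsIntegral ℤ ((D : ℂ) * φ x) → IsIntegral ℤ ((D.natAbs : F) * -x) ∧
      IsIntegral ℤ ((D.natAbs : F) * x) := by
    intro x hx
    have h1 : IsIntegral ℤ ((D : F) * x) := hintegral _ (by rwa [map_mul, map_intCast])
    rcases Int.natAbs_eq D with h | h
    · rw [h, Int.cast_natCast] at h1
      exact ⟨by simpa only [mul_neg] using h1.neg, h1⟩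
    · rw [h, Int.cast_neg, Int.cast_natCast, neg_mul] at h1
      exact ⟨by simpa only [mul_neg] using h1, by simpa only [neg_neg] using h1.neg⟩
  refine NumberField.false_of_unit_close φ (ξ := ξ) (η := η) hξ0 (D := D.natAbs) (Int.natAbs_pos.mpr hD)
    ?_ ?_ ?_ ?_ hη0 (μ := μ) hδ hp hpP (by rwa [hDnat]) hT hd hL0 hL hν ?_ ?_ ?_
    (ω := z0 + z1 - (z2 + z3)) ?_ ?_
  · rw [hξ]
    refine (hDint _ ?_).1
    have := isIntegral_disc_mul_cross_ratio hf hdisc hinj (i := q 0) (j := q 1) (k := q 2) (l := q 3)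
      (hq.ne (by decide)) (hq.ne (by decide)) (hq.ne (by decide))
    simpa only [map_div₀, map_mul, map_sub, ha] using this
  · rw [hξ, show (-((a 0 - a 2) * (a 3 - a 1) / ((a 0 - a 1) * (a 2 - a 3))))⁻¹ =
      ((a 0 - a 1) * (a 3 - a 2)) / ((a 0 - a 2) * (a 3 - a 1)) by
        rw [inv_neg, inv_div, ← neg_div]; ring]
    have := isIntegral_disc_mul_cross_ratio hf hdisc hinj (i := q 0) (j := q 2) (k := q 1) (l := q 3)
      (hq.ne (by decide)) (hq.ne (by decide)) (hq.ne (by decide))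
    rw [show (a 0 - a 1) * (a 3 - a 2) / ((a 0 - a 2) * (a 3 - a 1)) =
      -((a 0 - a 1) * (a 3 - a 2) / ((a 0 - a 2) * (a 1 - a 3))) by
        rw [← neg_sub (a 1) (a 3), mul_neg, div_neg]]
    refine (hDint _ ?_).1
    simpa only [map_div₀, map_mul, map_sub, ha] using this
  · rw [hη]
    exact ((heI _ _).mul (heI _ _)).mul ((heI' _ _).mul (heI' _ _))
  · rw [hη, mul_inv, mul_inv, mul_inv, inv_inv, inv_inv]
    exact ((heI' _ _).mul (heI' _ _)).mul ((heI _ _).mul (heI _ _))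
  · intro ψ
    obtain ⟨q', hq', h⟩ := hψq ψ
    have hm : ∀ x y, orbitMean θ t (q' x, q' y) = orbitMean θ t (q x, q y) := fun x y =>
      orbitMean_congr t (hid ψ q' h x y)
    have hl : ∀ x y, |Real.log ‖ψ (e x y)‖ -
        p * (Real.log ‖θ (q' x) - θ (q' y)‖ / T - orbitMean θ t (q x, q y))| ≤ δ := by
      intro x y
      have := hYlog (q' x, q' y)
      rwa [ht, hm, ← hψe ψ q' h] at this
    have hlη : Real.log ‖ψ η‖ = Real.log ‖ψ (e 0 2)‖ + Real.log ‖ψ (e 3 1)‖ -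
        (Real.log ‖ψ (e 0 1)‖ + Real.log ‖ψ (e 2 3)‖) := by
      have hn := fun x y => hne ψ (he0 x y)
      rw [hη, map_mul, map_mul, map_mul, map_inv₀, map_inv₀, norm_mul, norm_mul, norm_mul, norm_inv,
        norm_inv, Real.log_mul (mul_ne_zero (hn _ _) (hn _ _))
          (mul_ne_zero (inv_ne_zero (hn _ _)) (inv_ne_zero (hn _ _))),
        Real.log_mul (hn _ _) (hn _ _), Real.log_mul (inv_ne_zero (hn _ _)) (inv_ne_zero (hn _ _)),
        Real.log_inv, Real.log_inv]
      ring
    have hkey : Real.log ‖ψ η‖ - p / T * (Real.log ‖ψ ξ‖ - μ) =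
        (Real.log ‖ψ (e 0 2)‖ -
          p * (Real.log ‖θ (q' 0) - θ (q' 2)‖ / T - orbitMean θ t (q 0, q 2))) +
        (Real.log ‖ψ (e 3 1)‖ -
          p * (Real.log ‖θ (q' 3) - θ (q' 1)‖ / T - orbitMean θ t (q 3, q 1))) -
        (Real.log ‖ψ (e 0 1)‖ -
          p * (Real.log ‖θ (q' 0) - θ (q' 1)‖ / T - orbitMean θ t (q 0, q 1))) -
        (Real.log ‖ψ (e 2 3)‖ -
          p * (Real.log ‖θ (q' 2) - θ (q' 3)‖ / T - orbitMean θ t (q 2, q 3))) := by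
      rw [hlη, hlogξ ψ q' h, hμ]
      field_simp
      ring
    rw [hkey]
    have b1 := abs_le.mp (hl 0 2)
    have b2 := abs_le.mp (hl 3 1)
    have b3 := abs_le.mp (hl 0 1)
    have b4 := abs_le.mp (hl 2 3)
    exact abs_le.mpr ⟨by linarith [b1.1, b2.1, b3.2, b4.2], by linarith [b1.2, b2.2, b3.1, b4.1]⟩
  · intro ψ
    obtain ⟨q', hq', h⟩ := hψq ψ
    have c1 := hmax (fun x => q' ((![0, 2, 3, 1] : Fin 4 → Fin 4) x)) (hq'.comp (by decide))
    have c2 := hmax (fun x => q' ((![0, 1, 3, 2] : Fin 4 → Fin 4) x)) (hq'.comp (by decide))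
    simp only [logCrossRatio, Matrix.cons_val] at c1 c2
    rw [hlogξ ψ q' h]
    rw [norm_sub_rev (θ (q' 2)) (θ (q' 3))] at c1 ⊢
    rw [norm_sub_rev (θ (q' 1)) (θ (q' 3))] at c2
    exact abs_le.mpr ⟨by linarith, by linarith⟩
  · have h1 : 1 - ξ = -((a 0 - a 3) * (a 1 - a 2) / ((a 0 - a 1) * (a 2 - a 3))) := by
      rw [hξ]
      field_simp
      ring
    have h2 : 1 - φ ξ = φ (1 - ξ) := by rw [map_sub, map_one]
    rw [h2, h1, map_neg, norm_neg, map_div₀, map_mul, map_mul, norm_div, norm_mul, norm_mul]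
    have hpos : ∀ {x : F}, x ≠ 0 → 0 < ‖φ x‖ := fun hx => (norm_nonneg _).lt_of_ne' (hne φ hx)
    rw [hTq, logCrossRatio, ← hnorm_sub φ q ha, ← hnorm_sub φ q ha, ← hnorm_sub φ q ha,
      ← hnorm_sub φ q ha, show ∀ w x y z : ℝ, -(w + x - y - z) = y + z - (w + x) by intros; ring,
      Real.exp_sub, Real.exp_add, Real.exp_add, Real.exp_log (hpos h01), Real.exp_log (hpos h23),
      Real.exp_log (hpos h03), Real.exp_log (hpos h12)]
  · rw [Complex.exp_sub, Complex.exp_add, Complex.exp_add, hz0, hz1, hz2, hz3, hη, ← hφe, ← hφe, ← hφe,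
      ← hφe, map_mul, map_mul, map_mul, map_inv₀, map_inv₀, div_eq_mul_inv, mul_inv]
  · simp only [Complex.sub_im, Complex.add_im]
    have b1 := abs_le.mp hz0'
    have b2 := abs_le.mp hz1'
    have b3 := abs_le.mp hz2'
    have b4 := abs_le.mp hz3'
    exact abs_le.mpr ⟨by linarith [b1.1, b2.1, b3.2, b4.2], by linarith [b1.2, b2.2, b3.1, b4.1]⟩

theorem logCrossRatio_le {f : ℤ[X]} {c D : ℤ} (hc : c ≠ 0) (hD : D ≠ 0)
    (hf : f.map (Int.castRingHom ℂ) = C (c : ℂ) * ∏ i, (X - C (θ i))) (hθ : ∀ i, IsIntegral ℚ (θ i))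
    (hinj : Function.Injective θ) (hdisc : (c : ℂ) ^ (2 * n - 2) * (Matrix.vandermonde θ).det ^ 2 = D)
    {δ : ℝ} (hδ : 0 < δ) (hδ1 : δ ≤ 1) {P L : ℕ}
    (hP : 8 ^ n ^ 2 * (|D| : ℝ) ^ (2 * n) * ((1 + n * Real.log |D|) / δ + 1) ^ n ^ 2 * (7 / δ + 1) ^ 4 ≤ P)
    (hL0 : 0 < L) (hL : 12 * (n : ℝ) ^ 4 * Real.log (1 / (40 * δ)) ≤ L)
    (hν : 1248 * (((n : ℝ) ^ 4) ^ 2 * L ^ 2) * (40 * δ) ≤ 1) (q : Fin 4 → Fin n) (hq : Function.Injective q) :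
    logCrossRatio θ q ≤ 10 * P ^ 2 / δ := by
  classical
  by_contra! hcon
  obtain ⟨q, hq, hmax⟩ : ∃ q₀ : Fin 4 → Fin n, Function.Injective q₀ ∧
      ∀ q', Function.Injective q' → logCrossRatio θ q' ≤ logCrossRatio θ q₀ ∧
        10 * P ^ 2 / δ < logCrossRatio θ q₀ := by
    obtain ⟨q₀, h1, h2⟩ := Finset.exists_max_image
      ((Finset.univ : Finset (Fin 4 → Fin n)).filter Function.Injective) (logCrossRatio θ)
      ⟨q, by simpa using hq⟩
    simp only [Finset.mem_filter, Finset.mem_univ, true_and] at h1 h2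
    exact ⟨q₀, h1, fun q' hq' => ⟨h2 q' hq', hcon.trans_le (h2 q hq)⟩⟩
  obtain ⟨T, hTdef⟩ : ∃ T, T = logCrossRatio θ q := ⟨_, rfl⟩
  have hT := (hmax q hq).2
  rw [← hTdef] at hT
  replace hmax : ∀ q', Function.Injective q' → logCrossRatio θ q' ≤ T := fun q' hq' =>
    hTdef ▸ (hmax q' hq').1
  have hTpos : 0 < T := lt_of_le_of_lt (by positivity) hT
  have hD1 : (1 : ℝ) ≤ |(D : ℝ)| := by exact_mod_cast Int.one_le_abs hD
  have hlogD : 0 ≤ Real.log |(D : ℝ)| := Real.log_nonneg hD1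
  have hn : 0 < n := Fin.pos (q 0)
  have hDP : 1 + Real.log |(D : ℝ)| ≤ P := by
    refine le_trans ?_ hP
    have h1 : (1 : ℝ) ≤ 8 ^ n ^ 2 * |(D : ℝ)| ^ (2 * n) :=
      one_le_mul_of_one_le_of_one_le (one_le_pow₀ (by norm_num)) (one_le_pow₀ hD1)
    have h2 : (1 : ℝ) ≤ (7 / δ + 1) ^ 4 := one_le_pow₀ (by have : 0 ≤ 7 / δ := by positivity
                                                           linarith)
    have hn1 : (1 : ℝ) ≤ n := by exact_mod_cast hn
    have h3 : 1 + Real.log |(D : ℝ)| ≤ (1 + n * Real.log |(D : ℝ)|) / δ + 1 := by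
      have h4 : 1 + n * Real.log |(D : ℝ)| ≤ (1 + n * Real.log |(D : ℝ)|) / δ :=
        le_div_self (by positivity) hδ hδ1
      nlinarith
    have h5 : (1 + n * Real.log |(D : ℝ)|) / δ + 1 ≤ ((1 + n * Real.log |(D : ℝ)|) / δ + 1) ^ n ^ 2 :=
      le_self_pow₀ (by linarith) (by positivity)
    calc 1 + Real.log |(D : ℝ)| ≤ 1 * ((1 + n * Real.log |(D : ℝ)|) / δ + 1) ^ n ^ 2 * 1 := by linarith
      _ ≤ _ := by gcongr
  obtain ⟨t, ht⟩ : ∃ t : Fin n × Fin n → ℝ, ∀ ω, t ω = Real.log ‖θ ω.1 - θ ω.2‖ / T := ⟨_, fun ω => rfl⟩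
  obtain ⟨p, hp, hpP, Y, hYorb, hYint, hYlog, hYim⟩ := exists_pair_units hc hD hf hθ hinj hdisc t
    (by
      intro ω ω' h1 h2
      rw [ht, ht, h1, h2, ← map_sub, RCLike.norm_conj])
    ![(q 0, q 2), (q 3, q 1), (q 0, q 1), (q 2, q 3)] hδ P hP
  have := numberField_rootField hθ q
  have hfin := finrank_rootField_le hc hf hθ q
  refine false_of_logCrossRatio_gt hc hD hf hinj hdisc (algebraMap (rootField θ q) ℂ)
    (a := fun x => ⟨θ (q x), IntermediateField.subset_adjoin _ _ ⟨x, rfl⟩⟩) hq (fun x => rfl) hfin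
    hTdef hmax hδ hp (by exact_mod_cast hpP) hDP hT.le hL0 (by simpa using hL) (by simpa using hν)
    hYorb hYint ht hYlog hYim

end

section

open Polynomial UpperHalfPlane

theorem exists_reduced_basis {a b c : ℝ} (ha : 0 < a) (hdet : 0 < a * c - b ^ 2) :
    ∃ x y z w : ℤ, x * w - y * z = 1 ∧
      a * x ^ 2 - 2 * b * x * z + c * z ^ 2 ≤ a * y ^ 2 - 2 * b * y * w + c * w ^ 2 ∧
      (a * x ^ 2 - 2 * b * x * z + c * z ^ 2) * (a * y ^ 2 - 2 * b * y * w + c * w ^ 2) ≤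
        4 / 3 * (a * c - b ^ 2) := by
  have hs : 0 < √(a * c - b ^ 2) := Real.sqrt_pos.mpr hdet
  have hs2 : √(a * c - b ^ 2) ^ 2 = a * c - b ^ 2 := Real.sq_sqrt hdet.le
  obtain ⟨s, hs_def⟩ : ∃ s, s = √(a * c - b ^ 2) := ⟨_, rfl⟩
  rw [← hs_def] at hs hs2
  obtain ⟨τ, hτ⟩ : ∃ τ : ℍ, (τ : ℂ) = ⟨b / a, s / a⟩ := ⟨⟨⟨b / a, s / a⟩, by positivity⟩, rfl⟩
  have hQ : ∀ x y : ℝ, a * x ^ 2 - 2 * b * x * y + c * y ^ 2 =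
      a * Complex.normSq ((x : ℂ) - y * τ) := by
    intro x y
    rw [hτ, Complex.normSq_apply]
    simp only [Complex.sub_re, Complex.ofReal_re, Complex.mul_re, Complex.ofReal_im, Complex.sub_im,
      Complex.mul_im, zero_mul, sub_zero, add_zero, zero_sub]
    have hc : c = (s ^ 2 + b ^ 2) / a := by
      rw [hs2]
      field_simp
      ring
    rw [hc]
    field_simp
    ring
  obtain ⟨g, hg⟩ := ModularGroup.exists_smul_mem_fd τ
  have hdetg : g 0 0 * g 1 1 - g 0 1 * g 1 0 = 1 := by
    have := g.det_coe
    rwa [Matrix.det_fin_two] at this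
  refine ⟨g 1 1, -g 0 1, -g 1 0, g 0 0, by linarith, ?_⟩
  obtain ⟨u, hu⟩ : ∃ u : ℂ, u = (g 0 0 : ℂ) * τ + (g 0 1 : ℂ) := ⟨_, rfl⟩
  obtain ⟨v, hv⟩ : ∃ v : ℂ, v = (g 1 0 : ℂ) * τ + (g 1 1 : ℂ) := ⟨_, rfl⟩
  have hcoe : ((g • τ : ℍ) : ℂ) = u / v := by
    rw [coe_specialLinearGroup_apply, hu, hv]
    simp
  have hv0 : v ≠ 0 := by
    intro h
    have h1 := (g • τ).im_pos
    rw [← coe_im, hcoe, h] at h1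
    simp at h1
  have hNv : 0 < Complex.normSq v := Complex.normSq_pos.mpr hv0
  have him : (g • τ).im = s / a / Complex.normSq v := by
    have h1 := ModularGroup.im_smul_eq_div_normSq g τ
    have h2 : τ.im = s / a := by rw [← coe_im, hτ]
    rw [h1, h2, hv]
    simp [denom]
  have hre : (g • τ).re ^ 2 ≤ 1 / 4 := by
    have := hg.2
    rw [← sq_abs]
    nlinarith [abs_nonneg (g • τ).re]
  have h34 := ModularGroup.three_le_four_mul_im_sq_of_mem_fd hg
  have h1le : 1 ≤ Complex.normSq (u / v) := hcoe ▸ hg.1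
  have hle : Complex.normSq (u / v) ≤ 4 / 3 * (s / a / Complex.normSq v) ^ 2 := by
    rw [← hcoe, Complex.normSq_apply, coe_re, coe_im, ← him]
    nlinarith
  have hQ1 : a * ((g 1 1 : ℤ) : ℝ) ^ 2 - 2 * b * (g 1 1 : ℤ) * ((-g 1 0 : ℤ) : ℝ) +
      c * ((-g 1 0 : ℤ) : ℝ) ^ 2 = a * Complex.normSq v := by
    rw [hQ, hv]
    push_cast
    congr 2
    ring
  have hQ2 : a * ((-g 0 1 : ℤ) : ℝ) ^ 2 - 2 * b * ((-g 0 1 : ℤ) : ℝ) * (g 0 0 : ℤ) +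
      c * ((g 0 0 : ℤ) : ℝ) ^ 2 = a * Complex.normSq u := by
    rw [hQ, hu, ← Complex.normSq_neg]
    push_cast
    congr 2
    ring
  rw [Complex.normSq_div] at h1le hle
  have hu_eq : Complex.normSq u = Complex.normSq u / Complex.normSq v * Complex.normSq v := by
    field_simp
  rw [hQ1, hQ2]
  refine ⟨?_, ?_⟩
  · refine mul_le_mul_of_nonneg_left ?_ ha.le
    rwa [one_le_div hNv] at h1le
  · calc a * Complex.normSq v * (a * Complex.normSq u)
        = a ^ 2 * Complex.normSq v ^ 2 * (Complex.normSq u / Complex.normSq v) := by field_simp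
      _ ≤ a ^ 2 * Complex.normSq v ^ 2 * (4 / 3 * (s / a / Complex.normSq v) ^ 2) := by gcongr
      _ = 4 / 3 * (a * c - b ^ 2) := by
        rw [← hs2]
        field_simp

end

section

open Polynomial

theorem norm_coeff_prod_le {ι : Type*} (s : Finset ι) {p : ι → ℂ[X]} {r : ι → ℝ[X]}
    (h : ∀ i k, ‖(p i).coeff k‖ ≤ (r i).coeff k) (k : ℕ) :
    ‖(∏ i ∈ s, p i).coeff k‖ ≤ (∏ i ∈ s, r i).coeff k := by
  classical
  induction s using Finset.induction_on generalizing k with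
  | empty =>
    rw [Finset.prod_empty, Finset.prod_empty, coeff_one, coeff_one]
    split_ifs <;> simp
  | insert a s ha ih =>
    rw [Finset.prod_insert ha, Finset.prod_insert ha, coeff_mul, coeff_mul]
    refine (norm_sum_le _ _).trans (Finset.sum_le_sum fun x _ => ?_)
    rw [norm_mul]
    exact mul_le_mul (h a _) (ih _) (norm_nonneg _) ((norm_nonneg _).trans (h a _))

theorem coeff_C_mul_X_add_C_pow {R : Type*} [CommRing R] (a b : R) (n k : ℕ) :
    ((C a * X + C b) ^ n).coeff k = a ^ k * b ^ (n - k) * n.choose k := by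
  have h : (C a * X + C b) ^ n = ((X + C b) ^ n).comp (C a * X) := by simp
  rw [h, comp_C_mul_X_coeff, coeff_X_add_C_pow]
  ring

theorem coeff_C_mul_X_add_C {R : Type*} [CommRing R] (a b : R) (k : ℕ) :
    (C a * X + C b).coeff k = if k = 0 then b else if k = 1 then a else 0 := by
  rw [coeff_add, coeff_C_mul, coeff_X, coeff_C]
  rcases k with _ | _ | k <;> simp

theorem sum_coeff_mul_pow_mul_pow {R : Type*} [CommRing R] {n : ℕ} (c : R) (θ : Fin n → R)
    {S : Type*} [CommRing S] [Algebra R S] (u v : S) :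
    ∑ k ∈ Finset.range (n + 1), algebraMap R S ((C c * ∏ i, (X - C (θ i))).coeff k) * u ^ k * v ^ (n - k) =
      algebraMap R S c * ∏ i, (u - algebraMap R S (θ i) * v) := by
  induction n with
  | zero => simp
  | succ n ih =>
    rw [Fin.prod_univ_succ, Fin.prod_univ_succ]
    have ih' := ih (fun i => θ i.succ)
    obtain ⟨p, hp⟩ : ∃ p, p = C c * ∏ i : Fin n, (X - C (θ i.succ)) := ⟨_, rfl⟩
    have hdeg : p.coeff (n + 1) = 0 := by
      nontriviality R
      refine coeff_eq_zero_of_natDegree_lt ?_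
      rw [hp]
      refine (natDegree_C_mul_le _ _).trans_lt ?_
      rw [natDegree_finsetProd_X_sub_C_eq_card]
      simp
    have h1 : C c * ((X - C (θ 0)) * ∏ i : Fin n, (X - C (θ i.succ))) = X * p - C (θ 0) * p := by
      rw [hp]; ring
    rw [h1, mul_left_comm, ← ih', ← hp, sub_mul, Finset.mul_sum, Finset.mul_sum]
    simp only [coeff_sub, coeff_C_mul, map_sub, map_mul, sub_mul, Finset.sum_sub_distrib]
    congr 1
    · rw [Finset.sum_range_succ']
      simp only [coeff_X_mul, coeff_X_mul_zero, map_zero, zero_mul, add_zero, Nat.add_sub_add_right]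
      refine Finset.sum_congr rfl fun k _ => ?_
      ring
    · rw [Finset.sum_range_succ, hdeg]
      simp only [map_zero, mul_zero, zero_mul, add_zero]
      refine Finset.sum_congr rfl fun k hk => ?_
      rw [Nat.succ_sub (Nat.le_of_lt_succ (Finset.mem_range.mp hk)), pow_succ]
      ring

variable {n : ℕ} {θ : Fin n → ℂ}

theorem map_glTranslate {f : ℤ[X]} {c : ℤ}
    (hf : f.map (Int.castRingHom ℂ) = C (c : ℂ) * ∏ i, (X - C (θ i))) (m : Matrix (Fin 2) (Fin 2) ℤ) :
    (glTranslate n f m).map (Int.castRingHom ℂ) =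
      C (c : ℂ) * ∏ i, (C (m 0 0 - θ i * m 1 0) * X + C (m 0 1 - θ i * m 1 1)) := by
  have h := sum_coeff_mul_pow_mul_pow (c : ℂ) θ (C (m 0 0 : ℂ) * X + C (m 0 1 : ℂ))
    (C (m 1 0 : ℂ) * X + C (m 1 1 : ℂ))
  rw [← hf] at h
  simp only [algebraMap_eq, coeff_map] at h
  simp only [glTranslate, Polynomial.map_sum, Polynomial.map_mul, Polynomial.map_pow, Polynomial.map_add,
    map_C, map_X]
  refine h.trans ?_
  congr 1
  refine Finset.prod_congr rfl fun i _ => ?_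
  simp only [map_sub, map_mul]
  ring

theorem glTranslate_coeff_bounds {f : ℤ[X]} {c : ℤ} (hc : c ≠ 0)
    (hf : f.map (Int.castRingHom ℂ) = C (c : ℂ) * ∏ i, (X - C (θ i))) (hinj : Function.Injective θ)
    (m : Matrix (Fin 2) (Fin 2) ℤ) (hm : m.det ≠ 0) {w : Fin n → ℝ} (hw : ∀ i, 0 < w i) {b₁ b₂ : ℝ}
    (hb : b₁ ≤ b₂) (h₁ : ∀ i, w i * ‖(m 0 0 - θ i * m 1 0 : ℂ)‖ ≤ b₁)
    (h₂ : ∀ i, w i * ‖(m 0 1 - θ i * m 1 1 : ℂ)‖ ≤ b₂) (hn : 0 < n) :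
    (∀ k, |((glTranslate n f m).coeff k : ℝ)| ≤ 2 ^ n * (|(c : ℝ)| / ∏ i, w i) * b₂ ^ n) ∧
      1 ≤ n * (|(c : ℝ)| / ∏ i, w i) * b₁ ^ (n - 1) * b₂ := by
  have hb1 : 0 ≤ b₁ := (mul_nonneg (hw ⟨0, hn⟩).le (norm_nonneg _)).trans (h₁ ⟨0, hn⟩)
  have hb2 := hb1.trans hb
  have hW : 0 < ∏ i, w i := Finset.prod_pos fun i _ => hw i
  have hmap := map_glTranslate hf m
  obtain ⟨A, hA⟩ : ∃ A, A = |(c : ℝ)| / ∏ i, w i := ⟨_, rfl⟩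
  have hA0 : 0 ≤ A := by rw [hA]; positivity
  have hcoeff : ∀ k, |((glTranslate n f m).coeff k : ℝ)| ≤ A * (b₁ ^ k * b₂ ^ (n - k) * n.choose k) := by
    intro k
    have h1 : |((glTranslate n f m).coeff k : ℝ)| =
        ‖((glTranslate n f m).map (Int.castRingHom ℂ)).coeff k‖ := by
      rw [coeff_map, eq_intCast, Complex.norm_intCast]
    have h2 : ∏ i, (C (b₁ / w i) * X + C (b₂ / w i)) = C (∏ i, w i)⁻¹ * (C b₁ * X + C b₂) ^ n := by
      have h3 : ∀ i, C (b₁ / w i) * X + C (b₂ / w i) = C (w i)⁻¹ * (C b₁ * X + C b₂) := by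
        intro i
        rw [div_eq_inv_mul, div_eq_inv_mul, C_mul, C_mul]
        ring
      simp only [h3, Finset.prod_mul_distrib, ← map_prod, Finset.prod_inv_distrib]
      simp
    rw [h1, hmap, coeff_C_mul, norm_mul, Complex.norm_intCast]
    have h4 := norm_coeff_prod_le Finset.univ
      (p := fun i => C (m 0 0 - θ i * m 1 0) * X + C (m 0 1 - θ i * m 1 1))
      (r := fun i => C (b₁ / w i) * X + C (b₂ / w i)) (fun i k => by
        have e1 : ‖(m 0 0 - θ i * m 1 0 : ℂ)‖ ≤ b₁ / w i := by
          rw [le_div_iff₀ (hw i), mul_comm]; exact h₁ i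
        have e2 : ‖(m 0 1 - θ i * m 1 1 : ℂ)‖ ≤ b₂ / w i := by
          rw [le_div_iff₀ (hw i), mul_comm]; exact h₂ i
        rw [coeff_C_mul_X_add_C, coeff_C_mul_X_add_C]
        split_ifs
        · exact e2
        · exact e1
        · exact norm_zero.le) k
    rw [h2, coeff_C_mul, coeff_C_mul_X_add_C_pow] at h4
    rw [hA, div_mul_eq_mul_div, mul_div_assoc]
    refine mul_le_mul_of_nonneg_left (h4.trans_eq ?_) (abs_nonneg _)
    rw [div_eq_inv_mul]
  rw [← hA]
  refine ⟨fun k => ?_, ?_⟩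
  · refine (hcoeff k).trans ?_
    rw [mul_comm (2 ^ n : ℝ) A, mul_assoc A, mul_comm (2 ^ n : ℝ)]
    refine mul_le_mul_of_nonneg_left ?_ hA0
    rcases le_or_gt k n with hk | hk
    · have e1 : b₁ ^ k * b₂ ^ (n - k) ≤ b₂ ^ n := by
        calc b₁ ^ k * b₂ ^ (n - k) ≤ b₂ ^ k * b₂ ^ (n - k) := by gcongr
          _ = b₂ ^ n := by rw [← pow_add, Nat.add_sub_cancel' hk]
      have e2 : (n.choose k : ℝ) ≤ 2 ^ n := by exact_mod_cast Nat.choose_le_two_pow n k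
      gcongr
    · rw [Nat.choose_eq_zero_of_lt hk]
      simp only [Nat.cast_zero, mul_zero]
      positivity
  · have hcC : (c : ℂ) ≠ 0 := by exact_mod_cast hc
    have hdet : (m 0 0 * m 1 1 - m 0 1 * m 1 0 : ℂ) ≠ 0 := by
      rw [Matrix.det_fin_two] at hm
      exact_mod_cast hm
    have hfac : ∀ i, (C (m 0 0 - θ i * m 1 0) * X + C (m 0 1 - θ i * m 1 1) : ℂ[X]) ≠ 0 := by
      intro i h
      have e0 := congrArg (fun p => coeff p 0) h
      have e1 := congrArg (fun p => coeff p 1) h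
      simp only [coeff_C_mul_X_add_C, coeff_zero, if_true, one_ne_zero, if_false] at e0 e1
      apply hdet
      linear_combination (m 1 1 : ℂ) * e1 - (m 1 0 : ℂ) * e0
    obtain ⟨j, hj⟩ : ∃ j, ∀ i, i ≠ j → (m 0 0 - θ i * m 1 0 : ℂ) ≠ 0 := by
      by_cases h : ∃ j, (m 0 0 - θ j * m 1 0 : ℂ) = 0
      · obtain ⟨j, hj⟩ := h
        refine ⟨j, fun i hij h => ?_⟩
        have h1 : (θ i - θ j) * m 1 0 = 0 := by linear_combination hj - h
        rcases mul_eq_zero.mp h1 with h2 | h2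
        · exact hij (hinj (sub_eq_zero.mp h2))
        · apply hdet
          rw [h2] at hj ⊢
          linear_combination (m 1 1 : ℂ) * hj
      · push Not at h
        exact ⟨⟨0, hn⟩, fun i _ => h i⟩
    have hdeg : ((glTranslate n f m).map (Int.castRingHom ℂ)).natDegree =
        ∑ i, (C (m 0 0 - θ i * m 1 0) * X + C (m 0 1 - θ i * m 1 1) : ℂ[X]).natDegree := by
      rw [hmap, natDegree_C_mul hcC, natDegree_prod _ _ fun i _ => hfac i]
    have hle : ((glTranslate n f m).map (Int.castRingHom ℂ)).natDegree ≤ n := by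
      rw [hdeg]
      refine (Finset.sum_le_card_nsmul _ _ 1 fun i _ => natDegree_linear_le).trans ?_
      simp
    have hge : n - 1 ≤ ((glTranslate n f m).map (Int.castRingHom ℂ)).natDegree := by
      rw [hdeg]
      calc n - 1 = ∑ i ∈ Finset.univ.erase j, 1 := by simp
        _ ≤ ∑ i ∈ Finset.univ.erase j,
            (C (m 0 0 - θ i * m 1 0) * X + C (m 0 1 - θ i * m 1 1) : ℂ[X]).natDegree :=
          Finset.sum_le_sum fun i hi => (natDegree_linear (hj i (Finset.ne_of_mem_erase hi))).ge
        _ ≤ _ := Finset.sum_le_sum_of_subset (Finset.erase_subset _ _)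
    obtain ⟨k, hk⟩ : ∃ k, k = ((glTranslate n f m).map (Int.castRingHom ℂ)).natDegree := ⟨_, rfl⟩
    have hne : (glTranslate n f m).coeff k ≠ 0 := by
      intro h
      have h0 : ((glTranslate n f m).map (Int.castRingHom ℂ)) ≠ 0 := by
        rw [hmap]
        exact mul_ne_zero (C_ne_zero.mpr hcC) (Finset.prod_ne_zero_iff.mpr fun i _ => hfac i)
      apply leadingCoeff_ne_zero.mpr h0
      rw [leadingCoeff, ← hk, coeff_map, h, map_zero]
    have h1 : (1 : ℝ) ≤ |((glTranslate n f m).coeff k : ℝ)| := by exact_mod_cast Int.one_le_abs hne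
    refine (h1.trans (hcoeff k)).trans ?_
    rw [← hk] at hle hge
    have hn1 : (1 : ℝ) ≤ n := by exact_mod_cast hn
    obtain rfl | rfl : k = n ∨ k = n - 1 := by omega
    · have e1 : b₁ ^ k = b₁ ^ (k - 1) * b₁ := by rw [← pow_succ, Nat.sub_add_cancel hn]
      rw [Nat.sub_self, pow_zero, Nat.choose_self, Nat.cast_one, mul_one, mul_one, e1]
      calc A * (b₁ ^ (k - 1) * b₁) ≤ 1 * (A * (b₁ ^ (k - 1) * b₂)) := by rw [one_mul]; gcongr
        _ ≤ k * (A * (b₁ ^ (k - 1) * b₂)) := by gcongr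
        _ = _ := by ring
    · have e1 : n.choose (n - 1) = n := by
        rw [Nat.choose_symm hn, Nat.choose_one_right]
      rw [e1, Nat.sub_sub_self hn, pow_one]
      exact le_of_eq (by ring)

end

section

open Polynomial

theorem crossRatio_sum_bound {ι : Type*} [Fintype ι] [DecidableEq ι] {L : ι → ι → ℝ}
    (hsymm : ∀ i j, L i j = L j i) (hdiag : ∀ i, L i i = 0) {M : ℝ}
    (hM : ∀ i j k l, i ≠ j → i ≠ k → i ≠ l → j ≠ k → j ≠ l → k ≠ l → L i j + L k l ≤ M + L i k + L j l)
    {i j : ι} (hij : i ≠ j) {n : ℕ} (hn : Fintype.card ι = n) :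
    (n - 1) * ((n - 2) * L i j - ∑ k, L i k - ∑ k, L j k) + ∑ k, ∑ l, L k l ≤ (n - 2) * (n - 3) * M := by
  obtain ⟨K, hK⟩ : ∃ K, K = (Finset.univ.erase i).erase j := ⟨_, rfl⟩
  have hjmem : j ∈ (Finset.univ : Finset ι).erase i := Finset.mem_erase.mpr ⟨hij.symm, Finset.mem_univ _⟩
  have hsum : ∀ g : ι → ℝ, ∑ k ∈ K, g k = ∑ k, g k - g i - g j := by
    intro g
    rw [hK, ← Finset.add_sum_erase _ g (Finset.mem_univ i), ← Finset.add_sum_erase _ g hjmem]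
    ring
  have hone : ∑ k ∈ K, (1 : ℝ) = n - 2 := by
    rw [hsum, ← hn, Finset.sum_const, Finset.card_univ]
    simp
    ring
  have hsum' : ∀ k ∈ K, ∀ g : ι → ℝ, ∑ l ∈ K.erase k, g l = ∑ l ∈ K, g l - g k := by
    intro k hk g
    rw [← Finset.add_sum_erase _ g hk]
    ring
  have h1 : ∑ k ∈ K, ∑ l ∈ K.erase k, (L i j + L k l) ≤
      ∑ k ∈ K, ∑ l ∈ K.erase k, (M + L i k + L j l) := by
    refine Finset.sum_le_sum fun k hk => Finset.sum_le_sum fun l hl => ?_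
    rw [Finset.mem_erase] at hl
    obtain ⟨hkl, hl⟩ := hl
    rw [hK, Finset.mem_erase, Finset.mem_erase] at hk hl
    exact hM i j k l hij hk.2.1.symm hl.2.1.symm hk.1.symm hl.1.symm hkl.symm
  have hconst : ∀ x : ℝ, ∑ k ∈ K, x = (n - 2) * x := fun x => by
    rw [← hone, Finset.sum_mul]
    simp only [one_mul]
  have e1 : ∑ k ∈ K, ∑ l ∈ K.erase k, (L i j + L k l) =
      (n - 2) * (n - 3) * L i j + (∑ k, ∑ l, L k l - 2 * ∑ k, L i k - 2 * ∑ k, L j k + 2 * L i j) := by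
    have : ∀ k ∈ K, ∑ l ∈ K.erase k, (L i j + L k l) =
        (n - 3) * L i j + (∑ l, L k l - L i k - L j k) := by
      intro k hk
      rw [hsum' k hk, Finset.sum_add_distrib, hconst, hsum, hdiag, hsymm k i, hsymm k j]
      ring
    rw [Finset.sum_congr rfl this, Finset.sum_add_distrib, hconst, hsum]
    simp only [Finset.sum_sub_distrib, hdiag, hsymm j i]
    ring
  have e2 : ∑ k ∈ K, ∑ l ∈ K.erase k, (M + L i k + L j l) =
      (n - 2) * (n - 3) * M + (n - 3) * (∑ k, L i k + ∑ k, L j k - 2 * L i j) := by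
    have : ∀ k ∈ K, ∑ l ∈ K.erase k, (M + L i k + L j l) =
        (n - 3) * M + (n - 3) * L i k + (∑ l, L j l - L i j) - L j k := by
      intro k hk
      rw [hsum' k hk, Finset.sum_add_distrib, hconst, hsum, hdiag, hsymm j i]
      ring
    rw [Finset.sum_congr rfl this, Finset.sum_sub_distrib, Finset.sum_add_distrib,
      Finset.sum_add_distrib, hconst, hconst, ← Finset.mul_sum, hsum, hsum]
    simp only [hdiag, hsymm j i]
    ring
  rw [e1, e2] at h1
  linarith

theorem two_mul_sum_sq_mul_sum_norm_sq {ι : Type*} [Fintype ι] (v : ι → ℝ) (θ : ι → ℂ) :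
    2 * ((∑ i, v i) * (∑ i, v i * ‖θ i‖ ^ 2) - (∑ i, v i * (θ i).re) ^ 2 - (∑ i, v i * (θ i).im) ^ 2) =
      ∑ i, ∑ j, v i * v j * ‖θ i - θ j‖ ^ 2 := by
  have h : ∀ i j, v i * v j * ‖θ i - θ j‖ ^ 2 = (v i * ‖θ i‖ ^ 2) * v j + v i * (v j * ‖θ j‖ ^ 2) -
      2 * ((v i * (θ i).re) * (v j * (θ j).re)) - 2 * ((v i * (θ i).im) * (v j * (θ j).im)) := by
    intro i j
    rw [← Complex.normSq_eq_norm_sq, ← Complex.normSq_eq_norm_sq, ← Complex.normSq_eq_norm_sq,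
      Complex.normSq_apply, Complex.normSq_apply, Complex.normSq_apply, Complex.sub_re, Complex.sub_im]
    ring
  simp only [h, Finset.sum_sub_distrib, Finset.sum_add_distrib, ← Finset.mul_sum, ← Finset.sum_mul]
  ring

theorem le_of_product_bounds {A s b₁ b₂ : ℝ} {n : ℕ} (hn : 3 ≤ n) (hA : 1 ≤ A) (hs : 1 ≤ s) (hb1 : 0 ≤ b₁)
    (hb2 : 0 ≤ b₂) (hb : b₁ * b₂ ≤ s) (h : 1 ≤ n * A * b₁ ^ (n - 1) * b₂) : b₂ ≤ n * A * s ^ 2 := by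
  have hn1 : (1 : ℝ) ≤ n := by exact_mod_cast (by omega : 1 ≤ n)
  have hnA : 1 ≤ n * A := one_le_mul_of_one_le_of_one_le hn1 hA
  have hpow : b₁ ^ (n - 1) = b₁ ^ (n - 2) * b₁ := by
    rw [← pow_succ]
    congr 1
    omega
  have h1 : 1 ≤ n * A * s * b₁ ^ (n - 2) := by
    calc 1 ≤ n * A * b₁ ^ (n - 1) * b₂ := h
      _ = n * A * b₁ ^ (n - 2) * (b₁ * b₂) := by rw [hpow]; ring
      _ ≤ n * A * b₁ ^ (n - 2) * s := by gcongr
      _ = _ := by ring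
  have h2 : 1 ≤ n * A * s * b₁ := by
    rcases le_total 1 b₁ with h3 | h3
    · exact one_le_mul_of_one_le_of_one_le (one_le_mul_of_one_le_of_one_le hnA hs) h3
    · refine h1.trans ?_
      gcongr
      exact pow_le_of_le_one hb1 h3 (by omega)
  calc b₂ ≤ n * A * s * b₁ * b₂ := le_mul_of_one_le_left hb2 h2
    _ = n * A * s * (b₁ * b₂) := by ring
    _ ≤ n * A * s * s := by gcongr
    _ = _ := by ring

variable {n : ℕ} {θ : Fin n → ℂ}

theorem exists_involutive_conj {f : ℤ[X]} {c : ℤ} (hc : c ≠ 0)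
    (hf : f.map (Int.castRingHom ℂ) = C (c : ℂ) * ∏ i, (X - C (θ i))) (hinj : Function.Injective θ) :
    ∃ σ : Fin n → Fin n, Function.Involutive σ ∧ ∀ i, θ (σ i) = starRingEnd ℂ (θ i) := by
  have h : ∀ i, ∃ j, starRingEnd ℂ (θ i) = θ j := fun i =>
    exists_embedding_eq hc hf (RingHom.id ℂ) (starRingEnd ℂ) rfl
  choose σ hσ using h
  refine ⟨σ, fun i => hinj ?_, fun i => (hσ i).symm⟩
  rw [← hσ, ← hσ, Complex.conj_conj]

theorem exists_glTranslate_coeff_le {f : ℤ[X]} {c D : ℤ} (hc : c ≠ 0) (hD : D ≠ 0)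
    (hf : f.map (Int.castRingHom ℂ) = C (c : ℂ) * ∏ i, (X - C (θ i))) (hinj : Function.Injective θ)
    (hlogD : Real.log |(D : ℝ)| = (2 * n - 2) * Real.log |(c : ℝ)| + ∑ i, ∑ j, Real.log ‖θ i - θ j‖)
    (hn : 3 ≤ n) {M : ℝ} (hM0 : 0 ≤ M)
    (hM : ∀ q : Fin 4 → Fin n, Function.Injective q → logCrossRatio θ q ≤ M) :
    ∃ m : Matrix (Fin 2) (Fin 2) ℤ, IsUnit m.det ∧ ∀ k,
      |((glTranslate n f m).coeff k : ℝ)| ≤ 2 ^ n * |(D : ℝ)| * (n * |(D : ℝ)| * (n * Real.exp M) ^ 2) ^ n := by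
  have hD1 : (1 : ℝ) ≤ |(D : ℝ)| := by exact_mod_cast Int.one_le_abs hD
  have hc0 : 0 < |(c : ℝ)| := by positivity
  have hlog0 : 0 ≤ Real.log |(D : ℝ)| := Real.log_nonneg hD1
  have hn3 : (3 : ℝ) ≤ n := by exact_mod_cast hn
  have hn2 : (0 : ℝ) < n - 2 := by linarith
  obtain ⟨L, hL⟩ : ∃ L : Fin n → Fin n → ℝ, ∀ i j, L i j = Real.log ‖θ i - θ j‖ := ⟨_, fun _ _ => rfl⟩
  obtain ⟨ℓ, hℓ⟩ : ∃ ℓ, ℓ = Real.log |(c : ℝ)| := ⟨_, rfl⟩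
  have hsymm : ∀ i j, L i j = L j i := fun i j => by rw [hL, hL, norm_sub_rev]
  have hdiag : ∀ i, L i i = 0 := fun i => by rw [hL, sub_self, norm_zero, Real.log_zero]
  simp only [← hL, ← hℓ] at hlogD
  obtain ⟨u, hu⟩ : ∃ u : Fin n → ℝ, ∀ i, u i = -(ℓ + ∑ j, L i j) / (n - 2) := ⟨_, fun _ => rfl⟩
  obtain ⟨w, hw⟩ : ∃ w : Fin n → ℝ, ∀ i, w i = Real.exp (u i) := ⟨_, fun _ => rfl⟩
  have hwpos : ∀ i, 0 < w i := fun i => by rw [hw]; exact Real.exp_pos _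
  have hpair : ∀ i j, w i * w j * ‖θ i - θ j‖ ≤ Real.exp M := by
    intro i j
    rcases eq_or_ne i j with rfl | hij
    · rw [sub_self, norm_zero, mul_zero]
      exact (Real.exp_pos _).le
    have h1 := crossRatio_sum_bound hsymm hdiag (M := M) (fun i j k l hij hik hil hjk hjl hkl => by
      have h2 := hM ![i, j, l, k] (by
        intro x y hxy
        fin_cases x <;> fin_cases y <;> simp_all [Ne.symm])
      simp only [logCrossRatio, Matrix.cons_val] at h2
      rw [hL, hL, hL, hL]
      rw [norm_sub_rev (θ l)] at h2
      linarith) hij (Fintype.card_fin n)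
    have h3 : L i j + u i + u j ≤ M := by
      have h4 : (n - 2) * (L i j + u i + u j) = (n - 2) * L i j - ∑ k, L i k - ∑ k, L j k - 2 * ℓ := by
        rw [hu, hu]
        field_simp
        ring
      have h5 : (n - 1) * ((n - 2) * (L i j + u i + u j)) ≤ (n - 2) * (n - 3) * M := by
        rw [h4]
        linarith
      have h6 : (n - 2) * (n - 3) * M ≤ (n - 1) * ((n - 2) * M) := by nlinarith [mul_nonneg hn2.le hM0]
      have h7 := le_of_mul_le_mul_left (h5.trans h6) (by linarith)
      exact le_of_mul_le_mul_left h7 hn2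
    have h8 : 0 < ‖θ i - θ j‖ := norm_pos_iff.mpr (sub_ne_zero.mpr (hinj.ne hij))
    rw [hw, hw, ← Real.exp_log h8, ← hL, ← Real.exp_add, ← Real.exp_add]
    exact Real.exp_le_exp.mpr (by linarith)
  obtain ⟨A, hA⟩ : ∃ A, A = |(c : ℝ)| / ∏ i, w i := ⟨_, rfl⟩
  have hAexp : A = Real.exp (Real.log |(D : ℝ)| / (n - 2)) := by
    rw [hA]
    simp only [hw]
    rw [← Real.exp_sum, ← Real.exp_log hc0, ← Real.exp_sub, ← hℓ]
    congr 1
    simp only [hu]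
    rw [← Finset.sum_div, Finset.sum_neg_distrib, Finset.sum_add_distrib, hlogD, Finset.sum_const,
      Finset.card_univ, Fintype.card_fin, nsmul_eq_mul]
    field_simp
    ring
  have hA1 : 1 ≤ A := by
    rw [hAexp]
    exact Real.one_le_exp (by positivity)
  have hAD : A ≤ |(D : ℝ)| := by
    rw [hAexp, ← Real.exp_log (zero_lt_one.trans_le hD1)]
    refine Real.exp_le_exp.mpr ?_
    rw [Real.log_exp]
    exact div_le_self hlog0 (by linarith)
  obtain ⟨σ, hσ, hσθ⟩ := exists_involutive_conj hc hf hinj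
  have hLσ : ∀ i j, L (σ i) (σ j) = L i j := by
    intro i j
    rw [hL, hL, hσθ, hσθ, ← map_sub, RCLike.norm_conj]
  have huσ : ∀ i, u (σ i) = u i := by
    intro i
    rw [hu, hu, ← Equiv.sum_comp hσ.toPerm (L (σ i))]
    simp only [Function.Involutive.coe_toPerm, hLσ]
  have him : ∑ i, w i ^ 2 * (θ i).im = 0 := by
    have h1 : ∑ i, w i ^ 2 * (θ i).im = -∑ i, w i ^ 2 * (θ i).im := by
      conv_lhs => rw [← Equiv.sum_comp hσ.toPerm]
      rw [← Finset.sum_neg_distrib]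
      refine Finset.sum_congr rfl fun i _ => ?_
      rw [Function.Involutive.coe_toPerm, hw, huσ, ← hw, hσθ, Complex.conj_im]
      ring
    linarith
  have hdet := two_mul_sum_sq_mul_sum_norm_sq (fun i => w i ^ 2) θ
  rw [him] at hdet
  have hterm : ∀ i j, w i ^ 2 * w j ^ 2 * ‖θ i - θ j‖ ^ 2 = (w i * w j * ‖θ i - θ j‖) ^ 2 := by
    intros; ring
  simp only [hterm] at hdet
  have hdet_le : ∑ i, ∑ j, (w i * w j * ‖θ i - θ j‖) ^ 2 ≤ n ^ 2 * Real.exp M ^ 2 := by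
    calc ∑ i, ∑ j, (w i * w j * ‖θ i - θ j‖) ^ 2 ≤ ∑ i : Fin n, ∑ j : Fin n, Real.exp M ^ 2 := by
          refine Finset.sum_le_sum fun i _ => Finset.sum_le_sum fun j _ => ?_
          have := (hwpos i).le
          have := (hwpos j).le
          exact pow_le_pow_left₀ (by positivity) (hpair i j) 2
      _ = _ := by simp; ring
  have hdet_pos : 0 < ∑ i, ∑ j, (w i * w j * ‖θ i - θ j‖) ^ 2 := by
    refine Finset.sum_pos' (fun i _ => Finset.sum_nonneg fun j _ => sq_nonneg _)
      ⟨⟨0, by omega⟩, Finset.mem_univ _, ?_⟩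
    refine Finset.sum_pos' (fun j _ => sq_nonneg _) ⟨⟨1, by omega⟩, Finset.mem_univ _, ?_⟩
    have h1 : 0 < ‖θ ⟨0, by omega⟩ - θ ⟨1, by omega⟩‖ :=
      norm_pos_iff.mpr (sub_ne_zero.mpr (hinj.ne (by simp)))
    have := hwpos ⟨0, by omega⟩
    have := hwpos ⟨1, by omega⟩
    positivity
  obtain ⟨a, ha⟩ : ∃ a, a = ∑ i, w i ^ 2 := ⟨_, rfl⟩
  obtain ⟨b, hb⟩ : ∃ b, b = ∑ i, w i ^ 2 * (θ i).re := ⟨_, rfl⟩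
  obtain ⟨e, he⟩ : ∃ e, e = ∑ i, w i ^ 2 * ‖θ i‖ ^ 2 := ⟨_, rfl⟩
  have ha0 : 0 < a := by
    rw [ha]
    exact Finset.sum_pos (fun i _ => pow_pos (hwpos i) 2) ⟨⟨0, by omega⟩, Finset.mem_univ _⟩
  rw [← ha, ← hb, ← he] at hdet
  have hQ : ∀ x y : ℝ, a * x ^ 2 - 2 * b * x * y + e * y ^ 2 =
      ∑ i, (w i * ‖((x : ℂ) - θ i * (y : ℂ))‖) ^ 2 := by
    intro x y
    have h1 : ∀ i, (w i * ‖((x : ℂ) - θ i * (y : ℂ))‖) ^ 2 = w i ^ 2 * x ^ 2 -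
        2 * (w i ^ 2 * (θ i).re) * x * y + w i ^ 2 * ‖θ i‖ ^ 2 * y ^ 2 := by
      intro i
      rw [mul_pow, ← Complex.normSq_eq_norm_sq, ← Complex.normSq_eq_norm_sq, Complex.normSq_apply,
        Complex.normSq_apply]
      simp
      ring
    simp only [h1, Finset.sum_sub_distrib, Finset.sum_add_distrib, ← Finset.mul_sum, ← Finset.sum_mul,
      ha, hb, he]
  obtain ⟨x, y, z, t, hdet1, hle, hprod⟩ := exists_reduced_basis (b := b) (c := e) ha0 (by linarith)
  rw [hQ, hQ] at hle hprod
  obtain ⟨m, hm⟩ : ∃ m : Matrix (Fin 2) (Fin 2) ℤ, m = !![x, y; z, t] := ⟨_, rfl⟩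
  have hmdet : m.det = 1 := by rw [hm, Matrix.det_fin_two_of, hdet1]
  have hsqrt : ∀ (x y : ℤ) (i : Fin n), w i * ‖(x - θ i * y : ℂ)‖ ≤
      √(∑ i, (w i * ‖(((x : ℝ) : ℂ) - θ i * ((y : ℝ) : ℂ))‖) ^ 2) := by
    intro x y i
    refine Real.le_sqrt_of_sq_le ?_
    exact Finset.single_le_sum (f := fun i => (w i * ‖(((x : ℝ) : ℂ) - θ i * ((y : ℝ) : ℂ))‖) ^ 2)
      (fun j _ => sq_nonneg _) (Finset.mem_univ i)
  have hbounds := glTranslate_coeff_bounds hc hf hinj m (by rw [hmdet]; exact one_ne_zero) hwpos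
    (Real.sqrt_le_sqrt hle) (fun i => by rw [hm]; exact hsqrt x z i)
    (fun i => by rw [hm]; exact hsqrt y t i) (by omega)
  rw [← hA] at hbounds
  obtain ⟨b₁, hb1⟩ : ∃ b₁, b₁ = √(∑ i, (w i * ‖(((x : ℝ) : ℂ) - θ i * ((z : ℝ) : ℂ))‖) ^ 2) := ⟨_, rfl⟩
  obtain ⟨b₂, hb2⟩ : ∃ b₂, b₂ = √(∑ i, (w i * ‖(((y : ℝ) : ℂ) - θ i * ((t : ℝ) : ℂ))‖) ^ 2) := ⟨_, rfl⟩
  rw [← hb1, ← hb2] at hbounds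
  have hb12 : b₁ * b₂ ≤ n * Real.exp M := by
    rw [hb1, hb2, ← Real.sqrt_mul (Finset.sum_nonneg fun j _ => sq_nonneg _)]
    refine Real.sqrt_le_iff.mpr ⟨by positivity, hprod.trans ?_⟩
    rw [mul_pow]
    nlinarith
  have hs : 1 ≤ n * Real.exp M := one_le_mul_of_one_le_of_one_le (by linarith) (Real.one_le_exp hM0)
  have hb20 : 0 ≤ b₂ := by rw [hb2]; exact Real.sqrt_nonneg _
  have hb2le := le_of_product_bounds hn hA1 hs (by rw [hb1]; exact Real.sqrt_nonneg _) hb20 hb12 hbounds.2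
  refine ⟨m, by rw [hmdet]; exact isUnit_one, fun k => (hbounds.1 k).trans ?_⟩
  gcongr
  refine hb2le.trans ?_
  gcongr

end

section

open Polynomial

theorem glTranslate_two_eq (f : ℤ[X]) (m : Matrix (Fin 2) (Fin 2) ℤ) :
    glTranslate 2 f m =
      C (f.coeff 2 * m 0 0 ^ 2 + f.coeff 1 * m 0 0 * m 1 0 + f.coeff 0 * m 1 0 ^ 2) * X ^ 2 +
      C (2 * f.coeff 2 * m 0 0 * m 0 1 + f.coeff 1 * (m 0 0 * m 1 1 + m 0 1 * m 1 0) +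
        2 * f.coeff 0 * m 1 0 * m 1 1) * X +
      C (f.coeff 2 * m 0 1 ^ 2 + f.coeff 1 * m 0 1 * m 1 1 + f.coeff 0 * m 1 1 ^ 2) := by
  simp only [glTranslate, Finset.sum_range_succ, Finset.sum_range_zero, map_add, map_mul, map_pow]
  norm_num
  ring

theorem exists_reduced_integral_quadratic {a b c : ℤ} (hD : b ^ 2 - 4 * a * c ≠ 0) :
    ∃ x y z w : ℤ, x * w - y * z = 1 ∧
      |a * x ^ 2 + b * x * z + c * z ^ 2| ≤ |b ^ 2 - 4 * a * c| ∧
      |2 * a * x * y + b * (x * w + y * z) + 2 * c * z * w| ≤ |b ^ 2 - 4 * a * c| ∧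
      |a * y ^ 2 + b * y * w + c * w ^ 2| ≤ |b ^ 2 - 4 * a * c| := by
  obtain ⟨S, hS⟩ : ∃ S : Set ℕ, S = {N | ∃ x y z w : ℤ, x * w - y * z = 1 ∧
    (2 * a * x * y + b * (x * w + y * z) + 2 * c * z * w).natAbs = N} := ⟨_, rfl⟩
  have hne : S.Nonempty := by
    rw [hS]
    exact ⟨_, 1, 0, 0, 1, by norm_num, rfl⟩
  have hmem := Nat.sInf_mem hne
  have hmin : ∀ x y z w : ℤ, x * w - y * z = 1 →
      sInf S ≤ (2 * a * x * y + b * (x * w + y * z) + 2 * c * z * w).natAbs := fun x y z w h => by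
    refine Nat.sInf_le ?_
    rw [hS]
    exact ⟨x, y, z, w, h, rfl⟩
  obtain ⟨N, hN⟩ : ∃ N, N = sInf S := ⟨_, rfl⟩
  rw [← hN] at hmem hmin
  rw [hS] at hmem
  obtain ⟨x, y, z, w, hdet, hxyzw⟩ := hmem
  have hmin' : ∀ x' y' z' w' : ℤ, x' * w' - y' * z' = 1 →
      |2 * a * x * y + b * (x * w + y * z) + 2 * c * z * w| ≤
        |2 * a * x' * y' + b * (x' * w' + y' * z') + 2 * c * z' * w'| := by
    intro x' y' z' w' h
    have := hmin x' y' z' w' h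
    rw [← hxyzw] at this
    rw [Int.abs_eq_natAbs, Int.abs_eq_natAbs]
    exact_mod_cast this
  obtain ⟨A, hA⟩ : ∃ A, A = a * x ^ 2 + b * x * z + c * z ^ 2 := ⟨_, rfl⟩
  obtain ⟨B, hB⟩ : ∃ B, B = 2 * a * x * y + b * (x * w + y * z) + 2 * c * z * w := ⟨_, rfl⟩
  obtain ⟨E, hE⟩ : ∃ E, E = a * y ^ 2 + b * y * w + c * w ^ 2 := ⟨_, rfl⟩
  have hdisc : B ^ 2 - 4 * A * E = b ^ 2 - 4 * a * c := by
    have : B ^ 2 - 4 * A * E = (b ^ 2 - 4 * a * c) * (x * w - y * z) ^ 2 := by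
      rw [hA, hB, hE]; ring
    rw [this, hdet]; ring
  have hBA : ∀ k : ℤ, |B| ≤ |B + 2 * A * k| := by
    intro k
    have := hmin' x (y + k * x) z (w + k * z) (by linear_combination hdet)
    rw [← hB] at this
    convert this using 2
    rw [hA, hB]; ring
  have hBE : ∀ k : ℤ, |B| ≤ |B + 2 * E * k| := by
    intro k
    have := hmin' (x + k * y) y (z + k * w) w (by linear_combination hdet)
    rw [← hB] at this
    convert this using 2
    rw [hE, hB]; ring
  rw [← hdisc]
  have habs : ∀ {V : ℤ}, V ≠ 0 → (∀ k : ℤ, |B| ≤ |B + 2 * V * k|) → |B| ≤ |V| := by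
    intro V hV h
    have h1 := h 1
    have h2 := h (-1)
    rcases abs_cases B with ⟨e1, _⟩ | ⟨e1, _⟩ <;> rcases abs_cases V with ⟨e2, _⟩ | ⟨e2, _⟩ <;>
      rcases abs_cases (B + 2 * V * 1) with ⟨e3, _⟩ | ⟨e3, _⟩ <;>
      rcases abs_cases (B + 2 * V * -1) with ⟨e4, _⟩ | ⟨e4, _⟩ <;> omega
  rw [← hdisc] at hD
  have hBB : B ≠ 0 → |B| ≤ |B ^ 2| := by
    intro hB0
    rw [abs_pow]
    nlinarith [Int.one_le_abs hB0]
  have hmod : ∀ V : ℤ, B ≠ 0 → |V - B * (V / B)| ≤ |B| := by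
    intro V hB0
    rw [← Int.emod_def, abs_of_nonneg (Int.emod_nonneg V hB0)]
    exact (Int.emod_lt_abs V hB0).le
  by_cases hA0 : A = 0
  · have hB0 : B ≠ 0 := by
      rintro rfl
      exact hD (by rw [hA0]; ring)
    have hm := hmod E hB0
    generalize E / B = k at hm
    have e : B ^ 2 - 4 * A * E = B ^ 2 := by rw [hA0]; ring
    rw [e]
    refine ⟨x, y - k * x, z, w - k * z, by linear_combination hdet, ?_, ?_, ?_⟩
    · rw [← hA, hA0, abs_zero]; exact abs_nonneg _
    · have : 2 * a * x * (y - k * x) + b * (x * (w - k * z) + (y - k * x) * z) +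
          2 * c * z * (w - k * z) = B := by linear_combination -hB + 2 * k * hA - 2 * k * hA0
      rw [this]
      exact hBB hB0
    · have : a * (y - k * x) ^ 2 + b * (y - k * x) * (w - k * z) + c * (w - k * z) ^ 2 =
          E - B * k := by linear_combination -hE + k * hB - k ^ 2 * hA + k ^ 2 * hA0
      rw [this]
      exact hm.trans (hBB hB0)
  by_cases hE0 : E = 0
  · have hB0 : B ≠ 0 := by
      rintro rfl
      exact hD (by rw [hE0]; ring)
    have hm := hmod A hB0
    generalize A / B = k at hm
    have e : B ^ 2 - 4 * A * E = B ^ 2 := by rw [hE0]; ring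
    rw [e]
    refine ⟨x - k * y, y, z - k * w, w, by linear_combination hdet, ?_, ?_, ?_⟩
    · have : a * (x - k * y) ^ 2 + b * (x - k * y) * (z - k * w) + c * (z - k * w) ^ 2 =
          A - B * k := by linear_combination -hA + k * hB - k ^ 2 * hE + k ^ 2 * hE0
      rw [this]
      exact hm.trans (hBB hB0)
    · have : 2 * a * (x - k * y) * y + b * ((x - k * y) * w + y * (z - k * w)) +
          2 * c * (z - k * w) * w = B := by linear_combination -hB + 2 * k * hE - 2 * k * hE0
      rw [this]
      exact hBB hB0
    · rw [← hE, hE0, abs_zero]; exact abs_nonneg _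
  have hBA' := habs hA0 hBA
  have hBE' := habs hE0 hBE
  have h1 := Int.one_le_abs hA0
  have h2 := Int.one_le_abs hE0
  have h3 : 3 * (|A| * |E|) ≤ |B ^ 2 - 4 * A * E| := by
    have h4 : |4 * A * E| ≤ |B ^ 2 - 4 * A * E| + |B ^ 2| := by
      have := abs_sub (B ^ 2) (B ^ 2 - 4 * A * E)
      rw [show B ^ 2 - (B ^ 2 - 4 * A * E) = 4 * A * E by ring] at this
      linarith
    rw [abs_mul, abs_mul, abs_pow] at h4
    have h5 : |B| ^ 2 ≤ |A| * |E| := by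
      rw [sq]
      exact mul_le_mul hBA' hBE' (abs_nonneg _) (abs_nonneg _)
    have h6 : |(4 : ℤ)| = 4 := rfl
    rw [h6] at h4
    linarith
  refine ⟨x, y, z, w, hdet, ?_, ?_, ?_⟩
  · rw [← hA]; nlinarith
  · rw [← hB]; nlinarith
  · rw [← hE]; nlinarith

theorem exists_glTranslate_two_coeff_le {f : ℤ[X]} {D : ℤ} (hD : D ≠ 0)
    (hdisc : f.coeff 1 ^ 2 - 4 * f.coeff 2 * f.coeff 0 = D) :
    ∃ m : Matrix (Fin 2) (Fin 2) ℤ, IsUnit m.det ∧ ∀ k, |(glTranslate 2 f m).coeff k| ≤ |D| := by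
  rw [← hdisc] at hD ⊢
  obtain ⟨x, y, z, w, hdet, h2, h1, h0⟩ := exists_reduced_integral_quadratic hD
  refine ⟨!![x, y; z, w], by rw [Matrix.det_fin_two_of, hdet]; exact isUnit_one, fun k => ?_⟩
  rw [glTranslate_two_eq]
  simp only [coeff_add, coeff_C_mul, coeff_X_pow, coeff_X, coeff_C]
  rcases k with _ | _ | _ | k
  · simpa using h0
  · simpa using h1
  · simpa using h2
  · simp

end

section

open Polynomial

theorem exists_roots_of_discC {f : ℤ[X]} {n : ℕ} (hfn : f.natDegree = n) {D : ℤ} (hdisc : discC f = D) :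
    ∃ θ : Fin n → ℂ, f.map (Int.castRingHom ℂ) = C (f.leadingCoeff : ℂ) * ∏ i, (X - C (θ i)) ∧
      (D : ℂ) = (f.leadingCoeff : ℂ) ^ (2 * n - 2) *
        ∏ i, ∏ j, if i < j then (θ i - θ j) ^ 2 else 1 := by
  have hinj : Function.Injective (Int.castRingHom ℂ) := Int.cast_injective
  have hcard : Multiset.card (f.map (Int.castRingHom ℂ)).roots = (f.map (Int.castRingHom ℂ)).natDegree :=
    (IsAlgClosed.splits _).natDegree_eq_card_roots.symm
  have hlen : (rootList f).length = n := by
    rw [rootList, Multiset.length_toList, hcard, natDegree_map_eq_of_injective hinj, hfn]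
  subst hlen
  refine ⟨(rootList f).get, ?_, ?_⟩
  · have h1 := C_leadingCoeff_mul_prod_multiset_X_sub_C hcard
    rw [leadingCoeff_map_of_injective hinj] at h1
    rw [← h1]
    congr 1
    have h2 : (f.map (Int.castRingHom ℂ)).roots = (rootList f : Multiset ℂ) :=
      (Multiset.coe_toList _).symm
    rw [h2, Multiset.map_coe, Multiset.prod_coe]
    simp only [List.get_eq_getElem]
    rw [Fin.prod_univ_fun_getElem (rootList f) (fun z => X - C z)]
  · rw [← hdisc, discC, hfn, Fintype.prod_prod_type]
    rfl

variable {n : ℕ} {θ : Fin n → ℂ}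

theorem det_vandermonde_sq_eq (θ : Fin n → ℂ) :
    (Matrix.vandermonde θ).det ^ 2 = ∏ i, ∏ j, if i < j then (θ i - θ j) ^ 2 else 1 := by
  rw [Matrix.det_vandermonde, ← Finset.prod_pow]
  refine Finset.prod_congr rfl fun i _ => ?_
  rw [← Finset.prod_pow, ← Finset.prod_filter]
  refine Finset.prod_congr (by ext; simp) fun j _ => ?_
  ring

theorem log_norm_prod_sq (hinj : Function.Injective θ) :
    Real.log ‖∏ i, ∏ j, if i < j then (θ i - θ j) ^ 2 else 1‖ = ∑ i, ∑ j, Real.log ‖θ i - θ j‖ := by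
  have hne : ∀ i j, ‖if i < j then (θ i - θ j) ^ 2 else 1‖ ≠ 0 := by
    intro i j
    rw [norm_ne_zero_iff]
    split_ifs with h
    · exact pow_ne_zero _ (sub_ne_zero.mpr (hinj.ne h.ne))
    · exact one_ne_zero
  simp only [norm_prod]
  rw [Real.log_prod fun i _ => Finset.prod_ne_zero_iff.mpr fun j _ => hne i j]
  simp only [Real.log_prod fun j _ => hne _ j]
  have h1 : ∀ i j, Real.log ‖θ i - θ j‖ = (if i < j then Real.log ‖θ i - θ j‖ else 0) +
      if j < i then Real.log ‖θ i - θ j‖ else 0 := by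
    intro i j
    rcases lt_trichotomy i j with h | rfl | h
    · simp [h, h.not_gt]
    · simp
    · simp [h, h.not_gt]
  have h2 : ∀ i j, Real.log ‖if i < j then (θ i - θ j) ^ 2 else 1‖ =
      (if i < j then Real.log ‖θ i - θ j‖ else 0) + if i < j then Real.log ‖θ j - θ i‖ else 0 := by
    intro i j
    split_ifs
    · rw [norm_pow, Real.log_pow, norm_sub_rev (θ j)]
      push_cast
      ring
    · simp
  rw [Finset.sum_congr rfl fun i _ => Finset.sum_congr rfl fun j _ => h1 i j]
  simp only [h2, Finset.sum_add_distrib]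
  congr 1
  exact Finset.sum_comm

theorem injective_of_prod_sq_ne_zero
    (h : ∏ i, ∏ j, (if i < j then (θ i - θ j) ^ 2 else 1) ≠ 0) : Function.Injective θ := by
  intro i j hij
  by_contra hne
  have h1 : ∀ i j : Fin n, i < j → θ i ≠ θ j := by
    intro i j hlt heq
    refine h (Finset.prod_eq_zero (Finset.mem_univ i) (Finset.prod_eq_zero (Finset.mem_univ j) ?_))
    rw [if_pos hlt, heq, sub_self]
    simp
  rcases lt_or_gt_of_ne hne with hlt | hlt
  · exact h1 i j hlt hij
  · exact h1 j i hlt hij.symm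

theorem isIntegral_rat_of_map_eq {f : ℤ[X]} {c : ℤ} (hc : c ≠ 0)
    (hf : f.map (Int.castRingHom ℂ) = C (c : ℂ) * ∏ i, (X - C (θ i))) (i : Fin n) : IsIntegral ℚ (θ i) := by
  have hcC : (c : ℂ) ≠ 0 := by exact_mod_cast hc
  refine (IsAlgebraic.isIntegral ⟨f.map (Int.castRingHom ℚ), fun h0 => ?_, ?_⟩)
  · have h1 : f.map (Int.castRingHom ℂ) = (f.map (Int.castRingHom ℚ)).map (algebraMap ℚ ℂ) := by
      rw [Polynomial.map_map]
      congr 1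
    rw [h0, Polynomial.map_zero, hf] at h1
    exact mul_ne_zero (C_ne_zero.mpr hcC)
      (Finset.prod_ne_zero_iff.mpr fun i _ => X_sub_C_ne_zero _) h1
  · have h1 : aeval (θ i) (f.map (Int.castRingHom ℚ)) = eval (θ i) (f.map (Int.castRingHom ℂ)) := by
      rw [aeval_def, ← eval_map, Polynomial.map_map]
      congr 2
    rw [h1, hf, eval_mul, eval_prod, Finset.prod_eq_zero (Finset.mem_univ i) (by simp), mul_zero]

theorem coeff_disc_eq {f : ℤ[X]} {c D : ℤ} {θ : Fin 2 → ℂ}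
    (hf : f.map (Int.castRingHom ℂ) = C (c : ℂ) * ∏ i, (X - C (θ i)))
    (hdisc : (D : ℂ) = (c : ℂ) ^ (2 * 2 - 2) * ∏ i, ∏ j, if i < j then (θ i - θ j) ^ 2 else 1) :
    f.coeff 1 ^ 2 - 4 * f.coeff 2 * f.coeff 0 = D := by
  have h : f.map (Int.castRingHom ℂ) =
      C (c : ℂ) * X ^ 2 + C (-(c * (θ 0 + θ 1))) * X + C (c * (θ 0 * θ 1)) := by
    rw [hf, Fin.prod_univ_two]
    simp only [map_add, map_mul, map_neg]
    ring
  have hk : ∀ k, (f.coeff k : ℂ) = (f.map (Int.castRingHom ℂ)).coeff k := fun k => by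
    rw [coeff_map, eq_intCast]
  have h0 : (f.coeff 0 : ℂ) = c * (θ 0 * θ 1) := by
    rw [hk, h, coeff_add, coeff_add, coeff_C_mul, coeff_C_mul, coeff_X_pow, coeff_X, coeff_C]; simp
  have h1 : (f.coeff 1 : ℂ) = -(c * (θ 0 + θ 1)) := by
    rw [hk, h, coeff_add, coeff_add, coeff_C_mul, coeff_C_mul, coeff_X_pow, coeff_X, coeff_C]; simp
  have h2 : (f.coeff 2 : ℂ) = c := by
    rw [hk, h, coeff_add, coeff_add, coeff_C_mul, coeff_C_mul, coeff_X_pow, coeff_X, coeff_C]; simp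
  have h3 : ((f.coeff 1 ^ 2 - 4 * f.coeff 2 * f.coeff 0 : ℤ) : ℂ) = (D : ℤ) := by
    push_cast
    rw [h0, h1, h2, hdisc]
    simp [Fin.prod_univ_two]
    ring
  exact_mod_cast h3

end

section

theorem mul_log_pow_mul_pow_le {n : ℕ} (hn : 4 ≤ n) :
    12 * (n : ℝ) ^ 4 * Real.log (2 ^ 25 * (n : ℝ) ^ 18) ≤ 160 * (n : ℝ) ^ 5 := by
  have hn4 : (4 : ℝ) ≤ n := by exact_mod_cast hn
  have hn0 : (0 : ℝ) < n := by linarith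
  have h1 : Real.log n ≤ n / 4 - 1 + 2 * Real.log 2 := by
    have h2 := Real.log_le_sub_one_of_pos (show 0 < (n : ℝ) / 4 by positivity)
    rw [Real.log_div hn0.ne' (by norm_num), show (4 : ℝ) = 2 ^ 2 by norm_num, Real.log_pow] at h2
    push_cast at h2
    linarith
  have h2 := Real.log_two_lt_d9
  have h3 : Real.log (2 ^ 25 * (n : ℝ) ^ 18) ≤ 40 / 3 * n := by
    rw [Real.log_mul (by positivity) (by positivity), Real.log_pow, Real.log_pow]
    push_cast
    linarith
  calc 12 * (n : ℝ) ^ 4 * Real.log (2 ^ 25 * (n : ℝ) ^ 18) ≤ 12 * (n : ℝ) ^ 4 * (40 / 3 * n) := by gcongr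
    _ = 160 * (n : ℝ) ^ 5 := by ring

theorem add_mul_log_pow_le {n : ℕ} (hn : 0 < n) {x : ℝ} (hx : 1 ≤ x) :
    (2 + n * Real.log x) ^ (2 * n ^ 2) ≤ (2 * (n : ℝ) ^ 3) ^ (2 * n ^ 2) * x := by
  have hn1 : (1 : ℝ) ≤ n := by exact_mod_cast hn
  have hl := Real.log_nonneg hx
  have h1 : 2 + n * Real.log x ≤ 2 * (n : ℝ) ^ 3 * Real.exp (Real.log x / (2 * n ^ 2)) := by
    calc 2 + n * Real.log x ≤ 2 * (n : ℝ) ^ 3 + n * Real.log x := by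
          have := one_le_pow₀ hn1 (n := 3)
          linarith
      _ = 2 * (n : ℝ) ^ 3 * (Real.log x / (2 * n ^ 2) + 1) := by
          field_simp
          ring
      _ ≤ _ := by
        gcongr
        exact Real.add_one_le_exp _
  calc (2 + n * Real.log x) ^ (2 * n ^ 2)
      ≤ (2 * (n : ℝ) ^ 3 * Real.exp (Real.log x / (2 * n ^ 2))) ^ (2 * n ^ 2) := by gcongr
    _ = (2 * (n : ℝ) ^ 3) ^ (2 * n ^ 2) * x := by
      rw [mul_pow, ← Real.exp_nat_mul]
      congr 1
      push_cast
      rw [mul_div_cancel₀ _ (by positivity), Real.exp_log (by linarith)]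

theorem cross_ratio_constant_le {n : ℕ} (hn : 4 ≤ n) {x δ : ℝ} (hx : 1 ≤ x)
    (hδ : δ = 1 / (40 * 2 ^ 25 * (n : ℝ) ^ 18)) :
    ∃ P : ℕ, 8 ^ n ^ 2 * x ^ (2 * n) * ((1 + n * Real.log x) / δ + 1) ^ n ^ 2 * (7 / δ + 1) ^ 4 ≤ P ∧
      10 * (P : ℝ) ^ 2 / δ ≤ 2 ^ (90 * n ^ 2) * (n : ℝ) ^ (53 * n ^ 2) * x ^ (5 * n - 3) := by
  have hn1 : (1 : ℝ) ≤ n := by exact_mod_cast (by omega : 1 ≤ n)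
  have hl := Real.log_nonneg hx
  obtain ⟨Q, hQ⟩ : ∃ Q : ℝ, Q = 40 * 2 ^ 25 * (n : ℝ) ^ 18 := ⟨_, rfl⟩
  have hn18 : (1 : ℝ) ≤ (n : ℝ) ^ 18 := one_le_pow₀ hn1
  have hQ1 : 1 ≤ Q := by rw [hQ]; linarith
  have hQle : Q ≤ 2 ^ 31 * (n : ℝ) ^ 18 := by
    rw [hQ]
    gcongr
    norm_num
  rw [← hQ] at hδ
  have hdiv : ∀ y, y / δ = y * Q := fun y => by rw [hδ, div_div_eq_mul_div, div_one]
  simp only [hdiv]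
  obtain ⟨Z, hZ⟩ : ∃ Z : ℝ, Z = 8 ^ n ^ 2 * x ^ (2 * n) * ((1 + n * Real.log x) * Q + 1) ^ n ^ 2 *
    (7 * Q + 1) ^ 4 := ⟨_, rfl⟩
  rw [← hZ]
  have hnl : 0 ≤ n * Real.log x := by positivity
  have hZ1 : 1 ≤ Z := by
    rw [hZ]
    have h1 : 1 ≤ (1 + n * Real.log x) * Q + 1 := by
      have : 0 ≤ (1 + n * Real.log x) * Q := by positivity
      linarith
    exact one_le_mul_of_one_le_of_one_le (one_le_mul_of_one_le_of_one_le
      (one_le_mul_of_one_le_of_one_le (one_le_pow₀ (by norm_num)) (one_le_pow₀ hx)) (one_le_pow₀ h1))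
      (one_le_pow₀ (by linarith))
  refine ⟨⌈Z⌉₊, Nat.le_ceil _, ?_⟩
  have hP : (⌈Z⌉₊ : ℝ) ≤ 2 * Z := by
    have := Nat.ceil_lt_add_one (zero_le_one.trans hZ1)
    linarith
  have hZ2 : Z ^ 2 ≤ 64 ^ n ^ 2 * x ^ (4 * n) * (Q ^ (2 * n ^ 2) * ((2 * (n : ℝ) ^ 3) ^ (2 * n ^ 2) * x)) *
      (8 * Q) ^ 8 := by
    have h1 : (1 + n * Real.log x) * Q + 1 ≤ Q * (2 + n * Real.log x) := by
      linarith
    have h2 : 7 * Q + 1 ≤ 8 * Q := by linarith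
    calc Z ^ 2 = 64 ^ n ^ 2 * x ^ (4 * n) * ((1 + n * Real.log x) * Q + 1) ^ (2 * n ^ 2) *
          (7 * Q + 1) ^ 8 := by
          rw [hZ, show (64 : ℝ) = 8 ^ 2 by norm_num, ← pow_mul, mul_comm 2 (n ^ 2), pow_mul, pow_mul,
            show 4 * n = 2 * n * 2 by ring, pow_mul _ (2 * n)]
          ring
      _ ≤ 64 ^ n ^ 2 * x ^ (4 * n) * (Q * (2 + n * Real.log x)) ^ (2 * n ^ 2) * (8 * Q) ^ 8 := by gcongr
      _ ≤ _ := by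
        rw [mul_pow Q]
        gcongr
        exact add_mul_log_pow_le (by omega) hx
  have hx_pow : x ^ (4 * n) * x ≤ x ^ (5 * n - 3) := by
    rw [← pow_succ]
    exact pow_le_pow_right₀ hx (by omega)
  calc 10 * (⌈Z⌉₊ : ℝ) ^ 2 * Q ≤ 10 * (2 * Z) ^ 2 * Q := by gcongr
    _ = 40 * Z ^ 2 * Q := by ring
    _ ≤ 40 * (64 ^ n ^ 2 * x ^ (4 * n) * (Q ^ (2 * n ^ 2) * ((2 * (n : ℝ) ^ 3) ^ (2 * n ^ 2) * x)) *
      (8 * Q) ^ 8) * Q := by gcongr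
    _ = 40 * 8 ^ 8 * Q ^ 9 * 64 ^ n ^ 2 * Q ^ (2 * n ^ 2) * (2 * (n : ℝ) ^ 3) ^ (2 * n ^ 2) *
      (x ^ (4 * n) * x) := by ring
    _ ≤ 2 ^ 30 * (2 ^ 31 * (n : ℝ) ^ 18) ^ 9 * 64 ^ n ^ 2 * (2 ^ 31 * (n : ℝ) ^ 18) ^ (2 * n ^ 2) *
      (2 * (n : ℝ) ^ 3) ^ (2 * n ^ 2) * x ^ (5 * n - 3) := by
        gcongr
        norm_num
    _ = 2 ^ (309 + 70 * n ^ 2) * (n : ℝ) ^ (162 + 42 * n ^ 2) * x ^ (5 * n - 3) := by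
        rw [show (64 : ℝ) = 2 ^ 6 by norm_num]
        generalize (2 : ℝ) = t
        simp only [mul_pow, ← pow_mul, pow_add]
        ring
    _ ≤ 2 ^ (90 * n ^ 2) * (n : ℝ) ^ (53 * n ^ 2) * x ^ (5 * n - 3) := by
        have h16 : 16 ≤ n ^ 2 := by nlinarith
        have e1 : (2 : ℝ) ^ (309 + 70 * n ^ 2) ≤ 2 ^ (90 * n ^ 2) :=
          pow_le_pow_right₀ (by norm_num) (by omega)
        have e2 : (n : ℝ) ^ (162 + 42 * n ^ 2) ≤ (n : ℝ) ^ (53 * n ^ 2) :=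
          pow_le_pow_right₀ hn1 (by omega)
        gcongr

theorem coeff_bound_le_exp {n : ℕ} (hn : 1 ≤ n) {x M B : ℝ} (hx : 1 ≤ x) (hB : 1 ≤ B)
    (hM : M ≤ B * x ^ (5 * n - 3)) (h5 : 1 ≤ 5 * n - 3) (hBle : 10 * n ^ 2 * B ≤ (4 ^ 2 * (n : ℝ) ^ 3) ^ (25 * n ^ 2)) :
    2 ^ n * x * (n * x * (n * Real.exp M) ^ 2) ^ n ≤
      Real.exp ((4 ^ 2 * (n : ℝ) ^ 3) ^ (25 * n ^ 2) * x ^ (5 * n - 3)) := by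
  have hn1 : (1 : ℝ) ≤ n := by exact_mod_cast hn
  obtain ⟨y, hy⟩ : ∃ y, y = x ^ (5 * n - 3) := ⟨_, rfl⟩
  have hxy : x ≤ y := hy ▸ le_self_pow₀ hx (by omega)
  rw [← hy] at hM ⊢
  have hself : ∀ z : ℝ, z ≤ Real.exp z := fun z => by linarith [Real.add_one_le_exp z]
  have h2 : (2 : ℝ) ≤ Real.exp 1 := by linarith [Real.add_one_le_exp 1]
  calc 2 ^ n * x * (n * x * (n * Real.exp M) ^ 2) ^ n
      ≤ Real.exp 1 ^ n * Real.exp x * (Real.exp n * Real.exp x * (Real.exp n * Real.exp M) ^ 2) ^ n := by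
        gcongr
        all_goals exact hself _
    _ = Real.exp (n + x + n * (n + x + 2 * (n + M))) := by
        simp only [← Real.exp_nat_mul, ← Real.exp_add]
        push_cast
        ring_nf
    _ ≤ _ := by
        refine Real.exp_le_exp.mpr (le_trans ?_ (mul_le_mul_of_nonneg_right hBle (by linarith)))
        have hy1 : 1 ≤ y := hx.trans hxy
        have hBy : y ≤ B * y := le_mul_of_one_le_left (by linarith) hB
        have hn2 : (n : ℝ) ≤ n ^ 2 := by nlinarith
        obtain ⟨V, hV⟩ : ∃ V, V = B * y := ⟨_, rfl⟩
        rw [mul_assoc, ← hV]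
        rw [← hV] at hM hBy
        have hV1 : 1 ≤ V := hy1.trans hBy
        have hxV : x ≤ V := hxy.trans hBy
        have a1 : (n : ℝ) ≤ n ^ 2 * V := by nlinarith
        have a2 : x ≤ n ^ 2 * V := by nlinarith
        have a3 : (n : ℝ) * n ≤ n ^ 2 * V := by nlinarith
        have a4 : n * x ≤ n ^ 2 * V := by nlinarith
        have a5 : n * M ≤ n ^ 2 * V := by nlinarith
        nlinarith

theorem final_constant_le (n : ℕ) :
    10 * n ^ 2 * (2 ^ (90 * n ^ 2) * (n : ℝ) ^ (53 * n ^ 2)) ≤ (4 ^ 2 * (n : ℝ) ^ 3) ^ (25 * n ^ 2) := by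
  rcases Nat.eq_zero_or_pos n with rfl | hn
  · simp
  have hn1 : (1 : ℝ) ≤ n := by exact_mod_cast hn
  have h1 : 10 * (n : ℝ) ^ 2 ≤ 2 ^ (10 * n ^ 2) := by
    exact_mod_cast (Nat.lt_two_pow_self (n := 10 * n ^ 2)).le
  calc 10 * n ^ 2 * (2 ^ (90 * n ^ 2) * (n : ℝ) ^ (53 * n ^ 2))
      ≤ 2 ^ (10 * n ^ 2) * (2 ^ (90 * n ^ 2) * (n : ℝ) ^ (75 * n ^ 2)) := by
        gcongr
        norm_num
    _ = (4 ^ 2 * (n : ℝ) ^ 3) ^ (25 * n ^ 2) := by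
        rw [show (4 : ℝ) ^ 2 = 2 ^ 4 by norm_num, mul_pow, ← pow_mul, ← pow_mul, ← mul_assoc, ← pow_add]
        congr 2 <;> ring

end

section

open Polynomial

variable {n : ℕ} {θ : Fin n → ℂ} {f : ℤ[X]} {c D : ℤ}

theorem log_abs_eq_of_eq_prod_sq (hc : c ≠ 0) (hn : 1 ≤ n) (hinj : Function.Injective θ)
    (hdisc : (D : ℂ) = (c : ℂ) ^ (2 * n - 2) * ∏ i, ∏ j, if i < j then (θ i - θ j) ^ 2 else 1) :
    Real.log |(D : ℝ)| = (2 * n - 2) * Real.log |(c : ℝ)| + ∑ i, ∑ j, Real.log ‖θ i - θ j‖ := by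
  have hcC : (c : ℂ) ≠ 0 := by exact_mod_cast hc
  have hne : ∏ i, ∏ j, (if i < j then (θ i - θ j) ^ 2 else 1) ≠ 0 := by
    refine Finset.prod_ne_zero_iff.mpr fun i _ => Finset.prod_ne_zero_iff.mpr fun j _ => ?_
    split_ifs with h
    · exact pow_ne_zero _ (sub_ne_zero.mpr (hinj.ne h.ne))
    · exact one_ne_zero
  rw [← log_norm_prod_sq hinj, ← Complex.norm_intCast, ← Complex.norm_intCast, hdisc, norm_mul, norm_pow,
    Real.log_mul (by positivity) (norm_ne_zero_iff.mpr hne), Real.log_pow, Nat.cast_sub (by omega)]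
  push_cast
  rfl

theorem exists_logCrossRatio_bound (hn : 4 ≤ n) (hc : c ≠ 0) (hD : D ≠ 0)
    (hf : f.map (Int.castRingHom ℂ) = C (c : ℂ) * ∏ i, (X - C (θ i))) (hinj : Function.Injective θ)
    (hdisc : (D : ℂ) = (c : ℂ) ^ (2 * n - 2) * ∏ i, ∏ j, if i < j then (θ i - θ j) ^ 2 else 1) :
    ∃ M : ℝ, 0 ≤ M ∧ (∀ q : Fin 4 → Fin n, Function.Injective q → logCrossRatio θ q ≤ M) ∧
      M ≤ 2 ^ (90 * n ^ 2) * (n : ℝ) ^ (53 * n ^ 2) * |(D : ℝ)| ^ (5 * n - 3) := by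
  have hn0 : (0 : ℝ) < n := by exact_mod_cast (by omega : 0 < n)
  have hn1 : (1 : ℝ) ≤ n := by exact_mod_cast (by omega : 1 ≤ n)
  have hD1 : (1 : ℝ) ≤ |(D : ℝ)| := by exact_mod_cast Int.one_le_abs hD
  obtain ⟨δ, hδ⟩ : ∃ δ : ℝ, δ = 1 / (40 * 2 ^ 25 * (n : ℝ) ^ 18) := ⟨_, rfl⟩
  have h40 : 40 * δ = 1 / (2 ^ 25 * (n : ℝ) ^ 18) := by
    rw [hδ]
    field_simp
  have hδ0 : 0 < δ := by
    rw [hδ]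
    positivity
  obtain ⟨P, hP, hPle⟩ := cross_ratio_constant_le hn hD1 hδ
  refine ⟨10 * P ^ 2 / δ, by positivity, fun q hq => ?_, hPle⟩
  refine logCrossRatio_le hc hD hf (isIntegral_rat_of_map_eq hc hf) hinj
    (by rw [det_vandermonde_sq_eq, ← hdisc]) hδ0 ?_ hP (L := 160 * n ^ 5) (by positivity) ?_ ?_ q hq
  · rw [hδ, div_le_one (by positivity)]
    have := one_le_pow₀ hn1 (n := 18)
    linarith
  · rw [h40, one_div_one_div]
    push_cast
    exact mul_log_pow_mul_pow_le hn
  · rw [h40, mul_one_div, div_le_one (by positivity)]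
    push_cast
    have : 0 < (n : ℝ) ^ 18 := by positivity
    linarith

end

/-- every `f` of degree `n ≥ 2` and nonzero discriminant `D` is
`GL₂(ℤ)`-equivalent to a polynomial of height at most
`exp((4²n³)^(25n²) · |D|^(5n-3))`. -/
theorem gl2_representative_height_bound (n : ℕ) (hn : 2 ≤ n) (f : Polynomial ℤ)
    (hfn : f.natDegree = n) (D : ℤ) (hD : D ≠ 0) (hdisc : discC f = (D : ℂ)) :
    ∃ fstar : Polynomial ℤ, GL2Equiv n f fstar ∧
      ∀ k : ℕ, (|fstar.coeff k| : ℝ) ≤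
        Real.exp ((((4 : ℝ) ^ 2 * (n : ℝ) ^ 3) ^ (25 * n ^ 2)) * (|D| : ℝ) ^ (5 * n - 3)) := by
  obtain ⟨θ, hf, hprod⟩ := exists_roots_of_discC hfn hdisc
  have hc : f.leadingCoeff ≠ 0 := by
    rw [Ne, Polynomial.leadingCoeff_eq_zero]
    rintro rfl
    simp at hfn
    omega
  have hDC : (D : ℂ) ≠ 0 := by exact_mod_cast hD
  have hinj : Function.Injective θ := injective_of_prod_sq_ne_zero (right_ne_zero_of_mul (hprod ▸ hDC))
  have hD1 : (1 : ℝ) ≤ |(D : ℝ)| := by exact_mod_cast Int.one_le_abs hD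
  have hn1 : (1 : ℝ) ≤ n := by exact_mod_cast (by omega : 1 ≤ n)
  suffices h : ∃ m : Matrix (Fin 2) (Fin 2) ℤ, IsUnit m.det ∧ ∀ k, |((glTranslate n f m).coeff k : ℝ)| ≤
      Real.exp ((((4 : ℝ) ^ 2 * (n : ℝ) ^ 3) ^ (25 * n ^ 2)) * (|D| : ℝ) ^ (5 * n - 3)) by
    obtain ⟨m, hm, hk⟩ := h
    exact ⟨glTranslate n f m, ⟨m, hm, Or.inl rfl⟩, hk⟩
  rcases hn.eq_or_lt with rfl | hn3
  · obtain ⟨m, hm, hk⟩ := exists_glTranslate_two_coeff_le hD (coeff_disc_eq hf hprod)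
    refine ⟨m, hm, fun k => ?_⟩
    have h1 : |((glTranslate 2 f m).coeff k : ℝ)| ≤ |(D : ℝ)| := by exact_mod_cast hk k
    have h2 : |(D : ℝ)| ≤ |(D : ℝ)| ^ (5 * 2 - 3) := le_self_pow₀ hD1 (by norm_num)
    have h3 : 1 ≤ ((4 : ℝ) ^ 2 * ((2 : ℕ) : ℝ) ^ 3) ^ (25 * 2 ^ 2) := one_le_pow₀ (by norm_num)
    have h4 := le_mul_of_one_le_left (zero_le_one.trans (hD1.trans h2)) h3
    exact h1.trans (h2.trans (h4.trans ((lt_add_one _).le.trans (Real.add_one_le_exp _))))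
  · obtain ⟨M, hM0, hM, hMle⟩ : ∃ M : ℝ, 0 ≤ M ∧
        (∀ q : Fin 4 → Fin n, Function.Injective q → logCrossRatio θ q ≤ M) ∧
        M ≤ 2 ^ (90 * n ^ 2) * (n : ℝ) ^ (53 * n ^ 2) * |(D : ℝ)| ^ (5 * n - 3) := by
      rcases (show 3 ≤ n from hn3).eq_or_lt with rfl | hn4
      · refine ⟨0, le_rfl, fun q hq => ?_, by positivity⟩
        have := Fintype.card_le_of_injective q hq
        simp at this
      · exact exists_logCrossRatio_bound hn4 hc hD hf hinj hprod
    obtain ⟨m, hm, hk⟩ := exists_glTranslate_coeff_le hc hD hf hinj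
      (log_abs_eq_of_eq_prod_sq hc (by omega) hinj hprod) hn3 hM0 hM
    refine ⟨m, hm, fun k => (hk k).trans ?_⟩
    exact coeff_bound_le_exp (by omega) hD1 (one_le_mul_of_one_le_of_one_le (one_le_pow₀ (by norm_num))
      (one_le_pow₀ hn1)) hMle (by omega) (final_constant_le n)
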